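/- Let k be a perfect field of characteristic p > 0 and let π, ρ : P_{F_p} → V_k be additive functors from finite-dimensional F_p-vector spaces to k-vector spaces. Then for every natural number n, the group Ext^n_{F(P_{F_p},k)}(π, ρ) is isomorphic as a k-vector space to Hom_k(π(F_p), ρ(F_p)) if n is even, and is zero if n is odd. -/

import Mathlib

/-! STATEMENT 3: for a perfect field `k` of characteristic `p > 0` and additive functors
`π ρ : P_{F_p} ⥤ V_k`, the group `Ext^n_{F(P_{F_p},k)}(π, ρ)` is isomorphic as a `k`-vector
space to `Hom_k(π(F_p), ρ(F_p))` when `n` is even, and vanishes when `n` is odd. -/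

universe w u

open CategoryTheory

namespace CategoryTheory.Abelian.Ext

variable {R : Type*} [CommRing R] {C : Type*} [Category C] [Abelian C] [Linear R C]
  [HasExt.{w} C]

lemma mk₀_add' {X Y : C} (f g : X ⟶ Y) :
    Ext.mk₀ (f + g) = (Ext.mk₀ f + Ext.mk₀ g : Ext X Y 0) := by
  letI := HasDerivedCategory.standard C
  ext
  rw [Ext.add_hom, Ext.mk₀_hom, Ext.mk₀_hom, Ext.mk₀_hom, Functor.map_add]
  simp [ShiftedHom.mk₀, Preadditive.add_comp]

/-- Scalar multiplication on Ext-groups in an `R`-linear abelian category, given by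
Yoneda composition with `c • 𝟙 X`.  With this action, `Ext X Y n` is an `R`-module
(a `k`-vector space when `R = k` is a field). -/
noncomputable instance module (X Y : C) (n : ℕ) : Module R (Ext X Y n) where
  smul c α := (Ext.mk₀ (c • 𝟙 X)).comp α (zero_add n)
  one_smul α := by
    show (Ext.mk₀ ((1 : R) • 𝟙 X)).comp α (zero_add n) = α
    rw [one_smul]
    exact Ext.mk₀_id_comp α
  mul_smul c d α := by
    show (Ext.mk₀ ((c * d) • 𝟙 X)).comp α (zero_add n) =
      (Ext.mk₀ (c • 𝟙 X)).comp ((Ext.mk₀ (d • 𝟙 X)).comp α (zero_add n)) (zero_add n)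
    rw [Ext.mk₀_comp_mk₀_assoc, Linear.smul_comp, Linear.comp_smul, smul_smul, Category.id_comp]
  smul_zero c := by
    show (Ext.mk₀ (c • 𝟙 X)).comp (0 : Ext X Y n) (zero_add n) = 0
    simp
  smul_add c α β := by
    show (Ext.mk₀ (c • 𝟙 X)).comp (α + β) (zero_add n) = _
    rw [Ext.comp_add]
    rfl
  add_smul c d α := by
    show (Ext.mk₀ ((c + d) • 𝟙 X)).comp α (zero_add n) = _
    rw [add_smul, mk₀_add', Ext.add_comp]
    rfl
  zero_smul α := by
    show (Ext.mk₀ ((0 : R) • 𝟙 X)).comp α (zero_add n) = 0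
    rw [zero_smul, Ext.mk₀_zero, Ext.zero_comp]

end CategoryTheory.Abelian.Ext

open CategoryTheory Abelian

namespace DjamentTouze

section ExtGeneral

variable (R : Type*) [CommRing R] {C : Type*} [Category C] [Abelian C] [Linear R C]
  [HasExt.{w} C] (X : C)

lemma smul_ext_def {X Y : C} {n : ℕ} (c : R) (x : Ext X Y n) :
    c • x = (Ext.mk₀ (c • 𝟙 X)).comp x (zero_add n) := rfl

/-- Postcomposition with an extension class, as a linear map. -/
noncomputable def extComp {Y Z : C} {b : ℕ} (β : Ext Y Z b) {a c : ℕ} (h : a + b = c) :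
    Ext X Y a →ₗ[R] Ext X Z c where
  toFun x := x.comp β h
  map_add' x y := by simp
  map_smul' r x := by
    simp only [smul_ext_def, RingHom.id_apply]
    exact Ext.comp_assoc _ _ _ _ _ (by omega)

/-- The linear map induced on `Ext` groups by a morphism of the second variable. -/
noncomputable abbrev extMap {Y Z : C} (f : Y ⟶ Z) (n : ℕ) : Ext X Y n →ₗ[R] Ext X Z n :=
  extComp R X (Ext.mk₀ f) (add_zero n)

lemma extComp_apply {Y Z : C} {b : ℕ} (β : Ext Y Z b) {a c : ℕ} (h : a + b = c)
    (x : Ext X Y a) : extComp R X β h x = x.comp β h := rfl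

lemma extMap_extMap {Y Z T : C} (f : Y ⟶ Z) (g : Z ⟶ T) (n : ℕ) (x : Ext X Y n) :
    extMap R X g n (extMap R X f n x) = extMap R X (f ≫ g) n x := by
  simp [extComp_apply]

@[simp] lemma extMap_id {Y : C} (n : ℕ) (x : Ext X Y n) : extMap R X (𝟙 Y) n x = x := by
  simp [extComp_apply]

@[simp] lemma extMap_zero {Y Z : C} (n : ℕ) (x : Ext X Y n) :
    extMap R X (0 : Y ⟶ Z) n x = 0 := by
  simp [extComp_apply]

lemma extMap_add {Y Z : C} (f g : Y ⟶ Z) (n : ℕ) (x : Ext X Y n) :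
    extMap R X (f + g) n x = extMap R X f n x + extMap R X g n x := by
  simp [extComp_apply, Ext.mk₀_add']

lemma extMap_sum {ι : Type*} (s : Finset ι) {Y Z : C} (f : ι → (Y ⟶ Z)) (n : ℕ)
    (x : Ext X Y n) : extMap R X (∑ i ∈ s, f i) n x = ∑ i ∈ s, extMap R X (f i) n x := by
  classical
  induction s using Finset.induction_on with
  | empty => simp
  | insert a s ha ih => rw [Finset.sum_insert ha, Finset.sum_insert ha, extMap_add, ih]

/-- The Hom space as a degree zero Ext group. -/
noncomputable def extZeroEquiv (Y : C) : (X ⟶ Y) ≃ₗ[R] Ext X Y 0 where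
  toFun f := Ext.mk₀ f
  invFun := Ext.homEquiv₀
  left_inv f := Ext.homEquiv₀.apply_symm_apply f
  right_inv x := Ext.homEquiv₀.symm_apply_apply x
  map_add' f g := Ext.mk₀_add' f g
  map_smul' r f := by
    simp [smul_ext_def, Ext.mk₀_comp_mk₀]

/-- All Ext groups out of `X` into `T` vanish. -/
def Acyc (T : C) : Prop := ∀ n, Subsingleton (Ext X T n)

/-- `f` induces isomorphisms on all Ext groups out of `X`. -/
def ExtIso {Y Z : C} (f : Y ⟶ Z) : Prop := ∀ n, Function.Bijective fun x : Ext X Y n ↦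
  x.comp (Ext.mk₀ f) (add_zero n)

variable {X} in
/-- The linear equivalences given by a morphism which is invertible on Ext. -/
noncomputable def ExtIso.equiv {Y Z : C} {f : Y ⟶ Z} (hf : ExtIso X f) (n : ℕ) :
    Ext X Y n ≃ₗ[R] Ext X Z n :=
  LinearEquiv.ofBijective (extMap R X f n) (hf n)

variable {X}

omit [Linear R C] in
lemma ExtIso.of_isIso {Y Z : C} (f : Y ⟶ Z) [IsIso f] : ExtIso X f := by
  intro n
  refine Function.bijective_iff_has_inverse.2 ⟨fun x ↦ x.comp (Ext.mk₀ (inv f)) (add_zero n), ?_, ?_⟩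
    <;> intro x <;> simp

lemma ExtIso.comp {Y Z T : C} {f : Y ⟶ Z} {g : Z ⟶ T} (hf : ExtIso X f) (hg : ExtIso X g) :
    ExtIso X (f ≫ g) := by
  intro n
  have := (hg n).comp (hf n)
  convert this using 2 with x
  simp

lemma ExtIso.of_comp_left {Y Z T : C} {f : Y ⟶ Z} {g : Z ⟶ T} (hf : ExtIso X f)
    (h : ExtIso X (f ≫ g)) : ExtIso X g := by
  intro n
  have h1 := h n
  have : (fun x : Ext X Y n ↦ x.comp (Ext.mk₀ (f ≫ g)) (add_zero n)) =
    (fun x : Ext X Z n ↦ x.comp (Ext.mk₀ g) (add_zero n)) ∘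
      (fun x : Ext X Y n ↦ x.comp (Ext.mk₀ f) (add_zero n)) := by
    ext1 x; simp
  rw [this] at h1
  exact (Function.Bijective.of_comp_iff _ (hf n)).1 h1

/-- If the identity of `T` is a sum of maps factoring through acyclic objects, `T` is acyclic. -/
lemma Acyc.of_sum {ι : Type*} (s : Finset ι) {T : C} (U : ι → C) (a : ∀ i, T ⟶ U i)
    (b : ∀ i, U i ⟶ T) (hU : ∀ i ∈ s, Acyc X (U i)) (h : ∑ i ∈ s, a i ≫ b i = 𝟙 T) :
    Acyc X T := by
  refine fun n ↦ subsingleton_of_forall_eq 0 fun x ↦ ?_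
  rw [← extMap_id ℤ X n x, ← h, extMap_sum]
  refine Finset.sum_eq_zero fun i hi ↦ ?_
  have := hU i hi n
  rw [← extMap_extMap, Subsingleton.elim (extMap ℤ X (a i) n x) 0, map_zero]

lemma Acyc.of_retract {T U : C} (a : T ⟶ U) (b : U ⟶ T) (h : a ≫ b = 𝟙 T) (hU : Acyc X U) :
    Acyc X T :=
  Acyc.of_sum (Finset.univ : Finset Unit) (fun _ ↦ U) (fun _ ↦ a) (fun _ ↦ b)
    (fun _ _ ↦ hU) (by simpa using h)

/-- A split monomorphism whose complement factors through acyclic objects is an Ext-isomorphism. -/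
lemma ExtIso.of_sum {ι : Type*} (s : Finset ι) {T T' : C} (f : T ⟶ T') (g : T' ⟶ T)
    (hfg : f ≫ g = 𝟙 T) (U : ι → C) (a : ∀ i, T' ⟶ U i)
    (b : ∀ i, U i ⟶ T') (hU : ∀ i ∈ s, Acyc X (U i)) (h : g ≫ f + ∑ i ∈ s, a i ≫ b i = 𝟙 T') :
    ExtIso X f := by
  intro n
  refine Function.bijective_iff_has_inverse.2 ⟨extMap ℤ X g n, ?_, ?_⟩
  · intro x
    exact (extMap_extMap ℤ X f g n x).trans (by rw [hfg, extMap_id])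
  · intro x
    refine (extMap_extMap ℤ X g f n x).trans ?_
    conv_rhs => rw [← extMap_id ℤ X n x, ← h, extMap_add, extMap_sum]
    rw [left_eq_add]
    refine Finset.sum_eq_zero fun i hi ↦ ?_
    have := hU i hi n
    rw [← extMap_extMap, Subsingleton.elim (extMap ℤ X (a i) n x) 0, map_zero]

section SES

variable {S : ShortComplex C} (hS : S.ShortExact)

include hS in
lemma subsingleton_ext_right {n : ℕ} (h₂ : Subsingleton (Ext X S.X₂ n))
    (h₁ : Subsingleton (Ext X S.X₁ (n + 1))) : Subsingleton (Ext X S.X₃ n) :=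
  subsingleton_of_forall_eq 0 fun x ↦ by
    obtain ⟨y, rfl⟩ := Ext.covariant_sequence_exact₃ X hS x rfl (Subsingleton.elim _ _)
    rw [Subsingleton.elim y 0, Ext.zero_comp]

include hS in
lemma subsingleton_ext_left_succ {n : ℕ} (h₃ : Subsingleton (Ext X S.X₃ n))
    (h₂ : Subsingleton (Ext X S.X₂ (n + 1))) : Subsingleton (Ext X S.X₁ (n + 1)) :=
  subsingleton_of_forall_eq 0 fun x ↦ by
    obtain ⟨y, rfl⟩ := Ext.covariant_sequence_exact₁ X hS x (Subsingleton.elim _ _) rfl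
    rw [Subsingleton.elim y 0, Ext.zero_comp]

include hS in
lemma subsingleton_ext_left_zero (h₂ : Subsingleton (Ext X S.X₂ 0)) :
    Subsingleton (Ext X S.X₁ 0) := by
  have := hS.mono_f
  exact (Ext.postcomp_mk₀_injective_of_mono X S.f).subsingleton

include hS in
lemma ext_f_bijective_of_right {n : ℕ} (h₃ : Subsingleton (Ext X S.X₃ n))
    (h : ∀ m, m + 1 = n → Subsingleton (Ext X S.X₃ m)) :
    Function.Bijective (extMap R X S.f n) := by
  constructor
  · cases n with
    | zero => have := hS.mono_f
              exact Ext.postcomp_mk₀_injective_of_mono X S.f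
    | succ n =>
      have := h n rfl
      refine (injective_iff_map_eq_zero _).2 fun x hx ↦ ?_
      obtain ⟨y, rfl⟩ := Ext.covariant_sequence_exact₁ X hS x hx rfl
      rw [Subsingleton.elim y 0, Ext.zero_comp]
  · intro x
    exact Ext.covariant_sequence_exact₂ X hS x (Subsingleton.elim _ _)

lemma ext_δ_bijective {n : ℕ} (h₂ : Subsingleton (Ext X S.X₂ n))
    (h₂' : Subsingleton (Ext X S.X₂ (n + 1))) :
    Function.Bijective (extComp R X hS.extClass (rfl : n + 1 = n + 1)) := by
  constructor
  · refine (injective_iff_map_eq_zero _).2 fun x hx ↦ ?_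
    obtain ⟨y, rfl⟩ := Ext.covariant_sequence_exact₃ X hS x rfl hx
    rw [Subsingleton.elim y 0, Ext.zero_comp]
  · intro x
    exact Ext.covariant_sequence_exact₁ X hS x (Subsingleton.elim _ _) rfl

include hS in
lemma Acyc.right (h₁ : Acyc X S.X₁) (h₂ : Acyc X S.X₂) : Acyc X S.X₃ :=
  fun n ↦ subsingleton_ext_right hS (h₂ n) (h₁ (n + 1))

include hS in
lemma ExtIso.of_acyc_right (h₃ : Acyc X S.X₃) : ExtIso X S.f :=
  fun n ↦ ext_f_bijective_of_right ℤ hS (h₃ n) (fun m _ ↦ h₃ m)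

/-- A morphism of short exact sequences which is an Ext-isomorphism on the left and the identity
on the right is an Ext-isomorphism in the middle. -/
lemma ExtIso.mid_of_left {S S' : ShortComplex C} (hS : S.ShortExact) (hS' : S'.ShortExact)
    (φ : S ⟶ S') (h₁ : ExtIso X φ.τ₁) (h₃ : IsIso φ.τ₃) : ExtIso X φ.τ₂ := by
  have e : ∀ {n} (x : Ext X S.X₁ n), (x.comp (Ext.mk₀ S.f) (add_zero n)).comp
      (Ext.mk₀ φ.τ₂) (add_zero n) = (x.comp (Ext.mk₀ φ.τ₁) (add_zero n)).comp
      (Ext.mk₀ S'.f) (add_zero n) := fun x ↦ by simp [φ.comm₁₂]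
  have e' : ∀ {n} (x : Ext X S.X₂ n), (x.comp (Ext.mk₀ S.g) (add_zero n)).comp
      (Ext.mk₀ φ.τ₃) (add_zero n) = (x.comp (Ext.mk₀ φ.τ₂) (add_zero n)).comp
      (Ext.mk₀ S'.g) (add_zero n) := fun x ↦ by simp [φ.comm₂₃]
  have e'' : ∀ {n} (x : Ext X S.X₃ n), (x.comp (Ext.mk₀ φ.τ₃) (add_zero n)).comp
      hS'.extClass rfl = (x.comp hS.extClass rfl).comp (Ext.mk₀ φ.τ₁) (add_zero _) := fun x ↦ by
    rw [Ext.comp_assoc_of_second_deg_zero, ← ShortComplex.ShortExact.extClass_naturality hS,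
      Ext.comp_assoc_of_third_deg_zero]
  have h₃' : ExtIso X φ.τ₃ := ExtIso.of_isIso _
  intro n
  constructor
  · refine (injective_iff_map_eq_zero (extMap ℤ X φ.τ₂ n)).2 fun x hx ↦ ?_
    change x.comp (Ext.mk₀ φ.τ₂) (add_zero n) = 0 at hx
    obtain ⟨y, rfl⟩ := Ext.covariant_sequence_exact₂ X hS x (by
      apply (h₃' n).1
      simp only [e', hx, Ext.zero_comp])
    rw [e] at hx
    cases n with
    | zero =>
      have := hS'.mono_f
      have h0 := (Ext.postcomp_mk₀_injective_of_mono X S'.f)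
        (a₁ := y.comp (Ext.mk₀ φ.τ₁) (add_zero 0)) (a₂ := 0) (hx.trans (by simp))
      rw [(h₁ 0).1 (a₁ := y) (a₂ := 0) (by simpa using h0), Ext.zero_comp]
    | succ n =>
      obtain ⟨z, hz⟩ := Ext.covariant_sequence_exact₁ X hS' _ hx rfl
      obtain ⟨z, rfl⟩ := (h₃' n).2 z
      rw [e''] at hz
      rw [← (h₁ _).1 hz]
      rw [Ext.comp_assoc_of_third_deg_zero, ShortComplex.ShortExact.extClass_comp, Ext.comp_zero]
  · intro x
    obtain ⟨c, hc⟩ := (h₃' n).2 (x.comp (Ext.mk₀ S'.g) (add_zero n))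
    obtain ⟨b, rfl⟩ := Ext.covariant_sequence_exact₃ X hS c rfl (by
      apply (h₁ _).1
      simp only [← e'', Ext.zero_comp]
      dsimp only at hc
      rw [hc, Ext.comp_assoc_of_second_deg_zero, ShortComplex.ShortExact.comp_extClass,
        Ext.comp_zero])
    dsimp only at hc
    rw [e'] at hc
    obtain ⟨a, ha⟩ := Ext.covariant_sequence_exact₂ X hS'
      (x - b.comp (Ext.mk₀ φ.τ₂) (add_zero n)) (by
        rw [← extComp_apply ℤ, map_sub, extComp_apply, extComp_apply, hc, sub_self])
    obtain ⟨a, rfl⟩ := (h₁ n).2 a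
    refine ⟨a.comp (Ext.mk₀ S.f) (add_zero n) + b, ?_⟩
    dsimp only at ha ⊢
    rw [Ext.add_comp, e, ha, sub_add_cancel]

end SES

end ExtGeneral

section FunctorCategory

/-- The category of finite-dimensional vector spaces over the prime field. -/
abbrev FV (p : ℕ) [Fact p.Prime] := FGModuleCat.{0} (ZMod p)

/-- Functors from finite-dimensional `F_p`-vector spaces to `k`-vector spaces. -/
abbrev Fun (k : Type u) [Field k] (p : ℕ) [Fact p.Prime] := FV p ⥤ ModuleCat.{u} k

variable {k : Type u} [Field k] {p : ℕ} [Fact p.Prime]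

lemma nat_apply {F G : Fun k p} (f : F ⟶ G) {V U : FV p} (g : V ⟶ U) (x : F.obj V) :
    f.app U (F.map g x) = G.map g (f.app V x) :=
  NatTrans.naturality_apply f g x

lemma map_map_apply (F : Fun k p) {V U Z : FV p} (g : V ⟶ U) (h : U ⟶ Z) (x : F.obj V) :
    F.map h (F.map g x) = F.map (g ≫ h) x := by
  simp

lemma fun_hom_ext {F G : Fun k p} {f g : F ⟶ G} (h : ∀ V (x : F.obj V), f.app V x = g.app V x) :
    f = g := by
  ext V x
  exact h V x

lemma mono_of_injective {F G : Fun k p} (f : F ⟶ G) (h : ∀ V, Function.Injective (f.app V)) :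
    Mono f :=
  (NatTrans.mono_iff_mono_app f).2 fun V ↦ (ModuleCat.mono_iff_injective _).2 (h V)

lemma injective_of_mono {F G : Fun k p} (f : F ⟶ G) [Mono f] (V : FV p) :
    Function.Injective (f.app V) :=
  (ModuleCat.mono_iff_injective _).1 ((NatTrans.mono_iff_mono_app f).1 inferInstance V)

lemma epi_of_surjective {F G : Fun k p} (f : F ⟶ G) (h : ∀ V, Function.Surjective (f.app V)) :
    Epi f :=
  (NatTrans.epi_iff_epi_app f).2 fun V ↦ (ModuleCat.epi_iff_surjective _).2 (h V)

lemma surjective_of_epi {F G : Fun k p} (f : F ⟶ G) [Epi f] (V : FV p) :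
    Function.Surjective (f.app V) :=
  (ModuleCat.epi_iff_surjective _).1 ((NatTrans.epi_iff_epi_app f).1 inferInstance V)

lemma isIso_of_bijective {F G : Fun k p} (f : F ⟶ G) (h : ∀ V, Function.Bijective (f.app V)) :
    IsIso f := by
  have := mono_of_injective f fun V ↦ (h V).1
  have := epi_of_surjective f fun V ↦ (h V).2
  exact isIso_of_mono_of_epi f

/-- Short exactness of a sequence of functors can be checked pointwise. -/
lemma shortExact_of_pointwise (S : ShortComplex (Fun k p))
    (hf : ∀ V, Function.Injective (S.f.app V)) (hg : ∀ V, Function.Surjective (S.g.app V))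
    (h : ∀ V (x : S.X₂.obj V), S.g.app V x = 0 → ∃ y, S.f.app V y = x) : S.ShortExact := by
  have := mono_of_injective _ hf
  have := epi_of_surjective _ hg
  refine ShortComplex.ShortExact.mk ?_
  rw [ShortComplex.exact_iff_isZero_homology]
  refine Functor.isZero _ fun V ↦ ?_
  refine Limits.IsZero.of_iso ?_ (S.mapHomologyIso ((evaluation _ _).obj V)).symm
  rw [← ShortComplex.exact_iff_isZero_homology]
  rw [ShortComplex.moduleCat_exact_iff]
  exact h V

lemma shortExact_app {S : ShortComplex (Fun k p)} (hS : S.ShortExact) {V : FV p}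
    (x : S.X₂.obj V) (hx : S.g.app V x = 0) : ∃ y, S.f.app V y = x := by
  have := (hS.map_of_exact ((evaluation (FV p) (ModuleCat.{u} k)).obj V)).exact
  rw [ShortComplex.moduleCat_exact_iff] at this
  exact this x hx

/-- The standard vector spaces. -/
abbrev std (p : ℕ) [Fact p.Prime] (n : ℕ) : FV p := FGModuleCat.of (ZMod p) (Fin n → ZMod p)

/-- Every finite-dimensional space is isomorphic to a standard one. -/
noncomputable def isoStd (V : FV p) : V ≅ std p (Module.finrank (ZMod p) V) :=
  LinearEquiv.toFGModuleCatIso (V := V) (Module.finBasis (ZMod p) V).equivFun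

instance (V U : FV p) : Finite (V ⟶ U) :=
  have : Finite V := Module.finite_of_finite (ZMod p)
  have : Finite U := Module.finite_of_finite (ZMod p)
  Finite.of_injective (fun f : V ⟶ U ↦ (f.hom.hom : V → U)) fun f g h ↦ by
    apply FGModuleCat.hom_ext
    exact DFunLike.coe_injective h

/-- The coinduced functor `V ↦ W^(Hom(V, E))`. -/
noncomputable def coind (E : FV p) (W : ModuleCat.{u} k) : Fun k p where
  obj V := ModuleCat.of k ((V ⟶ E) → W)
  map g := ModuleCat.ofHom (LinearMap.funLeft k W (fun h ↦ g ≫ h))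
  map_id V := by ext f; rfl
  map_comp f g := by ext x h; exact congrArg x (Category.assoc f g h)

/-- Morphisms into a coinduced functor. -/
noncomputable def coindLift {G : Fun k p} {E : FV p} {W : ModuleCat.{u} k}
    (f : G.obj E →ₗ[k] W) : G ⟶ coind E W where
  app V := ModuleCat.ofHom (LinearMap.pi fun h ↦ f ∘ₗ (G.map h).hom)
  naturality V U g := by
    ext x
    funext h
    exact congrArg f (map_map_apply G g h x)

/-- The adjunction between evaluation and coinduction. -/
noncomputable def coindEquiv (G : Fun k p) (E : FV p) (W : ModuleCat.{u} k) :
    (G ⟶ coind E W) ≃ₗ[k] (G.obj E →ₗ[k] W) where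
  toFun f := LinearMap.proj (φ := fun _ : E ⟶ E ↦ (W : Type u)) (𝟙 E) ∘ₗ (f.app E).hom
  invFun f := coindLift f
  map_add' f g := rfl
  map_smul' c f := rfl
  left_inv f := by
    refine fun_hom_ext fun V x ↦ funext fun h ↦ ?_
    have h1 : (f.app E (G.map h x) : (E ⟶ E) → W) (𝟙 E) = (f.app V x : (V ⟶ E) → W) (h ≫ 𝟙 E) :=
      congrFun (nat_apply f h x) (𝟙 E)
    rw [Category.comp_id] at h1
    exact h1
  right_inv f := by
    ext x
    exact congrArg f (by simp : G.map (𝟙 E) x = x)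

lemma coindEquiv_comp {X Y : Fun k p} {E : FV p} {W : ModuleCat.{u} k} (f : X ⟶ Y)
    (g : Y ⟶ coind E W) : coindEquiv X E W (f ≫ g) = coindEquiv Y E W g ∘ₗ (f.app E).hom := rfl

instance coind_injective (E : FV p) (W : ModuleCat.{u} k) : Injective (coind E W) where
  factors {X Y} g f _ := by
    obtain ⟨r, hr⟩ := LinearMap.exists_leftInverse_of_injective (f.app E).hom
      (LinearMap.ker_eq_bot.2 (injective_of_mono f E))
    refine ⟨(coindEquiv _ E W).symm ((coindEquiv _ E W g) ∘ₗ r), ?_⟩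
    apply (coindEquiv _ E W).injective
    rw [coindEquiv_comp, LinearEquiv.apply_symm_apply, LinearMap.comp_assoc, hr,
      LinearMap.comp_id]

instance : EnoughInjectives (Fun k p) where
  presentation G := by
    let J := ∏ᶜ fun n : ℕ ↦ coind (std p n) (G.obj (std p n))
    let u : G ⟶ J := Limits.Pi.lift fun n : ℕ ↦ coindLift (LinearMap.id)
    refine ⟨⟨J, inferInstance, u, ?_⟩⟩
    refine Preadditive.mono_of_cancel_zero _ fun {H} f hf ↦ ?_
    refine fun_hom_ext fun V x ↦ ?_
    have h1 : f ≫ coindLift (E := std p (Module.finrank (ZMod p) V)) LinearMap.id = 0 := by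
      have : f ≫ u ≫ Limits.Pi.π _ (Module.finrank (ZMod p) V) = 0 := by
        rw [reassoc_of% hf, Limits.zero_comp]
      simpa [u] using this
    have h2 : G.map (isoStd V).hom (f.app V x) = 0 := by
      have := congrArg (fun (h : H ⟶ coind (std p (Module.finrank (ZMod p) V)) _) ↦
        (h.app V x : (V ⟶ _) → _) (isoStd V).hom) h1
      exact this
    have h3 : G.map (isoStd V).inv (G.map (isoStd V).hom (f.app V x)) = 0 := by rw [h2, map_zero]
    rw [map_map_apply] at h3
    simpa using h3

end FunctorCategory

section Doubling

variable {k : Type u} [Field k] {p : ℕ} [Fact p.Prime]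

/-- The space `V × V`. -/
abbrev dblObj (V : FV p) : FV p := FGModuleCat.of (ZMod p) (V × V)

/-- The first inclusion. -/
def inl (V : FV p) : V ⟶ dblObj V := FGModuleCat.ofHom (LinearMap.inl (ZMod p) V V)
/-- The second inclusion. -/
def inr (V : FV p) : V ⟶ dblObj V := FGModuleCat.ofHom (LinearMap.inr (ZMod p) V V)
/-- The first projection. -/
def fst (V : FV p) : dblObj V ⟶ V := FGModuleCat.ofHom (LinearMap.fst (ZMod p) V V)
/-- The second projection. -/
def snd (V : FV p) : dblObj V ⟶ V := FGModuleCat.ofHom (LinearMap.snd (ZMod p) V V)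

/-- The doubling functor `V ↦ V × V`. -/
abbrev dbl (p : ℕ) [Fact p.Prime] : FV p ⥤ FV p where
  obj V := dblObj V
  map f := FGModuleCat.ofHom (LinearMap.prodMap f.hom.hom f.hom.hom)
  map_id _ := rfl
  map_comp _ _ := rfl

lemma inl_fst (V : FV p) : inl V ≫ fst V = 𝟙 V := rfl
lemma inr_snd (V : FV p) : inr V ≫ snd V = 𝟙 V := rfl
lemma inl_snd (V : FV p) : inl V ≫ snd V = 0 := rfl
lemma inr_fst (V : FV p) : inr V ≫ fst V = 0 := rfl

/-- Doubling is self-adjoint. -/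
def dblAdj (p : ℕ) [Fact p.Prime] : dbl p ⊣ dbl p :=
  Adjunction.mkOfHomEquiv
    { homEquiv := fun V U ↦
        { toFun f := FGModuleCat.ofHom (LinearMap.prod (inl V ≫ f).hom.hom (inr V ≫ f).hom.hom)
          invFun f := FGModuleCat.ofHom
            (LinearMap.coprod (f ≫ fst U).hom.hom (f ≫ snd U).hom.hom)
          left_inv f := by
            apply FGModuleCat.hom_ext
            refine LinearMap.ext fun x ↦ ?_
            exact (map_add f.hom.hom (⟨x.1, 0⟩ : V × V) ⟨0, x.2⟩).symm.trans
              (congrArg f.hom.hom (Prod.ext (add_zero x.1) (zero_add x.2) :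
                (⟨x.1, 0⟩ + ⟨0, x.2⟩ : V × V) = x))
          right_inv f := by
            apply FGModuleCat.hom_ext
            refine LinearMap.ext fun x ↦ ?_
            have h0 : f.hom.hom (0 : V) = (⟨0, 0⟩ : U × U) := map_zero f.hom.hom
            refine Prod.ext ?_ ?_
            · exact (congrArg ((f.hom.hom x : U × U).1 + ·) (congrArg Prod.snd h0)).trans
                (add_zero _)
            · exact (congrArg (· + (f.hom.hom x : U × U).2) (congrArg Prod.fst h0)).trans
                (zero_add _) }
      homEquiv_naturality_left_symm := fun _ _ ↦ rfl
      homEquiv_naturality_right := fun _ _ ↦ rfl }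

instance dbl_injective (I : Fun k p) [Injective I] : Injective (dbl p ⋙ I) := by
  have h : ((Functor.whiskeringLeft _ _ (ModuleCat.{u} k)).obj (dbl p)).PreservesMonomorphisms := by
    constructor
    intro X Y f hf
    exact mono_of_injective _ fun V ↦ injective_of_mono f _
  exact Injective.injective_of_adjoint ((dblAdj p).whiskerLeft (ModuleCat.{u} k)) I

lemma map_square (T : Fun k p) {A B B' Z : FV p} {a : A ⟶ B} {b : B ⟶ Z} {a' : A ⟶ B'}
    {b' : B' ⟶ Z} (h : a ≫ b = a' ≫ b') : T.map a ≫ T.map b = T.map a' ≫ T.map b' := by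
  rw [← T.map_comp, h, T.map_comp]

/-- The map `T(V × V) → T(V)` given by the first projection. -/
def fstT (T : Fun k p) : dbl p ⋙ T ⟶ T where
  app V := T.map (fst V)
  naturality _ _ _ := map_square T rfl
/-- The map `T(V × V) → T(V)` given by the second projection. -/
def sndT (T : Fun k p) : dbl p ⋙ T ⟶ T where
  app V := T.map (snd V)
  naturality _ _ _ := map_square T rfl
/-- The map `T(V) → T(V × V)` given by the first inclusion. -/
def inlT (T : Fun k p) : T ⟶ dbl p ⋙ T where
  app V := T.map (inl V)
  naturality _ _ f := map_square T (FGModuleCat.hom_ext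
    (LinearMap.ext fun _ ↦ Prod.ext rfl (map_zero f.hom.hom).symm))
/-- The map `T(V) → T(V × V)` given by the second inclusion. -/
def inrT (T : Fun k p) : T ⟶ dbl p ⋙ T where
  app V := T.map (inr V)
  naturality _ _ f := map_square T (FGModuleCat.hom_ext
    (LinearMap.ext fun _ ↦ Prod.ext (map_zero f.hom.hom).symm rfl))
/-- The map `T(V × V) → T(V)` given by the sum. -/
def foldT (T : Fun k p) : dbl p ⋙ T ⟶ T where
  app V := T.map (fst V + snd V)
  naturality _ _ f := map_square T (FGModuleCat.hom_ext
    (LinearMap.ext fun x ↦ (map_add f.hom.hom x.1 x.2).symm))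
/-- The endomorphism of `T` given by the zero map. -/
def zeroT (T : Fun k p) : T ⟶ T where
  app V := T.map 0
  naturality V U f := by
    rw [← T.map_comp, ← T.map_comp]; simp

lemma inlT_fstT (T : Fun k p) : inlT T ≫ fstT T = 𝟙 T := by
  ext1; ext1 V; exact (T.map_comp _ _).symm.trans (by rw [inl_fst]; exact T.map_id V)
lemma inrT_sndT (T : Fun k p) : inrT T ≫ sndT T = 𝟙 T := by
  ext1; ext1 V; exact (T.map_comp _ _).symm.trans (by rw [inr_snd]; exact T.map_id V)
lemma inlT_sndT (T : Fun k p) : inlT T ≫ sndT T = zeroT T := by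
  ext1; ext1 V; exact (T.map_comp _ _).symm.trans (by rw [inl_snd]; rfl)
lemma inrT_fstT (T : Fun k p) : inrT T ≫ fstT T = zeroT T := by
  ext1; ext1 V; exact (T.map_comp _ _).symm.trans (by rw [inr_fst]; rfl)

variable {T T' : Fun k p} (f : T ⟶ T')

lemma fstT_naturality : Functor.whiskerLeft (dbl p) f ≫ fstT T' = fstT T ≫ f := by
  ext1; ext1 V; exact (f.naturality _).symm
lemma sndT_naturality : Functor.whiskerLeft (dbl p) f ≫ sndT T' = sndT T ≫ f := by
  ext1; ext1 V; exact (f.naturality _).symm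
lemma zeroT_naturality : f ≫ zeroT T' = zeroT T ≫ f := by
  ext1; ext1 V; exact (f.naturality _).symm

/-- A short exact sequence embedding a functor into an injective. -/
lemma exists_injective_ses (T : Fun k p) : ∃ S : ShortComplex (Fun k p), S.ShortExact ∧
    S.X₁ = T ∧ Injective S.X₂ := by
  refine ⟨ShortComplex.mk (Injective.ι T) (Limits.cokernel.π (Injective.ι T))
    (Limits.cokernel.condition _), ?_, rfl, inferInstanceAs (Injective (Injective.under T))⟩
  exact { exact := ShortComplex.exact_cokernel _
          mono_f := inferInstanceAs (Mono (Injective.ι T))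
          epi_g := inferInstanceAs (Epi (Limits.cokernel.π _)) }

/-- Doubling preserves short exact sequences. -/
lemma shortExact_dbl {S : ShortComplex (Fun k p)} (hS : S.ShortExact) :
    (ShortComplex.mk (Functor.whiskerLeft (dbl p) S.f) (Functor.whiskerLeft (dbl p) S.g)
      (by rw [← Functor.whiskerLeft_comp, S.zero]; rfl)).ShortExact := by
  have := hS.mono_f
  have := hS.epi_g
  exact shortExact_of_pointwise _ (fun V ↦ injective_of_mono S.f _)
    (fun V ↦ surjective_of_epi S.g _) (fun V x hx ↦ shortExact_app hS x hx)

variable [HasExt.{w} (Fun k p)] (π : Fun k p) [π.Additive]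

omit π [π.Additive] in
/-- The zero map acts on Ext groups in the same way through both variables. -/
lemma zeroT_comp_ext (s : ℕ) (M T : Fun k p) (y : Ext M T s) :
    (Ext.mk₀ (zeroT M)).comp y (zero_add s) = y.comp (Ext.mk₀ (zeroT T)) (add_zero s) := by
  induction s generalizing T with
  | zero =>
    obtain ⟨f, rfl⟩ := (Ext.mk₀_bijective _ _).2 y
    rw [Ext.mk₀_comp_mk₀, Ext.mk₀_comp_mk₀, zeroT_naturality]
  | succ s ih =>
    obtain ⟨S, hS, rfl, hI⟩ := exists_injective_ses T
    obtain ⟨z, rfl⟩ := Ext.covariant_sequence_exact₁ M hS y (Ext.eq_zero_of_injective _) rfl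
    let φ : S ⟶ S := ⟨zeroT _, zeroT _, zeroT _, (zeroT_naturality _).symm,
      (zeroT_naturality _).symm⟩
    rw [Ext.comp_assoc_of_third_deg_zero]
    have := hS.extClass_naturality hS φ
    change _ = (Ext.mk₀ (zeroT _)).comp _ _ at this
    change _ = z.comp (hS.extClass.comp (Ext.mk₀ φ.τ₁) _) _
    rw [this, ← Ext.comp_assoc_of_second_deg_zero, ← ih]
    exact (Ext.comp_assoc _ _ _ _ _ (by omega)).symm

lemma extMap_zeroT (s : ℕ) (T : Fun k p) (y : Ext π T s) :
    y.comp (Ext.mk₀ (zeroT T)) (add_zero s) = 0 := by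
  have h : zeroT π = 0 := by
    ext1; ext1 V; exact π.map_zero V V
  rw [← zeroT_comp_ext, h, Ext.mk₀_zero, Ext.zero_comp]

omit [HasExt.{w} (Fun k p)] in
lemma hom_dbl_eq_zero {T : Fun k p} (f : π ⟶ dbl p ⋙ T) (h1 : f ≫ fstT T = 0)
    (h2 : f ≫ sndT T = 0) : f = 0 := by
  refine fun_hom_ext fun V x ↦ ?_
  let μ : dblObj (dblObj V) ⟶ dblObj V := FGModuleCat.ofHom
    (LinearMap.prodMap (LinearMap.fst _ _ _) (LinearMap.snd _ _ _))
  have e1 : ∀ g : V ⟶ dblObj V, T.map ((dbl p).map g ≫ μ) (f.app V x) =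
      T.map μ (f.app (dblObj V) (π.map g x)) := fun g ↦ by
    rw [nat_apply, T.map_comp]; rfl
  have e2 := e1 (inl V + inr V)
  have e3 : (dbl p).map (inl V + inr V) ≫ μ = 𝟙 _ := by
    apply FGModuleCat.hom_ext
    refine LinearMap.ext fun x ↦ ?_
    change ((x.1 + 0), (0 + x.2)) = x
    simp
  rw [e3, π.map_add] at e2
  have e4 : (dbl p).map (inl V) ≫ μ = fst V ≫ inl V := rfl
  have e5 : (dbl p).map (inr V) ≫ μ = snd V ≫ inr V := rfl
  have e6 := e1 (inl V)
  have e7 := e1 (inr V)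
  have h1' : T.map (fst V) (f.app V x) = 0 := congrArg (fun g ↦ g.app V x) h1
  have h2' : T.map (snd V) (f.app V x) = 0 := congrArg (fun g ↦ g.app V x) h2
  rw [e4, ← map_map_apply, h1', map_zero] at e6
  rw [e5, ← map_map_apply, h2', map_zero] at e7
  have e8 : (π.map (inl V) + π.map (inr V)) x = π.map (inl V) x + π.map (inr V) x := rfl
  rw [e8, map_add, map_add, ← e6, ← e7] at e2
  simpa using e2

/-- An extension of an additive functor by `T(V × V)` is determined by its two restrictions. -/
lemma ext_dbl_eq_zero (s : ℕ) (T : Fun k p) (y : Ext π (dbl p ⋙ T) s)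
    (h1 : y.comp (Ext.mk₀ (fstT T)) (add_zero s) = 0)
    (h2 : y.comp (Ext.mk₀ (sndT T)) (add_zero s) = 0) : y = 0 := by
  induction s generalizing T with
  | zero =>
    obtain ⟨f, rfl⟩ := (Ext.mk₀_bijective _ _).2 y
    rw [Ext.mk₀_comp_mk₀, Ext.mk₀_eq_zero_iff] at h1 h2
    rw [hom_dbl_eq_zero π f h1 h2, Ext.mk₀_zero]
  | succ s ih =>
    obtain ⟨S, hS, rfl, hI⟩ := exists_injective_ses T
    have hD := shortExact_dbl hS
    obtain ⟨z, rfl⟩ := Ext.covariant_sequence_exact₁ π hD y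
      (Ext.eq_zero_of_injective (I := dbl p ⋙ S.X₂) _) rfl
    let φ : ShortComplex.mk (Functor.whiskerLeft (dbl p) S.f) (Functor.whiskerLeft (dbl p) S.g)
      (by rw [← Functor.whiskerLeft_comp, S.zero]; rfl) ⟶ S :=
      ⟨fstT _, fstT _, fstT _, (fstT_naturality _).symm, (fstT_naturality _).symm⟩
    let ψ : ShortComplex.mk (Functor.whiskerLeft (dbl p) S.f) (Functor.whiskerLeft (dbl p) S.g)
      (by rw [← Functor.whiskerLeft_comp, S.zero]; rfl) ⟶ S :=
      ⟨sndT _, sndT _, sndT _, (sndT_naturality _).symm, (sndT_naturality _).symm⟩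
    have e1 := hD.extClass_naturality hS φ
    have e2 := hD.extClass_naturality hS ψ
    change hD.extClass.comp (Ext.mk₀ (fstT _)) _ = (Ext.mk₀ (fstT _)).comp _ _ at e1
    change hD.extClass.comp (Ext.mk₀ (sndT _)) _ = (Ext.mk₀ (sndT _)).comp _ _ at e2
    rw [Ext.comp_assoc_of_third_deg_zero, e1, ← Ext.comp_assoc_of_second_deg_zero] at h1
    rw [Ext.comp_assoc_of_third_deg_zero, e2, ← Ext.comp_assoc_of_second_deg_zero] at h2
    obtain ⟨w1, hw1⟩ := Ext.covariant_sequence_exact₃ π hS _ _ h1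
    obtain ⟨w2, hw2⟩ := Ext.covariant_sequence_exact₃ π hS _ _ h2
    have key : z = (extMap ℤ π (inlT S.X₂) s w1 + extMap ℤ π (inrT S.X₂) s w2).comp
        (Ext.mk₀ (Functor.whiskerLeft (dbl p) S.g)) (add_zero s) := by
      rw [← sub_eq_zero]
      change z - extMap ℤ π (Functor.whiskerLeft (dbl p) S.g) s _ = 0
      apply ih
      · change extMap ℤ π _ s _ = 0
        rw [map_sub, extMap_extMap, fstT_naturality, ← extMap_extMap, map_add, extMap_extMap,
          extMap_extMap, inlT_fstT, inrT_fstT, extMap_id, extComp_apply ℤ π (Ext.mk₀ (zeroT _)),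
          extMap_zeroT, add_zero]
        exact sub_eq_zero.2 hw1.symm
      · change extMap ℤ π _ s _ = 0
        rw [map_sub, extMap_extMap, sndT_naturality, ← extMap_extMap, map_add, extMap_extMap,
          extMap_extMap, inlT_sndT, inrT_sndT, extMap_id, extComp_apply ℤ π (Ext.mk₀ (zeroT _)),
          extMap_zeroT, zero_add]
        exact sub_eq_zero.2 hw2.symm
    rw [key, Ext.comp_assoc_of_second_deg_zero, hD.comp_extClass, Ext.comp_zero]

variable {π} in
/-- The acyclicity criterion: `T` is a retract of `T(V × V)` via the sum, by a map which vanishes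
on both factors. -/
lemma Acyc.of_dbl {T : Fun k p} (α : T ⟶ dbl p ⋙ T) (h1 : α ≫ fstT T = 0)
    (h2 : α ≫ sndT T = 0) (h : α ≫ foldT T = 𝟙 T) : Acyc π T := by
  refine fun n ↦ subsingleton_of_forall_eq 0 fun x ↦ ?_
  rw [← extMap_id ℤ π n x, ← h, ← extMap_extMap,
    ext_dbl_eq_zero π n T (extMap ℤ π α n x) _ _, map_zero]
  · exact (extMap_extMap ℤ π _ _ _ _).trans (by rw [h1, extMap_zero])
  · exact (extMap_extMap ℤ π _ _ _ _).trans (by rw [h2, extMap_zero])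

variable {π} in
/-- A functor which is constant up to isomorphism is acyclic. -/
lemma Acyc.of_zeroT {T : Fun k p} (h : zeroT T = 𝟙 T) : Acyc π T := by
  refine fun n ↦ subsingleton_of_forall_eq 0 fun x ↦ ?_
  rw [← extMap_id ℤ π n x, ← h, extComp_apply, extMap_zeroT]

end Doubling

section Finiteness

variable {k : Type u} [Field k] {p : ℕ} [Fact p.Prime]

/-- Direct sum of the standard projective functors attached to a family of spaces. -/
noncomputable def freeFun (k : Type u) [Field k] {I : Type u} (E : I → FV p) : Fun k p where
  obj V := ModuleCat.of k ((Σ i, (E i ⟶ V)) →₀ k)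
  map g := ModuleCat.ofHom (Finsupp.lmapDomain k k (fun x ↦ ⟨x.1, x.2 ≫ g⟩))
  map_id V := by
    ext1
    refine Eq.trans ?_ (Finsupp.lmapDomain_id k k)
    change Finsupp.lmapDomain k k _ = _
    congr 1
  map_comp f g := by
    ext1
    refine Eq.trans ?_ (Finsupp.lmapDomain_comp k k _ _)
    change Finsupp.lmapDomain k k _ = _
    congr 1

lemma freeFun_map_single {I : Type u} (E : I → FV p) {V U : FV p} (g : V ⟶ U) (i : I)
    (h : E i ⟶ V) (c : k) :
    (freeFun k E).map g (Finsupp.single ⟨i, h⟩ c) = Finsupp.single ⟨i, h ≫ g⟩ c :=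
  Finsupp.mapDomain_single

/-- Morphisms out of a free functor. -/
noncomputable def freeLift {I : Type u} {E : I → FV p} {G : Fun k p} (x : ∀ i, G.obj (E i)) :
    freeFun k E ⟶ G where
  app V := ModuleCat.ofHom (Finsupp.lift (G.obj V) k _ fun y ↦ G.map y.2 (x y.1))
  naturality V U g := by
    ext1
    refine Finsupp.lhom_ext fun y c ↦ ?_
    change Finsupp.lift (G.obj U) k _ _ ((freeFun k E).map g (Finsupp.single ⟨y.1, y.2⟩ c)) =
      G.map g (Finsupp.lift (G.obj V) k _ _ (Finsupp.single y c))
    rw [freeFun_map_single]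
    simp

lemma freeLift_single {I : Type u} {E : I → FV p} {G : Fun k p} (x : ∀ i, G.obj (E i))
    {V : FV p} (i : I) (h : E i ⟶ V) (c : k) :
    (freeLift x).app V (Finsupp.single ⟨i, h⟩ c) = c • G.map h (x i) := by
  change Finsupp.lift (G.obj V) k _ _ (Finsupp.single _ c) = _
  simp

lemma freeFun_hom_ext {I : Type u} {E : I → FV p} {G : Fun k p} {f g : freeFun k E ⟶ G}
    (h : ∀ i, f.app (E i) (Finsupp.single ⟨i, 𝟙 _⟩ 1) = g.app (E i) (Finsupp.single ⟨i, 𝟙 _⟩ 1)) :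
    f = g := by
  ext1; ext1 V; ext1
  refine Finsupp.lhom_ext' fun y ↦ LinearMap.ext_ring ?_
  have e : (Finsupp.single y 1 : (Σ i, (E i ⟶ V)) →₀ k) =
      (freeFun k E).map y.2 (Finsupp.single ⟨y.1, 𝟙 _⟩ 1) := by
    rw [freeFun_map_single, Category.id_comp]
  change f.app V (Finsupp.single y 1) = g.app V (Finsupp.single y 1)
  rw [e]
  exact (nat_apply f _ _).trans ((congrArg _ (h _)).trans (nat_apply g _ _).symm)

instance {I : Type u} (E : I → FV p) : Projective (freeFun k E) where
  factors {X Y} f e _ := by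
    choose x hx using fun i ↦ surjective_of_epi e (E i) (f.app (E i) (Finsupp.single ⟨i, 𝟙 _⟩ 1))
    refine ⟨freeLift x, freeFun_hom_ext fun i ↦ ?_⟩
    change e.app _ ((freeLift x).app _ _) = _
    rw [freeLift_single]
    simp [hx]

/-- The functor `V ↦ V × F_p`. -/
abbrev shift (p : ℕ) [Fact p.Prime] : FV p ⥤ FV p where
  obj V := FGModuleCat.of (ZMod p) (V × ZMod p)
  map f := FGModuleCat.ofHom (LinearMap.prodMap f.hom.hom LinearMap.id)
  map_id _ := rfl
  map_comp _ _ := rfl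

/-- The projection `V × F_p → V`. -/
def shiftFst (V : FV p) : (shift p).obj V ⟶ V := FGModuleCat.ofHom (LinearMap.fst (ZMod p) V _)
/-- The inclusion `V → V × F_p`. -/
def shiftInl (V : FV p) : V ⟶ (shift p).obj V := FGModuleCat.ofHom (LinearMap.inl (ZMod p) V _)

lemma shiftInl_fst (V : FV p) : shiftInl V ≫ shiftFst V = 𝟙 V := rfl
lemma shift_map_fst {V U : FV p} (g : V ⟶ U) :
    (shift p).map g ≫ shiftFst U = shiftFst V ≫ g := rfl
/-- The difference functor, the kernel of `M(V × F_p) → M(V)`. -/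
noncomputable def delta (M : Fun k p) : Fun k p where
  obj V := ModuleCat.of k (LinearMap.ker (M.map (shiftFst V)).hom)
  map {V U} g := ModuleCat.ofHom ((M.map ((shift p).map g)).hom.restrict fun x hx ↦ by
    rw [LinearMap.mem_ker] at hx ⊢
    rw [map_map_apply, shift_map_fst, ← map_map_apply, hx, map_zero])
  map_id V := by
    ext1
    refine LinearMap.ext fun x ↦ Subtype.ext ?_
    change M.map (𝟙 _) x.1 = x.1
    simp
  map_comp f g := by
    ext1
    refine LinearMap.ext fun x ↦ Subtype.ext ?_
    exact (map_map_apply M ((shift p).map f) ((shift p).map g) x.1).symm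

/-- The inclusion of the difference functor. -/
noncomputable def deltaι (M : Fun k p) : delta M ⟶ shift p ⋙ M where
  app V := ModuleCat.ofHom (Submodule.subtype _)

/-- The projector onto the difference functor. -/
lemma shift_proj_mem (M : Fun k p) (V : FV p) (x : M.obj ((shift p).obj V)) :
    x - M.map (shiftFst V ≫ shiftInl V) x ∈ LinearMap.ker (M.map (shiftFst V)).hom := by
  rw [LinearMap.mem_ker, map_sub, map_map_apply, Category.assoc, shiftInl_fst, Category.comp_id,
    sub_self]

/-- The retraction onto the difference functor. -/
noncomputable def deltaπ (M : Fun k p) : shift p ⋙ M ⟶ delta M where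
  app V := ModuleCat.ofHom (LinearMap.codRestrict _
    (LinearMap.id - (M.map (shiftFst V ≫ shiftInl V)).hom) (shift_proj_mem M V))
  naturality V U g := by
    ext1
    refine LinearMap.ext fun x ↦ Subtype.ext ?_
    revert x
    change ∀ x : M.obj ((shift p).obj V), M.map ((shift p).map g) x -
      M.map (shiftFst U ≫ shiftInl U) (M.map ((shift p).map g) x) =
      M.map ((shift p).map g) (x - M.map (shiftFst V ≫ shiftInl V) x)
    intro x
    rw [map_sub, map_map_apply, map_map_apply]
    rfl

lemma deltaι_π (M : Fun k p) : deltaι M ≫ deltaπ M = 𝟙 _ := by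
  ext1; ext1 V; ext1
  refine LinearMap.ext fun x ↦ Subtype.ext ?_
  change x.1 - M.map (shiftFst V ≫ shiftInl V) x.1 = x.1
  rw [← map_map_apply, (show M.map (shiftFst V) x.1 = 0 from x.2), map_zero, sub_zero]

/-- Functoriality of the difference functor. -/
noncomputable def deltaMap {M N : Fun k p} (f : M ⟶ N) : delta M ⟶ delta N where
  app V := ModuleCat.ofHom ((f.app ((shift p).obj V)).hom.restrict fun x hx ↦ by
    rw [LinearMap.mem_ker] at hx ⊢
    rw [← nat_apply, hx, map_zero])
  naturality V U g := by
    ext1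
    exact LinearMap.ext fun x ↦ Subtype.ext (nat_apply f ((shift p).map g) x.1)

lemma shortExact_delta {S : ShortComplex (Fun k p)} (hS : S.ShortExact) :
    (ShortComplex.mk (deltaMap S.f) (deltaMap S.g) (by
      refine fun_hom_ext fun V x ↦ Subtype.ext ?_
      exact congrArg (fun h ↦ h.app ((shift p).obj V) x.1) S.zero)).ShortExact := by
  have := hS.mono_f
  have := hS.epi_g
  refine shortExact_of_pointwise _ (fun V x y hxy ↦ ?_) (fun V y ↦ ?_) (fun V x hx ↦ ?_)
  · exact Subtype.ext (injective_of_mono S.f _ (congrArg Subtype.val hxy))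
  · obtain ⟨x, hx⟩ := surjective_of_epi S.g _ y.1
    refine ⟨(deltaπ S.X₂).app V x, Subtype.ext ?_⟩
    change S.g.app _ (x - S.X₂.map (shiftFst V ≫ shiftInl V) x) = y.1
    rw [map_sub, nat_apply, hx, ← map_map_apply,
      (show S.X₃.map (shiftFst V) y.1 = 0 from y.2), map_zero, sub_zero]
  · obtain ⟨y, hy⟩ := shortExact_app hS x.1 (congrArg Subtype.val hx)
    refine ⟨⟨y, ?_⟩, Subtype.ext hy⟩
    apply injective_of_mono S.f
    rw [nat_apply, hy, map_zero]
    exact x.2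

/-- Homs to a product. -/
def shiftHomEquiv {I : Type u} (E : I → FV p) (V : FV p) :
    (Σ j : (Σ i, (E i ⟶ FGModuleCat.of (ZMod p) (ZMod p))), (E j.1 ⟶ V)) ≃
      Σ i, (E i ⟶ (shift p).obj V) where
  toFun x := ⟨x.1.1, FGModuleCat.ofHom (LinearMap.prod x.2.hom.hom x.1.2.hom.hom)⟩
  invFun y := ⟨⟨y.1, FGModuleCat.ofHom (LinearMap.snd _ _ _ ∘ₗ y.2.hom.hom)⟩, y.2 ≫ shiftFst V⟩
  left_inv _ := rfl
  right_inv _ := rfl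

/-- The shift of a free functor is free. -/
noncomputable def shiftFree {I : Type u} (E : I → FV p) :
    freeFun k (fun j : Σ i, (E i ⟶ FGModuleCat.of (ZMod p) (ZMod p)) ↦ E j.1) ⟶
      shift p ⋙ freeFun k E where
  app V := ModuleCat.ofHom (Finsupp.lmapDomain k k (shiftHomEquiv E V))
  naturality V U g := by
    ext1
    exact (Finsupp.lmapDomain_comp k k _ (shiftHomEquiv E U)).symm.trans
      (Finsupp.lmapDomain_comp k k (shiftHomEquiv E V) (α' := Σ i, (E i ⟶ (shift p).obj V))
        (α'' := Σ i, (E i ⟶ (shift p).obj U)) (fun x ↦ ⟨x.1, x.2 ≫ (shift p).map g⟩))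

instance isIso_shiftFree {I : Type u} (E : I → FV p) : IsIso (shiftFree (k := k) E) := by
  refine isIso_of_bijective _ fun V ↦ ?_
  have h : ⇑(Finsupp.domLCongr (R := k) (M := k) (shiftHomEquiv E V)) =
      Finsupp.lmapDomain k k (shiftHomEquiv E V) :=
    funext fun x ↦ Finsupp.equivMapDomain_eq_mapDomain _ x
  have h2 := (Finsupp.domLCongr (R := k) (M := k) (shiftHomEquiv E V)).bijective
  rw [h] at h2
  exact h2

/-- `G` vanishes on spaces of dimension at most `D`. -/
def Vanishes (D : ℕ) (G : Fun k p) : Prop :=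
  ∀ V : FV p, Module.finrank (ZMod p) V ≤ D → ∀ x : G.obj V, x = 0

variable [HasExt.{w} (Fun k p)]

/-- Ext groups out of `M` in degrees at most `s` vanish on functors which vanish on
spaces of small dimension. -/
def FP (s : ℕ) (M : Fun k p) : Prop :=
  ∃ D, ∀ G : Fun k p, Vanishes D G → ∀ i ≤ s, Subsingleton (Ext M G i)

lemma ext_freeFun {I : Type u} (E : I → FV p) (G : Fun k p) (h : ∀ i, ∀ x : G.obj (E i), x = 0)
    (n : ℕ) : Subsingleton (Ext (freeFun k E) G n) := by
  refine subsingleton_of_forall_eq 0 fun x ↦ ?_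
  cases n with
  | zero =>
    obtain ⟨f, rfl⟩ := (Ext.mk₀_bijective _ _).2 x
    rw [Ext.mk₀_eq_zero_iff]
    exact freeFun_hom_ext fun i ↦ (h i _).trans (h i _).symm
  | succ n => exact Ext.eq_zero_of_projective x

lemma subsingleton_ext_of_retract {M N : Fun k p} (a : M ⟶ N) (b : N ⟶ M) (h : a ≫ b = 𝟙 M)
    (G : Fun k p) (n : ℕ) (hN : Subsingleton (Ext N G n)) : Subsingleton (Ext M G n) := by
  refine subsingleton_of_forall_eq 0 fun x ↦ ?_
  rw [← Ext.mk₀_id_comp x, ← h, ← Ext.mk₀_comp_mk₀_assoc,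
    Subsingleton.elim ((Ext.mk₀ b).comp x (zero_add n)) 0, Ext.comp_zero]

lemma ext_delta_freeFun {I : Type u} (E : I → FV p) (G : Fun k p)
    (h : ∀ i, ∀ x : G.obj (E i), x = 0) (n : ℕ) :
    Subsingleton (Ext (delta (freeFun k E)) G n) := by
  refine subsingleton_ext_of_retract (deltaι _ ≫ inv (shiftFree E)) (shiftFree E ≫ deltaπ _)
    (by simp [deltaι_π]) G n (ext_freeFun _ G (fun j ↦ h j.1) n)

lemma finrank_shift (V : FV p) : Module.finrank (ZMod p) ((shift p).obj V) =
    Module.finrank (ZMod p) V + 1 :=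
  (Module.finrank_prod (R := ZMod p) (M := V) (M' := ZMod p)).trans (by simp)

omit [HasExt.{w} (Fun k p)] in
/-- Spaces of positive dimension split off a line. -/
lemma exists_iso_shift (V : FV p) (n : ℕ) (h : Module.finrank (ZMod p) V = n + 1) :
    ∃ U : FV p, Module.finrank (ZMod p) U = n ∧ Nonempty ((shift p).obj U ≅ V) := by
  have e : Module.finrank (ZMod p) ((shift p).obj (std p n)) = Module.finrank (ZMod p) V := by
    rw [finrank_shift, h]
    simp
  refine ⟨std p n, by simp, ⟨?_⟩⟩
  exact LinearEquiv.toFGModuleCatIso (LinearEquiv.ofFinrankEq ((std p n) × ZMod p) V e)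

lemma FP.zero_of_delta {M : Fun k p} (h : FP 0 (delta M)) : FP 0 M := by
  obtain ⟨D, hD⟩ := h
  refine ⟨D + 1, fun G hG i hi ↦ ?_⟩
  obtain rfl : i = 0 := by omega
  refine subsingleton_of_forall_eq 0 fun x ↦ ?_
  obtain ⟨f, rfl⟩ := (Ext.mk₀_bijective _ _).2 x
  rw [Ext.mk₀_eq_zero_iff]
  have h0 : deltaMap f = 0 := by
    have := hD (delta G) (fun V hV x ↦ Subtype.ext (hG _ (by rw [finrank_shift]; omega) _)) 0 le_rfl
    exact (Ext.mk₀_bijective _ _).1 (Subsingleton.elim _ _)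
  have key : ∀ n, ∀ V : FV p, Module.finrank (ZMod p) V = n → ∀ x, f.app V x = 0 := by
    intro n
    induction n with
    | zero => intro V hV x; exact hG V (by omega) _
    | succ n ih =>
      intro V hV x
      obtain ⟨U, hU, ⟨e⟩⟩ := exists_iso_shift V n hV
      have h1 : ∀ y, f.app ((shift p).obj U) y = 0 := fun y ↦ by
        have h2 : f.app _ (y - M.map (shiftFst U ≫ shiftInl U) y) = 0 :=
          congrArg (fun g ↦ (g.app U ⟨_, shift_proj_mem M U y⟩).1) h0
        rw [map_sub, ← map_map_apply, nat_apply f (shiftInl U), ih U hU, map_zero, sub_zero] at h2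
        exact h2
      have h3 := h1 (M.map e.inv x)
      rw [nat_apply] at h3
      have h4 := congrArg (G.map e.hom) h3
      rw [map_map_apply, map_zero] at h4
      simpa using h4
  exact fun_hom_ext fun V x ↦ key _ V rfl x

lemma FP.of_delta (s : ℕ) {M : Fun k p} (h : FP s (delta M)) : FP s M := by
  induction s generalizing M with
  | zero => exact FP.zero_of_delta h
  | succ s ih =>
    obtain ⟨D₁, hD₁⟩ := h
    obtain ⟨D, hD⟩ : FP 0 M :=
      FP.zero_of_delta ⟨D₁, fun G hG i hi ↦ hD₁ G hG i (by omega)⟩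
    let I : Type u := Σ e : Fin (D + 1), M.obj (std p e)
    let E : I → FV p := fun i ↦ std p i.1
    let q : freeFun k E ⟶ M := freeLift fun i ↦ i.2
    have hq : Epi q := by
      refine Abelian.epi_of_cokernel_π_eq_zero q ?_
      have hV : Vanishes D (Limits.cokernel q) := fun V hV y ↦ by
        obtain ⟨x, rfl⟩ := surjective_of_epi (Limits.cokernel.π q) V y
        let i : I := ⟨⟨Module.finrank (ZMod p) V, by omega⟩, M.map (isoStd V).hom x⟩
        have hx : q.app V (Finsupp.single ⟨i, (isoStd V).inv⟩ 1) = x := by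
          refine (freeLift_single _ i _ 1).trans ?_
          rw [one_smul, map_map_apply, Iso.hom_inv_id]
          simp
        rw [← hx]
        exact congrArg (fun g : freeFun k E ⟶ _ ↦ g.app V (Finsupp.single ⟨i, (isoStd V).inv⟩ 1))
          (Limits.cokernel.condition q)
      have := hD _ hV 0 le_rfl
      exact (Ext.mk₀_bijective _ _).1 (Subsingleton.elim _ _)
    let S : ShortComplex (Fun k p) := ShortComplex.mk (Limits.kernel.ι q) q
      (Limits.kernel.condition q)
    have hS : S.ShortExact := { exact := ShortComplex.exact_kernel _ }
    have hP : ∀ G : Fun k p, Vanishes D G → ∀ i, ∀ x : G.obj (E i), x = 0 := fun G hG i x ↦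
      hG _ (by simp [E]; omega) x
    obtain ⟨D₂, hD₂⟩ : FP s S.X₁ := by
      refine ih ⟨max D D₁, fun G hG i hi ↦ ?_⟩
      refine subsingleton_of_forall_eq 0 fun x ↦ ?_
      have h1 := hD₁ G (fun V hV ↦ hG V (by omega)) (1 + i) (by omega)
      have h2 := ext_delta_freeFun E G (hP G fun V hV ↦ hG V (by omega)) i
      obtain ⟨y, rfl⟩ := Ext.contravariant_sequence_exact₁ (shortExact_delta hS) G x rfl
        (Subsingleton.elim (α := Ext (delta M) G (1 + i)) _ _)
      rw [Subsingleton.elim (α := Ext (delta (freeFun k E)) G i) y 0, Ext.comp_zero]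
    refine ⟨max D D₂, fun G hG i hi ↦ ?_⟩
    cases i with
    | zero => exact hD G (fun V hV ↦ hG V (by omega)) 0 le_rfl
    | succ i =>
      refine subsingleton_of_forall_eq 0 fun x ↦ ?_
      have h1 := hD₂ G (fun V hV ↦ hG V (by omega)) i (by omega)
      have h2 := ext_freeFun E G (hP G fun V hV ↦ hG V (by omega)) (i + 1)
      obtain ⟨y, rfl⟩ := Ext.contravariant_sequence_exact₃ hS G x
        (Subsingleton.elim (α := Ext (freeFun k E) G (i + 1)) _ _) (add_comm 1 i)
      rw [Subsingleton.elim y 0, Ext.comp_zero]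

/-- Additive functors satisfy all the finiteness conditions. -/
lemma FP.of_additive (π : Fun k p) [π.Additive] (s : ℕ) : FP s π := by
  refine FP.of_delta s ⟨0, fun G hG i hi ↦ subsingleton_of_forall_eq 0 fun x ↦ ?_⟩
  have h1 : zeroT (delta π) = 𝟙 _ := by
    refine fun_hom_ext fun V y ↦ Subtype.ext ?_
    change π.map ((shift p).map 0) y.1 = y.1
    have h2 : π.map (shiftFst V) y.1 = 0 := y.2
    have h3 : (shift p).map (0 : V ⟶ V) + shiftFst V ≫ shiftInl V = 𝟙 _ := by
      apply FGModuleCat.hom_ext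
      refine LinearMap.ext fun x ↦ Prod.ext ?_ ?_
      · exact zero_add x.1
      · exact add_zero x.2
    have h4 : π.map ((shift p).map (0 : V ⟶ V) + shiftFst V ≫ shiftInl V) y.1 = y.1 := by
      rw [h3]; simp
    rw [π.map_add] at h4
    have h5 : (π.map ((shift p).map (0 : V ⟶ V)) + π.map (shiftFst V ≫ shiftInl V)) y.1 =
      π.map ((shift p).map (0 : V ⟶ V)) y.1 + π.map (shiftFst V ≫ shiftInl V) y.1 := rfl
    rw [h5, ← map_map_apply π (shiftFst V), h2, map_zero, add_zero] at h4
    exact h4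
  have h2 : zeroT G = 0 := by
    refine fun_hom_ext fun V y ↦ ?_
    change G.map 0 y = 0
    have : (0 : V ⟶ V) = (0 : V ⟶ std p 0) ≫ (0 : std p 0 ⟶ V) := by simp
    rw [this, ← map_map_apply, hG (std p 0) (by simp) (G.map _ y), map_zero]
  rw [← Ext.mk₀_id_comp x, ← h1, zeroT_comp_ext, h2, Ext.mk₀_zero, Ext.comp_zero]

end Finiteness

section Twist

variable {k : Type u} [Field k] {p : ℕ} [Fact p.Prime]

/-- The functor `M ↦ M^(I)` on vector spaces. -/
noncomputable abbrev sumCopies (k : Type u) [Field k] (I : Type u) :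
    ModuleCat.{u} k ⥤ ModuleCat.{u} k where
  obj M := ModuleCat.of k (I →₀ M)
  map f := ModuleCat.ofHom (Finsupp.mapRange.linearMap f.hom)
  map_id M := by ext1; exact Finsupp.mapRange.linearMap_id
  map_comp f g := by ext1; exact Finsupp.mapRange.linearMap_comp g.hom f.hom

/-- Postcomposition with `M ↦ M^(I)`. -/
noncomputable abbrev tw (I : Type u) (T : Fun k p) : Fun k p := T ⋙ sumCopies k I

/-- Functoriality of `tw`. -/
noncomputable abbrev twMap (I : Type u) {T T' : Fun k p} (f : T ⟶ T') : tw I T ⟶ tw I T' :=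
  Functor.whiskerRight f (sumCopies k I)

lemma twMap_comp (I : Type u) {T T' T'' : Fun k p} (f : T ⟶ T') (g : T' ⟶ T'') :
    twMap I f ≫ twMap I g = twMap I (f ≫ g) := (Functor.whiskerRight_comp f g _).symm

lemma twMap_id (I : Type u) (T : Fun k p) : twMap I (𝟙 T) = 𝟙 (tw I T) :=
  Functor.whiskerRight_id' _

lemma twMap_zero (I : Type u) (T T' : Fun k p) : twMap I (0 : T ⟶ T') = 0 :=
  fun_hom_ext fun _ _ ↦ Finsupp.ext fun _ ↦ rfl

lemma twMap_add (I : Type u) {T T' : Fun k p} (f g : T ⟶ T') :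
    twMap I (f + g) = twMap I f + twMap I g :=
  fun_hom_ext fun _ _ ↦ Finsupp.ext fun _ ↦ rfl

lemma twMap_sum (I : Type u) {T T' : Fun k p} {ι : Type*} (s : Finset ι) (f : ι → (T ⟶ T')) :
    twMap I (∑ i ∈ s, f i) = ∑ i ∈ s, twMap I (f i) := by
  classical
  induction s using Finset.induction_on with
  | empty => simpa using twMap_zero I T T'
  | insert i s hi ih => rw [Finset.sum_insert hi, twMap_add, ih, Finset.sum_insert hi]

/-- The image under `tw` of a short complex. -/
noncomputable abbrev twS (I : Type u) (S : ShortComplex (Fun k p)) : ShortComplex (Fun k p) :=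
  ShortComplex.mk (twMap I S.f) (twMap I S.g) (by rw [twMap_comp, S.zero, twMap_zero])

lemma shortExact_tw (I : Type u) {S : ShortComplex (Fun k p)} (hS : S.ShortExact) :
    (twS I S).ShortExact := by
  have := hS.mono_f
  have := hS.epi_g
  refine shortExact_of_pointwise _ (fun V x y hxy ↦ ?_) (fun V y ↦ ?_) (fun V x hx ↦ ?_)
  · exact Finsupp.ext fun i ↦ injective_of_mono S.f V (congrArg (fun z : I →₀ S.X₂.obj V ↦ z i) hxy)
  · exact Finsupp.mapRange_surjective _ (map_zero _) (surjective_of_epi S.g V) y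
  · have h1 : ∀ z : S.X₂.obj V, ∃ y : S.X₁.obj V, (S.g.app V z = 0 → S.f.app V y = z) ∧
        (z = 0 → y = 0) := fun z ↦ by
      by_cases hz : z = 0
      · exact ⟨0, fun _ ↦ by rw [map_zero, hz], fun _ ↦ rfl⟩
      by_cases h : S.g.app V z = 0
      · obtain ⟨y, hy⟩ := shortExact_app hS z h
        exact ⟨y, fun _ ↦ hy, fun h0 ↦ absurd h0 hz⟩
      · exact ⟨0, fun h' ↦ absurd h' h, fun _ ↦ rfl⟩
    choose s hs hs' using h1
    refine ⟨Finsupp.mapRange s (hs' 0 rfl) x, Finsupp.ext fun i ↦ ?_⟩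
    exact hs _ (congrArg (fun z : I →₀ S.X₃.obj V ↦ z i) hx)

variable [HasExt.{w} (Fun k p)] (π : Fun k p) (I : Type u)

/-- `T` is acyclic for `π` with coefficients in `k^(I)`. -/
def TAcyc (T : Fun k p) : Prop := Acyc π (tw I T)

/-- `f` is an isomorphism on Ext groups with coefficients in `k^(I)`. -/
def TIso {T T' : Fun k p} (f : T ⟶ T') : Prop := ExtIso π (twMap I f)

variable {π I}

lemma TIso.of_isIso {T T' : Fun k p} (f : T ⟶ T') [IsIso f] : TIso π I f :=
  ExtIso.of_isIso _

lemma TIso.comp {T T' T'' : Fun k p} {f : T ⟶ T'} {g : T' ⟶ T''} (hf : TIso π I f)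
    (hg : TIso π I g) : TIso π I (f ≫ g) := by
  rw [TIso, ← twMap_comp]; exact ExtIso.comp hf hg

lemma TIso.of_comp_left {T T' T'' : Fun k p} {f : T ⟶ T'} {g : T' ⟶ T''} (hf : TIso π I f)
    (h : TIso π I (f ≫ g)) : TIso π I g := by
  rw [TIso, ← twMap_comp] at h; exact ExtIso.of_comp_left hf h

lemma TAcyc.right {S : ShortComplex (Fun k p)} (hS : S.ShortExact) (h₁ : TAcyc π I S.X₁)
    (h₂ : TAcyc π I S.X₂) : TAcyc π I S.X₃ := Acyc.right (shortExact_tw I hS) h₁ h₂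

lemma TIso.of_acyc_right {S : ShortComplex (Fun k p)} (hS : S.ShortExact)
    (h₃ : TAcyc π I S.X₃) : TIso π I S.f := ExtIso.of_acyc_right (shortExact_tw I hS) h₃

lemma TIso.mid_of_left {S S' : ShortComplex (Fun k p)} (hS : S.ShortExact) (hS' : S'.ShortExact)
    (φ : S ⟶ S') (h₁ : TIso π I φ.τ₁) (h₃ : IsIso φ.τ₃) : TIso π I φ.τ₂ := by
  let φ' : twS I S ⟶ twS I S' := ShortComplex.Hom.mk (twMap I φ.τ₁) (twMap I φ.τ₂) (twMap I φ.τ₃)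
    ((twMap_comp I _ _).trans ((congrArg (twMap I) φ.comm₁₂).trans (twMap_comp I _ _).symm))
    ((twMap_comp I _ _).trans ((congrArg (twMap I) φ.comm₂₃).trans (twMap_comp I _ _).symm))
  exact ExtIso.mid_of_left (shortExact_tw I hS) (shortExact_tw I hS') φ' h₁
    (inferInstanceAs (IsIso (twMap I φ.τ₃)))

lemma TAcyc.of_sum {ι : Type*} (s : Finset ι) {T : Fun k p} (U : ι → Fun k p) (a : ∀ i, T ⟶ U i)
    (b : ∀ i, U i ⟶ T) (hU : ∀ i ∈ s, TAcyc π I (U i)) (h : ∑ i ∈ s, a i ≫ b i = 𝟙 T) :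
    TAcyc π I T :=
  Acyc.of_sum s (fun i ↦ tw I (U i)) (fun i ↦ twMap I (a i)) (fun i ↦ twMap I (b i)) hU
    (by simp only [twMap_comp]; rw [← twMap_sum, h, twMap_id])

lemma TAcyc.of_retract {T U : Fun k p} (a : T ⟶ U) (b : U ⟶ T) (h : a ≫ b = 𝟙 T)
    (hU : TAcyc π I U) : TAcyc π I T :=
  Acyc.of_retract (twMap I a) (twMap I b) (by rw [twMap_comp, h, twMap_id]) hU

lemma TIso.of_sum {ι : Type*} (s : Finset ι) {T T' : Fun k p} (f : T ⟶ T') (g : T' ⟶ T)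
    (hfg : f ≫ g = 𝟙 T) (U : ι → Fun k p) (a : ∀ i, T' ⟶ U i)
    (b : ∀ i, U i ⟶ T') (hU : ∀ i ∈ s, TAcyc π I (U i))
    (h : g ≫ f + ∑ i ∈ s, a i ≫ b i = 𝟙 T') : TIso π I f :=
  ExtIso.of_sum s (twMap I f) (twMap I g) (by rw [twMap_comp, hfg, twMap_id])
    (fun i ↦ tw I (U i)) (fun i ↦ twMap I (a i)) (fun i ↦ twMap I (b i)) hU
    (by simp only [twMap_comp]; rw [← twMap_sum, ← twMap_add, h, twMap_id])

variable [π.Additive]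

lemma TAcyc.of_dbl {T : Fun k p} (α : T ⟶ dbl p ⋙ T) (h1 : α ≫ fstT T = 0)
    (h2 : α ≫ sndT T = 0) (h : α ≫ foldT T = 𝟙 T) : TAcyc π I T := by
  refine Acyc.of_dbl (T := tw I T) (twMap I α : tw I T ⟶ dbl p ⋙ tw I T) ?_ ?_ ?_
  · exact (twMap_comp I α (fstT T)).trans (by rw [h1, twMap_zero])
  · exact (twMap_comp I α (sndT T)).trans (by rw [h2, twMap_zero])
  · exact (twMap_comp I α (foldT T)).trans (by rw [h, twMap_id])

lemma TAcyc.of_zeroT {T : Fun k p} (h : zeroT T = 𝟙 T) : TAcyc π I T := by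
  refine Acyc.of_zeroT (T := tw I T) ?_
  exact (congrArg (twMap I) h).trans (twMap_id I T)

/-- Acyclicity of a quotient of a functor satisfying the criterion of `TAcyc.of_dbl`. -/
lemma TAcyc.of_dbl_quotient {S : ShortComplex (Fun k p)} (hS : S.ShortExact)
    (α : S.X₂ ⟶ dbl p ⋙ S.X₂) (h1 : α ≫ fstT S.X₂ = 0)
    (h2 : α ≫ sndT S.X₂ = 0) (h : α ≫ foldT S.X₂ = 𝟙 S.X₂)
    (hα : S.f ≫ α ≫ Functor.whiskerLeft (dbl p) S.g = 0) : TAcyc π I S.X₃ := by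
  have := hS.epi_g
  have hfold : Functor.whiskerLeft (dbl p) S.g ≫ foldT S.X₃ = foldT S.X₂ ≫ S.g := by
    ext1; ext1 V
    exact (S.g.naturality _).symm
  refine TAcyc.of_dbl (hS.gIsCokernel.desc (Limits.CokernelCofork.ofπ
    (α ≫ Functor.whiskerLeft (dbl p) S.g) hα)) ?_ ?_ ?_ <;> rw [← cancel_epi S.g]
  all_goals
    refine (Category.assoc _ _ _).symm.trans ?_
    refine (congrArg (· ≫ _) (hS.gIsCokernel.fac _ Limits.WalkingParallelPair.one)).trans ?_
    refine (Category.assoc _ _ _).trans ?_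
  · rw [fstT_naturality, ← Category.assoc, h1]; simp
  · rw [sndT_naturality, ← Category.assoc, h2]; simp
  · rw [hfold, ← Category.assoc, h]; simp

end Twist

section Pol

variable {k : Type u} [Field k] {p : ℕ} [Fact p.Prime]

/-- A chosen basis of a finite-dimensional space. -/
noncomputable abbrev bas (V : FV p) : Module.Basis (Fin (Module.finrank (ZMod p) V)) (ZMod p) V :=
  Module.finBasis (ZMod p) V

/-- The symmetric algebra over `k` on the sum of copies of `V` indexed by `σ`. -/
abbrev Pol (k : Type u) [Field k] (σ : Type) (V : FV p) : Type u :=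
  MvPolynomial (σ × Fin (Module.finrank (ZMod p) V)) k

variable [CharP k p] {σ τ υ : Type}

/-- The linear polynomial attached to a vector. -/
noncomputable def lin (k : Type u) [Field k] [CharP k p] (i : σ) {V : FV p} : V →+ Pol k σ V where
  toFun v := ∑ a, MvPolynomial.C (ZMod.castHom (dvd_refl p) k ((bas V).repr v a)) *
    MvPolynomial.X (i, a)
  map_zero' := by simp
  map_add' v w := by simp [add_mul, Finset.sum_add_distrib]

lemma lin_bas (i : σ) {V : FV p} (a) : lin k i (bas V a) = MvPolynomial.X (i, a) := by
  classical
  change (∑ b, MvPolynomial.C (ZMod.castHom (dvd_refl p) k ((bas V).repr (bas V a) b)) *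
    MvPolynomial.X (i, b) : Pol k σ V) = _
  rw [Finset.sum_eq_single a]
  · simp
  · intro b _ hb
    simp [hb.symm]
  · simp

section Lift

variable {R : Type*} [CommRing R] [Algebra k R]

/-- The universal property of `Pol`. -/
noncomputable def plift {V : FV p} (A : σ → V →+ R) : Pol k σ V →ₐ[k] R :=
  MvPolynomial.aeval fun x ↦ A x.1 (bas V x.2)

omit [CharP k p] in
lemma plift_X {V : FV p} (A : σ → V →+ R) (x) :
    plift (k := k) A (MvPolynomial.X x) = A x.1 (bas V x.2) := MvPolynomial.aeval_X _ _

lemma algebraMap_cast_mul {V : FV p} (A : V →+ R) (c : ZMod p) (v : V) :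
    algebraMap k R (ZMod.castHom (dvd_refl p) k c) * A v = A (c • v) := by
  obtain ⟨n, rfl⟩ := ZMod.natCast_zmod_surjective c
  simp [Nat.cast_smul_eq_nsmul]

lemma plift_lin {V : FV p} (A : σ → V →+ R) (i : σ) (v : V) :
    plift (k := k) A (lin k i v) = A i v := by
  change plift A (∑ a, _) = _
  rw [map_sum]
  simp only [map_mul, plift_X, MvPolynomial.algHom_C]
  simp only [algebraMap_cast_mul, ← map_sum]
  rw [(bas V).sum_repr]

lemma pol_algHom_ext {V : FV p} {f g : Pol k σ V →ₐ[k] R}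
    (h : ∀ i v, f (lin k i v) = g (lin k i v)) : f = g := by
  refine MvPolynomial.algHom_ext fun x ↦ ?_
  have := h x.1 (bas V x.2)
  rwa [lin_bas] at this

end Lift

/-- The map of polynomial algebras induced by a family of linear maps. -/
noncomputable def pmap (k : Type u) [Field k] [CharP k p] {V U : FV p} (g : σ → (V ⟶ U)) :
    Pol k σ V →ₐ[k] Pol k σ U :=
  plift fun i ↦ (lin k i).comp (g i).hom.hom.toAddMonoidHom

lemma pmap_lin {V U : FV p} (g : σ → (V ⟶ U)) (i : σ) (v : V) :
    pmap k g (lin k i v) = lin k i (g i v) := plift_lin _ _ _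

lemma pmap_pmap {V U Z : FV p} (g : σ → (V ⟶ U)) (h : σ → (U ⟶ Z)) (f : Pol k σ V) :
    pmap k h (pmap k g f) = pmap k (fun i ↦ g i ≫ h i) f := by
  refine congrArg (fun F : Pol k σ V →ₐ[k] Pol k σ Z ↦ F f)
    (pol_algHom_ext (f := (pmap k h).comp (pmap k g)) fun i v ↦ ?_)
  rw [AlgHom.comp_apply, pmap_lin, pmap_lin, pmap_lin]
  rfl

lemma pmap_id {V : FV p} (f : Pol k σ V) : pmap k (fun _ ↦ 𝟙 V) f = f := by
  refine congrArg (fun F : Pol k σ V →ₐ[k] Pol k σ V ↦ F f)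
    (pol_algHom_ext (g := AlgHom.id k _) fun i v ↦ ?_)
  rw [pmap_lin]
  rfl

/-- A family of submodules of polynomial algebras stable under linear maps. -/
structure SubPol (k : Type u) [Field k] (p : ℕ) [Fact p.Prime] [CharP k p] (σ : Type) where
  /-- The submodules. -/
  N : ∀ V : FV p, Submodule k (Pol k σ V)
  /-- Stability under families of linear maps. -/
  stable : ∀ {V U : FV p} (g : σ → (V ⟶ U)), ∀ f ∈ N V, pmap k g f ∈ N U

/-- The functor given by a stable family of submodules. -/
noncomputable def SubPol.fn (N : SubPol k p σ) : Fun k p where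
  obj V := ModuleCat.of k (N.N V)
  map g := ModuleCat.ofHom ((pmap k fun _ ↦ g).toLinearMap.restrict (N.stable fun _ ↦ g))
  map_id V := by
    ext1
    exact LinearMap.ext fun f ↦ Subtype.ext (pmap_id f.1)
  map_comp g h := by
    ext1
    refine LinearMap.ext ?_
    exact fun f : N.N _ ↦ Subtype.ext (pmap_pmap (fun _ ↦ g) (fun _ ↦ h) f.1).symm

/-- A natural transformation between functors of polynomials. -/
noncomputable def SubPol.hom (N : SubPol k p σ) (N' : SubPol k p τ)
    (θ : ∀ V : FV p, Pol k σ V →ₗ[k] Pol k τ V)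
    (hθ : ∀ {V U : FV p} (g : V ⟶ U) f, f ∈ N.N V →
      θ U (pmap k (fun _ ↦ g) f) = pmap k (fun _ ↦ g) (θ V f))
    (hN : ∀ V, ∀ f ∈ N.N V, θ V f ∈ N'.N V) : N.fn ⟶ N'.fn where
  app V := ModuleCat.ofHom ((θ V).restrict (hN V))
  naturality V U g := by
    ext1
    exact LinearMap.ext fun f ↦ Subtype.ext (hθ g f.1 f.2)

/-- The natural transformation to the doubling induced by a family of inclusions. -/
noncomputable def SubPol.toDbl (N : SubPol k p σ) (g : ∀ V : FV p, σ → (V ⟶ dblObj V))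
    (hg : ∀ {V U : FV p} (f : V ⟶ U) (i : σ), f ≫ g U i = g V i ≫ (dbl p).map f) :
    N.fn ⟶ dbl p ⋙ N.fn where
  app V := ModuleCat.ofHom ((pmap k (g V)).toLinearMap.restrict (N.stable (g V)))
  naturality V U f := by
    ext1
    refine LinearMap.ext ?_
    refine fun x : N.N V ↦ Subtype.ext ?_
    refine (pmap_pmap (fun _ ↦ f) (g U) x.1).trans
      (Eq.trans ?_ (pmap_pmap (g V) (fun _ ↦ (dbl p).map f) x.1).symm)
    exact congrArg (fun h ↦ pmap k h x.1) (funext (hg f))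

lemma inl_natural {V U : FV p} (f : V ⟶ U) : f ≫ inl U = inl V ≫ (dbl p).map f :=
  FGModuleCat.hom_ext (LinearMap.ext fun _ ↦ Prod.ext rfl (map_zero f.hom.hom).symm)

lemma inr_natural {V U : FV p} (f : V ⟶ U) : f ≫ inr U = inr V ≫ (dbl p).map f :=
  FGModuleCat.hom_ext (LinearMap.ext fun _ ↦ Prod.ext (map_zero f.hom.hom).symm rfl)

lemma inl_fold (V : FV p) : inl V ≫ (fst V + snd V) = 𝟙 V :=
  FGModuleCat.hom_ext (LinearMap.ext fun x ↦ add_zero x)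

lemma inr_fold (V : FV p) : inr V ≫ (fst V + snd V) = 𝟙 V :=
  FGModuleCat.hom_ext (LinearMap.ext fun x ↦ zero_add x)

section Weights

open MvPolynomial

variable {M : Type} [AddCommMonoid M] {R : Type*} [CommRing R] {α β : Type*}

lemma isWeightedHomogeneous_aeval {w : α → M} {w' : β → M} {q : α → MvPolynomial β R}
    (hq : ∀ x, IsWeightedHomogeneous w' (q x) (w x)) {f : MvPolynomial α R} {m : M}
    (hf : IsWeightedHomogeneous w f m) : IsWeightedHomogeneous w' (aeval q f) m := by
  rw [aeval_def, eval₂_eq]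
  refine IsWeightedHomogeneous.sum _ _ _ fun e he ↦ ?_
  have h1 := hf (mem_support_iff.1 he)
  have h2 : IsWeightedHomogeneous w' (∏ i ∈ e.support, q i ^ e i)
      (∑ i ∈ e.support, e i • w i) :=
    IsWeightedHomogeneous.prod _ _ _ fun i _ ↦ (hq i).pow _
  rw [← h1, Finsupp.weight_apply]
  exact h2.C_mul _

lemma isWeightedHomogeneous_map {M' : Type} [AddCommMonoid M'] (h : M →+ M') {w : α → M}
    {f : MvPolynomial α R} {m : M} (hf : IsWeightedHomogeneous w f m) :
    IsWeightedHomogeneous (h ∘ w) f (h m) := by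
  intro e he
  rw [← hf he, Finsupp.weight_apply, Finsupp.weight_apply, Finsupp.sum, Finsupp.sum, map_sum]
  simp

variable {V U : FV p} {w : σ → M} {w' : τ → M}

lemma lin_homogeneous (i : σ) (v : V) :
    IsWeightedHomogeneous (fun x ↦ w x.1) (lin k i v) (w i) :=
  IsWeightedHomogeneous.sum _ _ _ fun a _ ↦ IsWeightedHomogeneous.C_mul
    (isWeightedHomogeneous_X k (fun x : σ × _ ↦ w x.1) (i, a)) _

omit [CharP k p] in
lemma plift_homogeneous {A : σ → V →+ Pol k τ U} {f : Pol k σ V} {m : M}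
    (hA : ∀ i v, IsWeightedHomogeneous (fun x ↦ w' x.1) (A i v) (w i))
    (hf : IsWeightedHomogeneous (fun x ↦ w x.1) f m) :
    IsWeightedHomogeneous (fun x ↦ w' x.1) (plift A f) m :=
  isWeightedHomogeneous_aeval (fun _ ↦ hA _ _) hf

lemma pmap_homogeneous (g : σ → (V ⟶ U)) {f : Pol k σ V} {m : M}
    (hf : IsWeightedHomogeneous (fun x ↦ w x.1) f m) :
    IsWeightedHomogeneous (fun x ↦ w x.1) (pmap k g f) m :=
  plift_homogeneous (fun _ _ ↦ lin_homogeneous _ _) hf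

lemma component_comm {M' : Type} [AddCommMonoid M'] {w : α → M} {w' : β → M'}
    (θ : MvPolynomial α R →ₗ[R] MvPolynomial β R) {h : M → M'} (hh : Function.Injective h)
    (hθ : ∀ f m, IsWeightedHomogeneous w f m → IsWeightedHomogeneous w' (θ f) (h m))
    (f : MvPolynomial α R) (m : M) :
    weightedHomogeneousComponent w' (h m) (θ f) = θ (weightedHomogeneousComponent w m f) := by
  classical
  induction f using MvPolynomial.induction_on' with
  | monomial e a =>
    have h1 := isWeightedHomogeneous_monomial w e a rfl
    rw [weightedHomogeneousComponent_of_mem h1, weightedHomogeneousComponent_of_mem (hθ _ _ h1)]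
    simp only [hh.eq_iff]
    split_ifs <;> simp
  | add f g hf hg => simp [hf, hg]

lemma pmap_component (g : σ → (V ⟶ U)) (f : Pol k σ V) (m : M) :
    weightedHomogeneousComponent (fun x ↦ w x.1) m (pmap k g f) =
      pmap k g (weightedHomogeneousComponent (fun x ↦ w x.1) m f) :=
  component_comm (pmap k g).toLinearMap Function.injective_id
    (fun _ _ h ↦ pmap_homogeneous g h) f m

/-- Polynomials of given weighted degree. -/
noncomputable def gr (k : Type u) [Field k] (p : ℕ) [Fact p.Prime] [CharP k p] (w : σ → M) (m : M) :
    SubPol k p σ where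
  N _ := weightedHomogeneousSubmodule k (fun x ↦ w x.1) m
  stable _ _ hf := pmap_homogeneous _ hf

end Weights

end Pol

section Acyclic

open MvPolynomial

variable {k : Type u} [Field k] {p : ℕ} [Fact p.Prime] [CharP k p] {σ τ : Type}

lemma weight_comp {M M' α : Type*} [AddCommMonoid M] [AddCommMonoid M'] (h : M →+ M') (w : α → M)
    (e : α →₀ ℕ) : Finsupp.weight (fun x ↦ h (w x)) e = h (Finsupp.weight w e) := by
  rw [Finsupp.weight_apply, Finsupp.weight_apply, Finsupp.sum, Finsupp.sum, map_sum]
  simp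

lemma aeval_eq_zero_of_support {α R A : Type*} [CommRing R] [CommRing A] [Algebra R A]
    {q : α → A} {f : MvPolynomial α R} (h : ∀ e ∈ f.support, ∃ x ∈ e.support, q x = 0) :
    aeval q f = 0 := by
  rw [aeval_def, eval₂_eq]
  refine Finset.sum_eq_zero fun e he ↦ ?_
  obtain ⟨x, hx, hq⟩ := h e he
  rw [Finset.prod_eq_zero hx, mul_zero]
  rw [hq, zero_pow (Finsupp.mem_support_iff.1 hx)]

lemma pmap_eq_zero {M : Type} [AddCommMonoid M] {w : σ → M} {m : M} {V U : FV p}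
    (g : σ → (V ⟶ U)) {f : Pol k σ V} (hf : IsWeightedHomogeneous (fun x ↦ w x.1) f m)
    (h : M →+ ℕ) (h1 : ∀ i, g i ≠ 0 → h (w i) = 0) (h2 : h m ≠ 0) : pmap k g f = 0 := by
  refine aeval_eq_zero_of_support fun e he ↦ ?_
  by_contra! hc
  apply h2
  rw [← hf (mem_support_iff.1 he), ← weight_comp, Finsupp.weight_apply]
  refine Finset.sum_eq_zero fun x hx ↦ ?_
  have h3 : h (w x.1) = 0 := h1 x.1 fun h0 ↦ hc x hx (by rw [h0]; exact map_zero (lin k x.1))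
  exact (congrArg (e x • ·) h3).trans (smul_zero _)

/-- The map to the doubling which sends the variables in `s` to the first factor. -/
noncomputable def SubPol.split (N : SubPol k p σ) (s : σ → Prop) [DecidablePred s] :
    N.fn ⟶ dbl p ⋙ N.fn :=
  N.toDbl (fun V i ↦ if s i then inl V else inr V) (fun f i ↦ by
    dsimp only
    split_ifs
    · exact inl_natural f
    · exact inr_natural f)

section Split

variable {M : Type} [AddCommMonoid M] {w : σ → M} {m : M} (s : σ → Prop) [DecidablePred s]

lemma gr_split_fst (h : M →+ ℕ) (h1 : ∀ i, s i → h (w i) = 0) (h2 : h m ≠ 0) :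
    (gr k p w m).split s ≫ fstT _ = 0 := by
  refine fun_hom_ext fun V ↦ ?_
  refine fun f : (gr k p w m).N V ↦ Subtype.ext ?_
  refine (pmap_pmap (fun i ↦ if s i then inl V else inr V) (fun _ ↦ fst V) f.1).trans
    (pmap_eq_zero _ f.2 h (fun i hi ↦ h1 i ?_) h2)
  by_contra hs
  apply hi
  simp only [hs, if_false]
  rfl

lemma gr_split_snd (h : M →+ ℕ) (h1 : ∀ i, ¬ s i → h (w i) = 0) (h2 : h m ≠ 0) :
    (gr k p w m).split s ≫ sndT _ = 0 := by
  refine fun_hom_ext fun V ↦ ?_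
  refine fun f : (gr k p w m).N V ↦ Subtype.ext ?_
  refine (pmap_pmap (fun i ↦ if s i then inl V else inr V) (fun _ ↦ snd V) f.1).trans
    (pmap_eq_zero _ f.2 h (fun i hi ↦ h1 i ?_) h2)
  intro hs
  apply hi
  simp only [hs, if_true]
  rfl

lemma split_fold (N : SubPol k p σ) : N.split s ≫ foldT _ = 𝟙 _ := by
  refine fun_hom_ext fun V ↦ ?_
  refine fun f : N.N V ↦ Subtype.ext ?_
  refine (pmap_pmap (fun i ↦ if s i then inl V else inr V) (fun _ ↦ fst V + snd V) f.1).trans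
    (Eq.trans ?_ (pmap_id f.1))
  refine congrArg (fun h ↦ pmap k h f.1) (funext fun i ↦ ?_)
  split_ifs
  · exact inl_fold V
  · exact inr_fold V

variable [HasExt.{w} (Fun k p)] {π : Fun k p} [π.Additive] {I : Type u}

/-- Polynomials of positive degree in two complementary sets of variables form an acyclic
functor. -/
lemma TAcyc.gr_mixed (h h' : M →+ ℕ) (h1 : ∀ i, s i → h (w i) = 0) (h2 : h m ≠ 0)
    (h1' : ∀ i, ¬ s i → h' (w i) = 0) (h2' : h' m ≠ 0) : TAcyc π I (gr k p w m).fn :=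
  TAcyc.of_dbl _ (gr_split_fst s h h1 h2) (gr_split_snd s h' h1' h2') (split_fold s _)

end Split

/-- The symmetric powers. -/
noncomputable abbrev sym (k : Type u) [Field k] (p : ℕ) [Fact p.Prime] [CharP k p] (n : ℕ) :
    SubPol k p Unit := gr k p (fun _ ↦ (1 : ℕ)) n

/-- The weight giving the bidegree for two blocks of variables. -/
def biw : Fin 2 → ℕ × ℕ := ![(1, 0), (0, 1)]

/-- The tensor products of two symmetric powers. -/
noncomputable abbrev bisym (k : Type u) [Field k] (p : ℕ) [Fact p.Prime] [CharP k p] (a b : ℕ) :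
    SubPol k p (Fin 2) := gr k p biw (a, b)

lemma bisym_split_fst {a b : ℕ} (hb : b ≠ 0) :
    (bisym k p a b).split (· = 0) ≫ fstT _ = 0 :=
  gr_split_fst _ (AddMonoidHom.snd ℕ ℕ) (by rintro i rfl; rfl) hb

lemma bisym_split_snd {a b : ℕ} (ha : a ≠ 0) :
    (bisym k p a b).split (· = 0) ≫ sndT _ = 0 :=
  gr_split_snd _ (AddMonoidHom.fst ℕ ℕ) (by
    intro i hi
    obtain rfl : i = 1 := by omega
    rfl) ha

/-- Substitution of `x + y`. -/
noncomputable def comul (k : Type u) [Field k] [CharP k p] (V : FV p) :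
    Pol k Unit V →ₐ[k] Pol k (Fin 2) V := plift fun _ ↦ lin k 0 + lin k 1

/-- Substitution of `x` for both blocks of variables. -/
noncomputable def merge (k : Type u) [Field k] [CharP k p] (V : FV p) :
    Pol k (Fin 2) V →ₐ[k] Pol k Unit V := plift fun _ ↦ lin k ()

/-- Substitution of `x` and `t x` for the two blocks of variables. -/
noncomputable def mergeT (k : Type u) [Field k] [CharP k p] (V : FV p) :
    Pol k (Fin 2) V →ₐ[k] Polynomial (Pol k Unit V) :=
  plift fun i ↦ (AddMonoidHom.mulLeft (Polynomial.X ^ (i : ℕ))).comp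
    (Polynomial.C.toAddMonoidHom.comp (lin k ()))

/-- The degree in the second block of variables. -/
def secw : Fin 2 → ℕ := ![0, 1]

lemma merge_component (V : FV p) (f : Pol k (Fin 2) V) (b : ℕ) :
    merge k V (weightedHomogeneousComponent (fun x ↦ secw x.1) b f) = (mergeT k V f).coeff b := by
  classical
  induction f using MvPolynomial.induction_on' with
  | monomial e a =>
    rw [weightedHomogeneousComponent_of_mem (isWeightedHomogeneous_monomial _ e a rfl)]
    have h : mergeT k V (monomial e a) = Polynomial.C (merge k V (monomial e a)) *
        Polynomial.X ^ (Finsupp.weight (fun x : Fin 2 × _ ↦ secw x.1) e) := by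
      simp only [mergeT, merge, plift, aeval_monomial, Finsupp.weight_apply, Finsupp.prod,
        Finsupp.sum, map_mul, map_prod, map_pow, ← Finset.prod_pow_eq_pow_sum]
      rw [mul_assoc, ← Finset.prod_mul_distrib]
      refine congrArg₂ _ rfl (Finset.prod_congr rfl fun x _ ↦ ?_)
      have h1 : ∀ i : Fin 2, secw i = i := by decide
      simp only [h1, AddMonoidHom.comp_apply, AddMonoidHom.coe_mulLeft, mul_pow, smul_eq_mul,
        ← pow_mul]
      rw [mul_comm, mul_comm (e x)]
      rfl
    rw [h, Polynomial.coeff_C_mul, Polynomial.coeff_X_pow]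
    split_ifs <;> simp
  | add f g hf hg => simp [hf, hg]

omit [CharP k p] in
lemma plift_mulLeft_comp {V : FV p} {R : Type*} [CommRing R] [Algebra k R] (c : R)
    (A : σ → V →+ R) {f : Pol k σ V} {n : ℕ}
    (hf : IsWeightedHomogeneous (fun _ ↦ (1 : ℕ)) f n) :
    plift (fun i ↦ (AddMonoidHom.mulLeft c).comp (A i)) f = c ^ n * plift A f := by
  rw [plift, plift, aeval_def, aeval_def, eval₂_eq, eval₂_eq, Finset.mul_sum]
  refine Finset.sum_congr rfl fun e he ↦ ?_
  rw [← hf (mem_support_iff.1 he), Finsupp.weight_apply, Finsupp.sum]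
  simp only [AddMonoidHom.comp_apply, AddMonoidHom.coe_mulLeft, mul_pow, Finset.prod_mul_distrib,
    Finset.prod_pow_eq_pow_sum, smul_eq_mul, mul_one]
  ring

lemma mergeT_comul (V : FV p) {f : Pol k Unit V} {n : ℕ}
    (hf : IsWeightedHomogeneous (fun _ ↦ (1 : ℕ)) f n) :
    mergeT k V (comul k V f) = (1 + Polynomial.X) ^ n * Polynomial.C f := by
  have h1 : (mergeT k V).comp (comul k V) = plift fun _ ↦
      (AddMonoidHom.mulLeft (1 + Polynomial.X)).comp
        (Polynomial.C.toAddMonoidHom.comp (lin k ())) := by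
    refine pol_algHom_ext fun i v ↦ ?_
    rw [AlgHom.comp_apply, comul, mergeT, plift_lin, plift_lin, AddMonoidHom.add_apply, map_add,
      plift_lin, plift_lin]
    simp [add_mul]
  refine (congrArg (fun F : Pol k Unit V →ₐ[k] _ ↦ F f) h1).trans ?_
  refine (plift_mulLeft_comp _ _ hf).trans (congrArg _ ?_)
  refine congrArg (fun F : Pol k Unit V →ₐ[k] Polynomial (Pol k Unit V) ↦ F f)
    (pol_algHom_ext (f := plift _) (g := Polynomial.CAlgHom) fun i v ↦ ?_)
  rw [plift_lin]
  rfl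

lemma comul_pmap {V U : FV p} (g : V ⟶ U) (f : Pol k Unit V) :
    comul k U (pmap k (fun _ ↦ g) f) = pmap k (fun _ ↦ g) (comul k V f) := by
  refine congrArg (fun F : Pol k Unit V →ₐ[k] Pol k (Fin 2) U ↦ F f) (pol_algHom_ext
    (f := (comul k U).comp (pmap k fun _ ↦ g)) (g := (pmap k fun _ ↦ g).comp (comul k V))
    fun i v ↦ ?_)
  rw [AlgHom.comp_apply, AlgHom.comp_apply, pmap_lin, comul, comul, plift_lin, plift_lin,
    AddMonoidHom.add_apply, AddMonoidHom.add_apply, map_add, pmap_lin, pmap_lin]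

lemma merge_pmap {V U : FV p} (g : V ⟶ U) (f : Pol k (Fin 2) V) :
    merge k U (pmap k (fun _ ↦ g) f) = pmap k (fun _ ↦ g) (merge k V f) := by
  refine congrArg (fun F : Pol k (Fin 2) V →ₐ[k] Pol k Unit U ↦ F f) (pol_algHom_ext
    (f := (merge k U).comp (pmap k fun _ ↦ g)) (g := (pmap k fun _ ↦ g).comp (merge k V))
    fun i v ↦ ?_)
  rw [AlgHom.comp_apply, AlgHom.comp_apply, pmap_lin, merge, merge, plift_lin, plift_lin,
    pmap_lin]

lemma comul_component_mem {V : FV p} {f : Pol k Unit V} {n : ℕ}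
    (hf : IsWeightedHomogeneous (fun _ ↦ (1 : ℕ)) f n) (a b : ℕ) (hab : a + b = n) :
    IsWeightedHomogeneous (fun x ↦ biw x.1)
      (weightedHomogeneousComponent (fun x ↦ secw x.1) b (comul k V f)) (a, b) := by
  classical
  have h1 : IsWeightedHomogeneous (fun _ ↦ (1 : ℕ)) (comul k V f) n :=
    plift_homogeneous (w := fun _ : Unit ↦ (1 : ℕ)) (w' := fun _ : Fin 2 ↦ (1 : ℕ))
      (fun _ v ↦ (lin_homogeneous (w := fun _ : Fin 2 ↦ (1 : ℕ)) 0 v).add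
        (lin_homogeneous (w := fun _ : Fin 2 ↦ (1 : ℕ)) 1 v)) hf
  intro e he
  rw [coeff_weightedHomogeneousComponent] at he
  split_ifs at he with h2
  · have h3 := h1 he
    have h4 := weight_comp (AddMonoidHom.snd ℕ ℕ) (fun x : Fin 2 × _ ↦ biw x.1) e
    have h5 := weight_comp (AddMonoidHom.fst ℕ ℕ + AddMonoidHom.snd ℕ ℕ)
      (fun x : Fin 2 × _ ↦ biw x.1) e
    have h6 : ∀ i, (AddMonoidHom.snd ℕ ℕ) (biw i) = secw i := by decide
    have h7 : ∀ i, (AddMonoidHom.fst ℕ ℕ + AddMonoidHom.snd ℕ ℕ) (biw i) = 1 := by decide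
    simp only [h6] at h4
    simp only [h7] at h5
    rw [h2] at h4
    rw [h3] at h5
    have h8 : n = (Finsupp.weight (fun x : Fin 2 × _ ↦ biw x.1) e).1 +
      (Finsupp.weight (fun x : Fin 2 × _ ↦ biw x.1) e).2 := h5
    have h9 : b = (Finsupp.weight (fun x : Fin 2 × _ ↦ biw x.1) e).2 := h4
    refine Prod.ext ?_ h9.symm
    change _ = a
    omega
  · exact (he rfl).elim

/-- The components of the comultiplication. -/
noncomputable def comulComponent (k : Type u) [Field k] [CharP k p] (b : ℕ) (V : FV p) :
    Pol k Unit V →ₗ[k] Pol k (Fin 2) V :=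
  (weightedHomogeneousComponent (fun x ↦ secw x.1) b).comp (comul k V).toLinearMap

lemma comul_component_pmap {V U : FV p} (g : V ⟶ U) (b : ℕ) (f : Pol k Unit V) :
    comulComponent k b U (pmap k (fun _ ↦ g) f) =
      pmap k (fun _ ↦ g) (comulComponent k b V f) := by
  refine (congrArg (weightedHomogeneousComponent _ b) (comul_pmap g f)).trans ?_
  exact pmap_component (w := secw) (fun _ ↦ g) (comul k V f) b

/-- The component of the comultiplication in a given bidegree. -/
noncomputable def comulHom (a b n : ℕ) (hab : a + b = n) : (sym k p n).fn ⟶ (bisym k p a b).fn :=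
  SubPol.hom _ _ (comulComponent k b)
    (fun g f _ ↦ comul_component_pmap g b f)
    (fun _ _ hf ↦ comul_component_mem hf a b hab)

lemma merge_homogeneous {V : FV p} {f : Pol k (Fin 2) V} {a b : ℕ}
    (hf : IsWeightedHomogeneous (fun x ↦ biw x.1) f (a, b)) :
    IsWeightedHomogeneous (fun _ ↦ (1 : ℕ)) (merge k V f) (a + b) := by
  refine plift_homogeneous (w := fun _ ↦ (1 : ℕ)) (w' := fun _ : Unit ↦ (1 : ℕ))
    (fun _ v ↦ lin_homogeneous (w := fun _ : Unit ↦ (1 : ℕ)) () v) ?_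
  have h := isWeightedHomogeneous_map (AddMonoidHom.fst ℕ ℕ + AddMonoidHom.snd ℕ ℕ) hf
  have h7 : ∀ i, (AddMonoidHom.fst ℕ ℕ + AddMonoidHom.snd ℕ ℕ) (biw i) = 1 := by decide
  have h8 : (AddMonoidHom.fst ℕ ℕ + AddMonoidHom.snd ℕ ℕ) ∘
    (fun x : Fin 2 × Fin (Module.finrank (ZMod p) V) ↦ biw x.1) = fun _ ↦ 1 :=
    funext fun x ↦ h7 x.1
  rwa [h8] at h

/-- Multiplication of polynomials in a given bidegree. -/
noncomputable def mergeHom (a b n : ℕ) (hab : a + b = n) : (bisym k p a b).fn ⟶ (sym k p n).fn :=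
  SubPol.hom _ _ (fun V ↦ (merge k V).toLinearMap) (fun g f _ ↦ merge_pmap g f)
    (fun _ _ hf ↦ hab ▸ merge_homogeneous hf)

lemma comulHom_mergeHom (a b n : ℕ) (hab : a + b = n) :
    comulHom a b n hab ≫ mergeHom a b n hab = (n.choose b : k) • 𝟙 (sym k p n).fn := by
  refine fun_hom_ext fun V ↦ ?_
  refine fun f : (sym k p n).N V ↦ Subtype.ext ?_
  refine (merge_component V (comul k V f.1) b).trans ?_
  rw [mergeT_comul V f.2, Polynomial.coeff_mul_C, Polynomial.coeff_one_add_X_pow]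
  refine Eq.trans ?_ (Algebra.smul_def (n.choose b : k) f.1).symm
  rw [map_natCast]

section

variable [HasExt.{w} (Fun k p)] {π : Fun k p} [π.Additive] {I : Type u}

lemma TAcyc.of_bisym {a b : ℕ} (ha : a ≠ 0) (hb : b ≠ 0) : TAcyc π I (bisym k p a b).fn :=
  TAcyc.gr_mixed (· = 0) (AddMonoidHom.snd ℕ ℕ) (AddMonoidHom.fst ℕ ℕ)
    (by rintro i rfl; rfl) hb (by
    intro i hi
    obtain rfl : i = 1 := by omega
    rfl) ha

omit [HasExt.{w} (Fun k p)] in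
lemma choose_ordProj_ne_zero {n : ℕ} (hn : n ≠ 0) :
    ((n.choose (p ^ n.factorization p) : ℕ) : k) ≠ 0 := by
  set q := p ^ n.factorization p with hq
  have h1 : (1 + Polynomial.X : Polynomial k) ^ n = ((1 + Polynomial.X ^ q) ^ (n / q)) := by
    rw [← one_pow (M := Polynomial k) q, ← add_pow_char_pow, ← pow_mul, one_pow,
      Nat.mul_div_cancel' (Nat.ordProj_dvd n p)]
  have h2 := Polynomial.coeff_one_add_X_pow k n q
  have h3 : (1 + Polynomial.X ^ q : Polynomial k) ^ (n / q) =
      Polynomial.expand k q ((1 + Polynomial.X) ^ (n / q)) := by simp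
  have hq0 : 0 < q := pow_pos (Fact.out : p.Prime).pos _
  rw [← h2, h1, h3, Polynomial.coeff_expand hq0, if_pos dvd_rfl, Nat.div_self hq0,
    Polynomial.coeff_one_add_X_pow, Nat.choose_one_right, Ne, CharP.cast_eq_zero_iff k p]
  exact Nat.not_dvd_ordCompl Fact.out hn

lemma TAcyc.of_sym_zero : TAcyc π I (sym k p 0).fn := by
  refine TAcyc.of_zeroT (fun_hom_ext fun V ↦ ?_)
  refine fun f : (sym k p 0).N V ↦ Subtype.ext ?_
  have hf : IsWeightedHomogeneous (fun _ ↦ (1 : ℕ)) f.1 0 := f.2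
  have h1 : f.1 = C (coeff 0 f.1) := by
    rw [← weightedHomogeneousComponent_zero _ (w := fun _ ↦ (1 : ℕ)) fun _ ↦ one_ne_zero,
      weightedHomogeneousComponent_of_mem hf, if_pos rfl]
  change pmap k (fun _ ↦ 0) f.1 = f.1
  rw [h1]
  exact algHom_C _ _

/-- Symmetric powers whose degree is not a power of `p` are acyclic. -/
lemma TAcyc.of_sym {n : ℕ} (hn : ∀ h, n ≠ p ^ h) : TAcyc π I (sym k p n).fn := by
  rcases eq_or_ne n 0 with rfl | h0
  · exact TAcyc.of_sym_zero
  set b := p ^ n.factorization p with hb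
  have hbn : b < n := lt_of_le_of_ne (Nat.ordProj_le p h0) (hn _).symm
  have hb0 : 0 < b := pow_pos (Fact.out : p.Prime).pos _
  have hab : n - b + b = n := by omega
  refine TAcyc.of_retract (comulHom (n - b) b n hab)
    (((n.choose b : ℕ) : k)⁻¹ • mergeHom (n - b) b n hab) ?_ (TAcyc.of_bisym (by omega) (by omega))
  rw [Linear.comp_smul, comulHom_mergeHom, smul_smul,
    inv_mul_cancel₀ (choose_ordProj_ne_zero h0), one_smul]

end

end Acyclic

section FrobeniusFiltration

open MvPolynomial

variable {k : Type u} [Field k]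

section Exponents

variable {α β : Type*}

/-- The linear map induced by a map on exponents of monomials. -/
noncomputable def mapExp (k : Type u) [Field k] (t : (α →₀ ℕ) → (β →₀ ℕ)) :
    MvPolynomial α k →ₗ[k] MvPolynomial β k :=
  (basisMonomials α k).constr k fun e ↦ monomial (t e) 1

lemma mapExp_monomial (t : (α →₀ ℕ) → (β →₀ ℕ)) (e : α →₀ ℕ) (a : k) :
    mapExp k t (monomial e a) = monomial (t e) a := by
  have h : monomial e a = a • basisMonomials α k e := by
    rw [coe_basisMonomials, smul_monomial, smul_eq_mul, mul_one]
  rw [h, map_smul, mapExp, Module.Basis.constr_basis, smul_monomial, smul_eq_mul, mul_one]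

lemma mapExp_coeff [DecidableEq β] (t : (α →₀ ℕ) → (β →₀ ℕ)) (f : MvPolynomial α k) (d : β →₀ ℕ) :
    coeff d (mapExp k t f) = ∑ e ∈ f.support, if t e = d then coeff e f else 0 := by
  conv_lhs => rw [f.as_sum, map_sum, coeff_sum]
  simp only [mapExp_monomial, coeff_monomial]

lemma mapExp_coeff_eq (t : (α →₀ ℕ) → (β →₀ ℕ)) {f : MvPolynomial α k} {e : α →₀ ℕ}
    (h : ∀ d ∈ f.support, t d = t e → d = e) : coeff (t e) (mapExp k t f) = coeff e f := by
  classical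
  rw [mapExp_coeff, Finset.sum_eq_single e]
  · simp
  · intro d hd hde
    rw [if_neg fun h1 ↦ hde (h d hd h1)]
  · intro he
    simp [notMem_support_iff.1 he]

lemma mapExp_coeff_eq_zero (t : (α →₀ ℕ) → (β →₀ ℕ)) {f : MvPolynomial α k} {d : β →₀ ℕ}
    (h : ∀ e ∈ f.support, t e ≠ d) : coeff d (mapExp k t f) = 0 := by
  classical
  rw [mapExp_coeff]
  exact Finset.sum_eq_zero fun e he ↦ if_neg (h e he)

lemma mapExp_mem_support {t : (α →₀ ℕ) → (β →₀ ℕ)} {f : MvPolynomial α k} {d : β →₀ ℕ}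
    (h : d ∈ (mapExp k t f).support) : ∃ e ∈ f.support, t e = d := by
  by_contra! hc
  exact mem_support_iff.1 h (mapExp_coeff_eq_zero t hc)

end Exponents

section Ideal

variable {p : ℕ} {α β : Type*} [Fintype α] [Fintype β]

/-- The number of `p`-th powers of variables dividing a monomial. -/
def pcount (p : ℕ) (e : α →₀ ℕ) : ℕ := ∑ a, e a / p

lemma pcount_add_le (p : ℕ) (d e : α →₀ ℕ) : pcount p d + pcount p e ≤ pcount p (d + e) := by
  rw [pcount, pcount, ← Finset.sum_add_distrib]
  exact Finset.sum_le_sum fun a _ ↦ Nat.div_add_div_le_add_div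

/-- The polynomials whose monomials are divisible by `i` `p`-th powers of variables. -/
noncomputable def frobIdeal (k : Type u) [Field k] (p : ℕ) (α : Type*) [Fintype α] (i : ℕ) :
    Submodule k (MvPolynomial α k) :=
  restrictSupport k {e | i ≤ pcount p e}

lemma mem_frobIdeal {i : ℕ} {f : MvPolynomial α k} :
    f ∈ frobIdeal k p α i ↔ ∀ e ∈ f.support, i ≤ pcount p e := Iff.rfl

lemma frobIdeal_mono {i j : ℕ} (hij : i ≤ j) : frobIdeal k p α j ≤ frobIdeal k p α i :=
  fun _ hf e he ↦ hij.trans (mem_frobIdeal.1 hf e he)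

lemma frobIdeal_zero (f : MvPolynomial α k) : f ∈ frobIdeal k p α 0 := fun _ _ ↦ Nat.zero_le _

lemma frobIdeal_mul {i j : ℕ} {f g : MvPolynomial α k} (hf : f ∈ frobIdeal k p α i)
    (hg : g ∈ frobIdeal k p α j) : f * g ∈ frobIdeal k p α (i + j) := by
  classical
  intro e he
  obtain ⟨a, ha, b, hb, rfl⟩ := Finset.mem_add.1 (support_mul f g he)
  exact (add_le_add (mem_frobIdeal.1 hf a ha) (mem_frobIdeal.1 hg b hb)).trans
    (pcount_add_le p a b)

lemma frobIdeal_pow {i : ℕ} {f : MvPolynomial α k} (hf : f ∈ frobIdeal k p α i) (n : ℕ) :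
    f ^ n ∈ frobIdeal k p α (n * i) := by
  induction n with
  | zero => exact frobIdeal_mono (by simp) (frobIdeal_zero _)
  | succ n ih =>
    rw [pow_succ, add_mul, one_mul]
    exact frobIdeal_mul ih hf

lemma frobIdeal_prod {ι : Type*} (s : Finset ι) (i : ι → ℕ) (f : ι → MvPolynomial α k)
    (h : ∀ a ∈ s, f a ∈ frobIdeal k p α (i a)) :
    ∏ a ∈ s, f a ∈ frobIdeal k p α (∑ a ∈ s, i a) := by
  classical
  induction s using Finset.induction_on with
  | empty => exact frobIdeal_zero _
  | insert a s ha ih =>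
    rw [Finset.prod_insert ha, Finset.sum_insert ha]
    exact frobIdeal_mul (h a (Finset.mem_insert_self a s))
      (ih fun b hb ↦ h b (Finset.mem_insert_of_mem hb))

lemma frobIdeal_pow_div {f : MvPolynomial α k} (hf : f ^ p ∈ frobIdeal k p α 1) (n : ℕ) :
    f ^ n ∈ frobIdeal k p α (n / p) := by
  have := frobIdeal_mul (frobIdeal_pow hf (n / p)) (frobIdeal_zero (p := p) (f ^ (n % p)))
  rwa [← pow_mul, ← pow_add, Nat.div_add_mod, mul_one, add_zero] at this

/-- Algebra maps which send variables to linear forms preserve the filtration. -/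
lemma frobIdeal_aeval (q : α → MvPolynomial β k) (hq : ∀ a, q a ^ p ∈ frobIdeal k p β 1)
    {f : MvPolynomial α k} {i : ℕ} (hf : f ∈ frobIdeal k p α i) :
    aeval q f ∈ frobIdeal k p β i := by
  rw [aeval_def, eval₂_eq']
  refine Submodule.sum_mem _ fun e he ↦ ?_
  rw [algebraMap_eq, ← smul_eq_C_mul]
  refine Submodule.smul_mem _ _ (frobIdeal_mono (hf he) ?_)
  exact frobIdeal_prod Finset.univ (fun a ↦ e a / p) (fun a ↦ q a ^ e a) fun a _ ↦
    frobIdeal_pow_div (hq a) (e a)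

end Ideal

variable {p : ℕ} [Fact p.Prime] [CharP k p]

lemma lin_pow_mem {σ : Type} [Fintype σ] (i : σ) {V : FV p} (v : V) :
    lin k i v ^ p ∈ frobIdeal k p (σ × Fin (Module.finrank (ZMod p) V)) 1 := by
  change (∑ a, C (ZMod.castHom (dvd_refl p) k ((bas V).repr v a)) * X (i, a) : Pol k σ V) ^ p ∈ _
  rw [sum_pow_char]
  refine Submodule.sum_mem _ fun a _ ↦ ?_
  rw [mul_pow, ← C_pow, ← smul_eq_C_mul]
  refine Submodule.smul_mem _ _ ?_
  classical
  rw [X_pow_eq_monomial]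
  intro e he
  obtain rfl := Finset.mem_singleton.1 (support_monomial_subset he)
  refine le_trans ?_ (Finset.single_le_sum (f := fun b ↦ (Finsupp.single (i, a) p) b / p)
    (fun _ _ ↦ Nat.zero_le _) (Finset.mem_univ (i, a)))
  simp [Nat.div_self (Fact.out : p.Prime).pos]

omit [CharP k p] in
lemma plift_frobIdeal {σ : Type} [Fintype σ] {V : FV p} {β : Type} [Fintype β]
    (A : σ → V →+ MvPolynomial β k) (hA : ∀ i v, A i v ^ p ∈ frobIdeal k p β 1) {i : ℕ}
    {f : Pol k σ V} (hf : f ∈ frobIdeal k p (σ × Fin (Module.finrank (ZMod p) V)) i) :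
    plift A f ∈ frobIdeal k p β i :=
  frobIdeal_aeval _ (fun _ ↦ hA _ _) hf

lemma pmap_frobIdeal {σ : Type} [Fintype σ] {V U : FV p} (g : σ → (V ⟶ U)) {i : ℕ}
    {f : Pol k σ V} (hf : f ∈ frobIdeal k p (σ × Fin (Module.finrank (ZMod p) V)) i) :
    pmap k g f ∈ frobIdeal k p (σ × Fin (Module.finrank (ZMod p) U)) i :=
  plift_frobIdeal (fun i ↦ (lin k i).comp (g i).hom.hom.toAddMonoidHom)
    (fun i v ↦ lin_pow_mem i (g i v)) hf

/-- The Frobenius filtration of the symmetric powers. -/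
noncomputable def frobSym (k : Type u) [Field k] (p : ℕ) [Fact p.Prime] [CharP k p] (i n : ℕ) :
    SubPol k p Unit where
  N V := frobIdeal k p _ i ⊓ (sym k p n).N V
  stable g _ hf := ⟨pmap_frobIdeal g hf.1, (sym k p n).stable g _ hf.2⟩

/-- The inclusion of a subfunctor of polynomials. -/
noncomputable abbrev SubPol.incl {σ : Type} (N N' : SubPol k p σ) (h : ∀ V, N.N V ≤ N'.N V) :
    N.fn ⟶ N'.fn :=
  SubPol.hom N N' (fun _ ↦ LinearMap.id) (fun _ _ _ ↦ rfl) h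

/-- The exponent of the image of a monomial under `f(x, y) ↦ f(x, x^p)`. -/
noncomputable def twistExp (p : ℕ) {ι : Type} [Fintype ι] (e : Fin 2 × ι →₀ ℕ) : Unit × ι →₀ ℕ :=
  Finsupp.equivFunOnFinite.symm fun x ↦ e (0, x.2) + p * e (1, x.2)

/-- The substitution `f(x, y) ↦ f(x, x^p)`. -/
noncomputable def frobMul (k : Type u) [Field k] [CharP k p] (V : FV p) :
    Pol k (Fin 2) V →ₐ[k] Pol k Unit V :=
  plift fun i ↦ (iterateFrobenius (Pol k Unit V) p i).toAddMonoidHom.comp (lin k ())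

lemma frobMul_monomial (V : FV p) (e) (a : k) :
    frobMul k V (monomial e a) = monomial (twistExp p e) a := by
  rw [frobMul, plift, aeval_monomial, monomial_eq, Finsupp.prod_fintype _ _ (by simp),
    Finsupp.prod_fintype _ _ (by simp), Fintype.prod_prod_type, Fintype.prod_prod_type,
    Fintype.prod_unique (fun x : Unit ↦ _), Fin.prod_univ_two, ← Finset.prod_mul_distrib]
  refine congrArg _ (Finset.prod_congr rfl fun x _ ↦ ?_)
  change iterateFrobenius (Pol k Unit V) p 0 (lin k () (bas V x)) ^ _ *
    iterateFrobenius (Pol k Unit V) p 1 (lin k () (bas V x)) ^ _ = _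
  rw [lin_bas, iterateFrobenius_def, iterateFrobenius_def, pow_zero, pow_one, pow_one, ← pow_mul,
    ← pow_add]
  rfl

lemma frobMul_eq (V : FV p) (f : Pol k (Fin 2) V) :
    frobMul k V f = mapExp k (twistExp p) f := by
  induction f using MvPolynomial.induction_on' with
  | monomial e a => rw [frobMul_monomial, mapExp_monomial]
  | add f g hf hg => rw [map_add, map_add, hf, hg]

lemma frobMul_pmap {V U : FV p} (g : V ⟶ U) (f : Pol k (Fin 2) V) :
    frobMul k U (pmap k (fun _ ↦ g) f) = pmap k (fun _ ↦ g) (frobMul k V f) := by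
  refine congrArg (fun F : Pol k (Fin 2) V →ₐ[k] Pol k Unit U ↦ F f) (pol_algHom_ext
    (f := (frobMul k U).comp (pmap k fun _ ↦ g)) (g := (pmap k fun _ ↦ g).comp (frobMul k V))
    fun i v ↦ ?_)
  rw [AlgHom.comp_apply, AlgHom.comp_apply, pmap_lin, frobMul, frobMul, plift_lin, plift_lin]
  change iterateFrobenius _ p i (lin k () (g v)) = pmap k _ (iterateFrobenius _ p i (lin k () v))
  rw [iterateFrobenius_def, iterateFrobenius_def, map_pow, pmap_lin]

lemma bisym_degree {V : FV p} {f : Pol k (Fin 2) V} {a b : ℕ} (hf : f ∈ (bisym k p a b).N V)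
    {e} (he : e ∈ f.support) : ∑ x, e (0, x) = a ∧ ∑ x, e (1, x) = b := by
  have h : Finsupp.weight (fun x : Fin 2 × _ ↦ biw x.1) e = (a, b) := hf (mem_support_iff.1 he)
  rw [Finsupp.weight_apply, Finsupp.sum_fintype _ _ (by simp), Fintype.sum_prod_type,
    Fin.sum_univ_two] at h
  have h1 := congrArg (AddMonoidHom.fst ℕ ℕ) h
  have h2 := congrArg (AddMonoidHom.snd ℕ ℕ) h
  simp only [map_add, map_sum, map_nsmul] at h1 h2
  simpa [biw] using And.intro h1 h2

lemma sym_degree {V : FV p} {f : Pol k Unit V} {n : ℕ} :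
    f ∈ (sym k p n).N V ↔ ∀ e ∈ f.support, ∑ x, e x = n := by
  change (∀ e, coeff e f ≠ 0 → _) ↔ _
  simp only [← mem_support_iff, Finsupp.weight_apply]
  refine forall₂_congr fun e _ ↦ ?_
  rw [Finsupp.sum_fintype _ _ (by simp)]
  simp

lemma pcount_twistExp {ι : Type} [Fintype ι] (e : Fin 2 × ι →₀ ℕ) :
    pcount p (twistExp p e) = ∑ x, e (0, x) / p + ∑ x, e (1, x) := by
  have hp := (Fact.out : p.Prime).pos
  rw [pcount, Fintype.sum_prod_type, Fintype.sum_unique, ← Finset.sum_add_distrib]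
  refine Finset.sum_congr rfl fun x _ ↦ ?_
  change (e (0, x) + p * e (1, x)) / p = _
  rw [Nat.add_mul_div_left _ _ hp]

omit [Fact p.Prime] in
lemma sum_twistExp {ι : Type} [Fintype ι] (e : Fin 2 × ι →₀ ℕ) :
    ∑ x, twistExp p e x = ∑ x, e (0, x) + p * ∑ x, e (1, x) := by
  rw [Fintype.sum_prod_type, Fintype.sum_unique, Finset.mul_sum, ← Finset.sum_add_distrib]
  rfl

lemma frobMul_mem {V : FV p} {f : Pol k (Fin 2) V} {i n a : ℕ} (h : a + p * i = n)
    (hf : f ∈ (bisym k p a i).N V) : frobMul k V f ∈ (frobSym k p i n).N V := by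
  rw [frobMul_eq]
  refine ⟨fun d hd ↦ ?_, sym_degree.2 fun d hd ↦ ?_⟩ <;>
    obtain ⟨e, he, rfl⟩ := mapExp_mem_support hd <;> obtain ⟨h1, h2⟩ := bisym_degree hf he
  · change i ≤ pcount p _
    rw [pcount_twistExp]
    omega
  · rw [sum_twistExp, h1, h2, h]

/-- The natural transformation `f(x, y) ↦ f(x, x^p)`. -/
noncomputable def frobMulHom (a i n : ℕ) (h : a + p * i = n) :
    (bisym k p a i).fn ⟶ (frobSym k p i n).fn :=
  SubPol.hom _ _ (fun V ↦ (frobMul k V).toLinearMap) (fun g f _ ↦ frobMul_pmap g f)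
    (fun _ _ hf ↦ frobMul_mem h hf)

lemma frobMul_reflect {V : FV p} {f : Pol k (Fin 2) V} {a i : ℕ}
    (hf : f ∈ (bisym k p a i).N V) (h : frobMul k V f ∈ frobIdeal k p _ (i + 1)) {e}
    (he : e ∈ f.support) : 1 ≤ ∑ x, e (0, x) / p := by
  by_contra! hc
  have hc' : ∑ x, e (0, x) / p = 0 := by omega
  have hp := (Fact.out : p.Prime).pos
  have h1 : coeff (twistExp p e) (frobMul k V f) = coeff e f := by
    rw [frobMul_eq]
    refine mapExp_coeff_eq _ fun d hd hde ↦ ?_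
    have h2 : pcount p (twistExp p d) = pcount p (twistExp p e) := by rw [hde]
    rw [pcount_twistExp, pcount_twistExp, (bisym_degree hf hd).2, (bisym_degree hf he).2,
      hc'] at h2
    have h3 : ∑ x, d (0, x) / p = 0 := by omega
    rw [Finset.sum_eq_zero_iff] at h3 hc'
    have h4 : ∀ x, d (0, x) = e (0, x) ∧ d (1, x) = e (1, x) := fun x ↦ by
      have h5 : d (0, x) + p * d (1, x) = e (0, x) + p * e (1, x) := DFunLike.congr_fun hde ((), x)
      have h6 := (Nat.div_eq_zero_iff_lt hp).1 (h3 x (Finset.mem_univ x))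
      have h7 := (Nat.div_eq_zero_iff_lt hp).1 (hc' x (Finset.mem_univ x))
      have h8 : d (0, x) = e (0, x) := by
        have := congrArg (· % p) h5
        simpa [Nat.mod_eq_of_lt h6, Nat.mod_eq_of_lt h7] using this
      exact ⟨h8, Nat.eq_of_mul_eq_mul_left hp (by omega)⟩
    ext ⟨j, x⟩
    fin_cases j
    · exact (h4 x).1
    · exact (h4 x).2
  have h2 := h (show twistExp p e ∈ (frobMul k V f).support by
    rw [mem_support_iff, h1]; exact mem_support_iff.1 he)
  have h3 : i + 1 ≤ pcount p (twistExp p e) := h2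
  rw [pcount_twistExp, (bisym_degree hf he).2] at h3
  omega

lemma plift_mem_frobIdeal_succ {V : FV p} {f : Pol k (Fin 2) V} {a i : ℕ} {β : Type} [Fintype β]
    (hf : f ∈ (bisym k p a i).N V) (h : ∀ e ∈ f.support, 1 ≤ ∑ x, e (0, x) / p)
    (A : Fin 2 → V →+ MvPolynomial β k) (h0 : ∀ v, A 0 v ^ p ∈ frobIdeal k p β 1)
    (h1 : ∀ v, A 1 v ∈ frobIdeal k p β 1) : plift A f ∈ frobIdeal k p β (i + 1) := by
  rw [plift, aeval_def, eval₂_eq']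
  refine Submodule.sum_mem _ fun e he ↦ ?_
  rw [algebraMap_eq, ← smul_eq_C_mul, Fintype.prod_prod_type, Fin.prod_univ_two]
  have h2 := frobIdeal_mul
    (frobIdeal_prod Finset.univ (fun x ↦ e (0, x) / p) (fun x ↦ A 0 (bas V x) ^ e (0, x))
      fun x _ ↦ frobIdeal_pow_div (h0 _) _)
    (frobIdeal_prod Finset.univ (fun x ↦ e (1, x) * 1) (fun x ↦ A 1 (bas V x) ^ e (1, x))
      fun x _ ↦ frobIdeal_pow (h1 _) _)
  refine Submodule.smul_mem _ _ (frobIdeal_mono ?_ h2)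
  simp only [mul_one, (bisym_degree hf he).2]
  have := h e he
  omega

/-- The comparison of successive steps of the Frobenius filtration. -/
noncomputable abbrev frobIncl (k : Type u) [Field k] (p : ℕ) [Fact p.Prime] [CharP k p]
    (i n : ℕ) : (frobSym k p (i + 1) n).fn ⟶ (frobSym k p i n).fn :=
  SubPol.incl _ _ fun _ ↦ inf_le_inf_right _ (frobIdeal_mono (Nat.le_succ i))

lemma SubPol.mono_incl {σ : Type} (N N' : SubPol k p σ) (h : ∀ V, N.N V ≤ N'.N V) :
    Mono (N.incl N' h) :=
  mono_of_injective _ fun V ↦ (Submodule.inclusion_injective (h V) :)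

omit [CharP k p] in
lemma shortExact_cokernel {F G : Fun k p} (f : F ⟶ G) [Mono f] :
    (ShortComplex.mk f (Limits.cokernel.π f) (by simp)).ShortExact :=
  ShortComplex.ShortExact.mk (ShortComplex.exact_cokernel f)

omit [CharP k p] in
lemma shortExact_kernel {F G : Fun k p} (f : F ⟶ G) [Epi f] :
    (ShortComplex.mk (Limits.kernel.ι f) f (by simp)).ShortExact :=
  ShortComplex.ShortExact.mk (ShortComplex.exact_kernel f)

lemma frobMul_surj {V : FV p} {f : Pol k Unit V} {i n a : ℕ} (h : a + p * i = n)
    (hf : f ∈ (frobSym k p i n).N V) :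
    ∃ g ∈ (bisym k p a i).N V, ∃ r ∈ (frobSym k p (i + 1) n).N V, frobMul k V g + r = f := by
  have hp := (Fact.out : p.Prime).pos
  suffices h1 : f ∈ ((bisym k p a i).N V).map (frobMul k V).toLinearMap ⊔
      (frobSym k p (i + 1) n).N V by
    obtain ⟨y, ⟨g, hg, rfl⟩, r, hr, hf'⟩ := Submodule.mem_sup.1 h1
    exact ⟨g, hg, r, hr, hf'⟩
  rw [f.as_sum]
  refine Submodule.sum_mem _ fun e he ↦ ?_
  have hn := sym_degree.1 hf.2 e he
  have hi : i ≤ pcount p e := hf.1 he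
  rcases hi.eq_or_lt with hi | hi
  · let d : Fin 2 × Fin (Module.finrank (ZMod p) V) →₀ ℕ :=
      Finsupp.equivFunOnFinite.symm fun y ↦ if y.1 = 0 then e ((), y.2) % p else e ((), y.2) / p
    have hd : twistExp p d = e := by
      ext ⟨_, x⟩
      exact Nat.mod_add_div _ _
    have h2 : ∑ x, d (1, x) = i := by
      rw [hi, pcount, Fintype.sum_prod_type, Fintype.sum_unique (fun x : Unit ↦ _)]
      rfl
    have h3 : ∑ x, d (0, x) = a := by
      have := sum_twistExp (p := p) d
      rw [hd, hn, h2] at this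
      omega
    refine Submodule.mem_sup_left ⟨monomial d (coeff e f), ?_, ?_⟩
    · refine isWeightedHomogeneous_monomial _ _ _ ?_
      rw [Finsupp.weight_apply, Finsupp.sum_fintype _ _ (by simp), Fintype.sum_prod_type,
        Fin.sum_univ_two, ← h2, ← h3]
      refine Prod.ext ((AddMonoidHom.fst ℕ ℕ).map_add _ _ |>.trans ?_)
        ((AddMonoidHom.snd ℕ ℕ).map_add _ _ |>.trans ?_) <;>
      · rw [map_sum, map_sum]
        simp [biw]
    · exact (frobMul_monomial V d _).trans (by rw [hd])
  · refine Submodule.mem_sup_right ⟨?_, ?_⟩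
    · exact (monomial_mem_restrictSupport k).2 (Or.inl hi)
    · refine isWeightedHomogeneous_monomial _ _ _ ?_
      rw [Finsupp.weight_apply, Finsupp.sum_fintype _ _ (by simp), ← hn]
      simp

lemma frobMul_split_mem {V : FV p} {f : Pol k (Fin 2) V} {a i : ℕ}
    (hf : f ∈ (bisym k p a i).N V) (h : frobMul k V f ∈ frobIdeal k p _ (i + 1)) :
    frobMul k (dblObj V) (pmap k (fun j ↦ if j = 0 then inl V else inr V) f) ∈
      frobIdeal k p _ (i + 1) := by
  set g : Fin 2 → (V ⟶ dblObj V) := fun j ↦ if j = 0 then inl V else inr V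
  set A : Fin 2 → V →+ Pol k Unit (dblObj V) := fun j ↦
    (iterateFrobenius (Pol k Unit (dblObj V)) p j).toAddMonoidHom.comp
      ((lin k ()).comp (g j).hom.hom.toAddMonoidHom) with hA
  have h1 : frobMul k (dblObj V) (pmap k g f) = plift A f := by
    refine congrArg (fun F : Pol k (Fin 2) V →ₐ[k] Pol k Unit (dblObj V) ↦ F f) (pol_algHom_ext
      (f := (frobMul k (dblObj V)).comp (pmap k g)) (g := plift A) fun i v ↦ ?_)
    rw [AlgHom.comp_apply, pmap_lin, frobMul, plift_lin, plift_lin]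
    rfl
  rw [h1]
  refine plift_mem_frobIdeal_succ hf (fun e he ↦ frobMul_reflect hf h he) A (fun v ↦ ?_)
    fun v ↦ ?_
  · change (iterateFrobenius (Pol k Unit (dblObj V)) p 0 (lin k () (g 0 v))) ^ p ∈ _
    rw [iterateFrobenius_def, pow_zero, pow_one]
    exact lin_pow_mem _ _
  · change (iterateFrobenius (Pol k Unit (dblObj V)) p 1 (lin k () (g 1 v))) ∈ _
    rw [iterateFrobenius_def, pow_one]
    exact lin_pow_mem _ _

/-- The projection to the subquotients of the Frobenius filtration. -/
noncomputable abbrev frobProj (k : Type u) [Field k] (p : ℕ) [Fact p.Prime] [CharP k p]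
    (i n : ℕ) : (frobSym k p i n).fn ⟶ Limits.cokernel (frobIncl k p i n) :=
  Limits.cokernel.π (frobIncl k p i n)

instance (i n : ℕ) : Mono (frobIncl k p i n) :=
  SubPol.mono_incl (frobSym k p (i + 1) n) (frobSym k p i n)
    fun _ ↦ inf_le_inf_right _ (frobIdeal_mono (Nat.le_succ i))

lemma frobProj_eq_zero_iff {i n : ℕ} {V : FV p} (f : (frobSym k p i n).N V) :
    (frobProj k p i n).app V f = 0 ↔ f.1 ∈ frobIdeal k p _ (i + 1) := by
  constructor
  · intro h
    obtain ⟨z, hz⟩ := shortExact_app (shortExact_cokernel (frobIncl k p i n)) (V := V) f h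
    revert z
    refine fun (z : (frobSym k p (i + 1) n).N V) hz ↦ ?_
    have h1 : z.1 = f.1 := congrArg Subtype.val hz
    exact h1 ▸ z.2.1
  · intro hf
    exact congrArg (fun F : (frobSym k p (i + 1) n).fn ⟶ _ ↦
      F.app V (⟨f.1, hf, f.2.2⟩ : (frobSym k p (i + 1) n).N V))
      (Limits.cokernel.condition (frobIncl k p i n))

/-- The projection from tensor products to the subquotients of the Frobenius filtration. -/
noncomputable abbrev frobQuot (k : Type u) [Field k] (p : ℕ) [Fact p.Prime] [CharP k p]
    (a i n : ℕ) (h : a + p * i = n) : (bisym k p a i).fn ⟶ Limits.cokernel (frobIncl k p i n) :=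
  frobMulHom a i n h ≫ frobProj k p i n

lemma frobQuot_eq_zero_iff {a i n : ℕ} (h : a + p * i = n) {V : FV p} (f : (bisym k p a i).N V) :
    (frobQuot k p a i n h).app V f = 0 ↔ frobMul k V f.1 ∈ frobIdeal k p _ (i + 1) :=
  frobProj_eq_zero_iff (⟨frobMul k V f.1, frobMul_mem h f.2⟩ : (frobSym k p i n).N V)

instance epi_frobQuot (a i n : ℕ) (h : a + p * i = n) : Epi (frobQuot k p a i n h) := by
  refine epi_of_surjective _ fun V y ↦ ?_
  obtain ⟨f, rfl⟩ := surjective_of_epi (frobProj k p i n) V y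
  revert f
  refine fun f : (frobSym k p i n).N V ↦ ?_
  obtain ⟨g, hg, r, hr, hf⟩ := frobMul_surj h f.2
  refine ⟨(⟨g, hg⟩ : (bisym k p a i).N V), ?_⟩
  have hr' : r ∈ (frobSym k p i n).N V := ⟨frobIdeal_mono (Nat.le_succ i) hr.1, hr.2⟩
  have h2 : f = (⟨frobMul k V g, frobMul_mem h hg⟩ : (frobSym k p i n).N V) + ⟨r, hr'⟩ :=
    Subtype.ext hf.symm
  rw [h2]
  refine Eq.trans ?_ (((frobProj k p i n).app V).hom.map_add _ _).symm
  exact ((congrArg _ ((frobProj_eq_zero_iff (i := i) (n := n) ⟨r, hr'⟩).2 hr.1)).trans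
    (add_zero _)).symm

lemma frobQuot_split {a i n : ℕ} (h : a + p * i = n) {V : FV p} (f : (bisym k p a i).N V)
    (hf : (frobQuot k p a i n h).app V f = 0) :
    (frobQuot k p a i n h).app (dblObj V)
      (((bisym k p a i).split (· = 0)).app V f : (bisym k p a i).N (dblObj V)) = 0 :=
  (frobQuot_eq_zero_iff h (V := dblObj V) _).2
    (frobMul_split_mem f.2 ((frobQuot_eq_zero_iff h f).1 hf))

lemma kernel_frobQuot_split {a i n : ℕ} (h : a + p * i = n) :
    Limits.kernel.ι (frobQuot k p a i n h) ≫ (bisym k p a i).split (· = 0) ≫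
      Functor.whiskerLeft (dbl p) (frobQuot k p a i n h) = 0 := by
  refine fun_hom_ext fun V y ↦ ?_
  exact frobQuot_split h ((Limits.kernel.ι (frobQuot k p a i n h)).app V y)
    (congrArg (fun F : Limits.kernel (frobQuot k p a i n h) ⟶ _ ↦ F.app V y)
      (Limits.kernel.condition (frobQuot k p a i n h)))

section

variable [HasExt.{w} (Fun k p)] {π : Fun k p} [π.Additive] {I : Type u}

omit [CharP k p] in
lemma TAcyc.of_dbl_epi {F G : Fun k p} (g : F ⟶ G) [Epi g] (α : F ⟶ dbl p ⋙ F)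
    (h1 : α ≫ fstT F = 0) (h2 : α ≫ sndT F = 0) (h : α ≫ foldT F = 𝟙 F)
    (hα : Limits.kernel.ι g ≫ α ≫ Functor.whiskerLeft (dbl p) g = 0) : TAcyc π I G :=
  TAcyc.of_dbl_quotient (S := ShortComplex.mk (Limits.kernel.ι g) g (Limits.kernel.condition _))
    (shortExact_kernel g) α h1 h2 h hα

/-- The steps of the Frobenius filtration have acyclic subquotients, except the last one. -/
lemma TAcyc.cokernel_frobIncl {a i n : ℕ} (h : a + p * i = n) (ha : a ≠ 0) (hi : i ≠ 0) :
    TAcyc π I (Limits.cokernel (frobIncl k p i n)) := by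
  have h0 := epi_frobQuot (k := k) a i n h
  have h1 := bisym_split_fst (k := k) (p := p) (a := a) hi
  have h2 := bisym_split_snd (k := k) (p := p) (b := i) ha
  have h3 := split_fold (· = 0) (bisym k p a i)
  have h4 := kernel_frobQuot_split (k := k) h
  generalize frobQuot k p a i n h = g at *
  generalize (bisym k p a i).split (· = 0) = s at *
  exact TAcyc.of_dbl_epi g s h1 h2 h3 h4

/-- The steps of the Frobenius filtration are Ext-isomorphisms, except the last one. -/
lemma TIso.of_frobIncl {a i n : ℕ} (h : a + p * i = n) (ha : a ≠ 0) (hi : i ≠ 0) :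
    TIso π I (frobIncl k p i n) := by
  have h1 := shortExact_cokernel (frobIncl k p i n)
  have h2 := TAcyc.cokernel_frobIncl (π := π) (I := I) h ha hi
  have h3 := TIso.of_acyc_right (S := ShortComplex.mk (frobIncl k p i n)
    (Limits.cokernel.π (frobIncl k p i n)) (Limits.cokernel.condition _)) h1 h2
  exact h3

end

end FrobeniusFiltration

section FrobeniusPowers

open MvPolynomial

variable {k : Type u} [Field k] {p : ℕ} [Fact p.Prime] [CharP k p]

lemma expand_lin {σ : Type} (i : σ) {V : FV p} (v : V) :
    expand p (lin k i v) = lin k i v ^ p := by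
  change expand p (∑ a, C (ZMod.castHom (dvd_refl p) k ((bas V).repr v a)) * X (i, a) :
    Pol k σ V) = (∑ a, C (ZMod.castHom (dvd_refl p) k ((bas V).repr v a)) * X (i, a)) ^ p
  rw [sum_pow_char, map_sum]
  refine Finset.sum_congr rfl fun a _ ↦ ?_
  rw [map_mul, expand_C, expand_X, mul_pow, ← C_pow, ← map_pow, ZMod.pow_card]

lemma expand_pmap {σ : Type} {V U : FV p} (g : σ → (V ⟶ U)) (f : Pol k σ V) :
    expand p (pmap k g f) = pmap k g (expand p f) := by
  refine congrArg (fun F : Pol k σ V →ₐ[k] Pol k σ U ↦ F f) (pol_algHom_ext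
    (f := (expand p).comp (pmap k g)) (g := (pmap k g).comp (expand p)) fun i v ↦ ?_)
  rw [AlgHom.comp_apply, AlgHom.comp_apply, pmap_lin, expand_lin, expand_lin, map_pow, pmap_lin]

lemma expand_mem_frobSym {V : FV p} {m : ℕ} {f : Pol k Unit V} (hf : f ∈ (sym k p m).N V) :
    expand p f ∈ (frobSym k p m (p * m)).N V := by
  classical
  have hp := (Fact.out : p.Prime)
  rw [sym_degree] at hf
  have h1 : ∀ d ∈ (expand p f).support, ∃ e, p • e = d ∧ ∑ x, e x = m := fun d hd ↦ by
    obtain ⟨e, he, rfl⟩ := Finset.mem_image.1 (support_expand_subset (p := p) f hd)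
    exact ⟨e, rfl, hf e he⟩
  refine ⟨fun d hd ↦ ?_, sym_degree.2 fun d hd ↦ ?_⟩ <;> obtain ⟨e, rfl, h⟩ := h1 d hd
  · change m ≤ pcount p _
    rw [← h, pcount]
    refine Finset.sum_le_sum fun x _ ↦ ?_
    rw [Finsupp.smul_apply, smul_eq_mul, Nat.mul_div_cancel_left _ hp.pos]
  · rw [← h, Finset.mul_sum]
    rfl

/-- The `p`-th power map. -/
noncomputable def expandHom (k : Type u) [Field k] (p : ℕ) [Fact p.Prime] [CharP k p] (m : ℕ) :
    (sym k p m).fn ⟶ (frobSym k p m (p * m)).fn :=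
  SubPol.hom _ _ (fun _ ↦ (expand p).toLinearMap) (fun g f _ ↦ expand_pmap (fun _ ↦ g) f)
    fun _ _ hf ↦ expand_mem_frobSym hf

lemma expand_surj {V : FV p} {m : ℕ} {f : Pol k Unit V} (hf : f ∈ (frobSym k p m (p * m)).N V) :
    ∃ g ∈ (sym k p m).N V, expand p g = f := by
  have hp := (Fact.out : p.Prime)
  suffices h : f ∈ ((sym k p m).N V).map (expand p (σ := _) (R := k)).toLinearMap from h
  rw [f.as_sum]
  refine Submodule.sum_mem _ fun e he ↦ ?_
  have hn := sym_degree.1 hf.2 e he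
  have hi : m ≤ pcount p e := hf.1 he
  have h1 : ∀ x, p * (e x / p) ≤ e x := fun x ↦ Nat.mul_div_le _ _
  have h2 : ∑ x, p * (e x / p) = ∑ x, e x := le_antisymm (Finset.sum_le_sum fun x _ ↦ h1 x)
    (by rw [hn, ← Finset.mul_sum]; exact Nat.mul_le_mul_left p hi)
  have h3 := (Finset.sum_eq_sum_iff_of_le fun x _ ↦ h1 x).1 h2
  let d : Unit × Fin (Module.finrank (ZMod p) V) →₀ ℕ :=
    Finsupp.equivFunOnFinite.symm fun x ↦ e x / p
  refine ⟨monomial d (coeff e f), ?_, ?_⟩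
  · refine sym_degree.2 fun d' hd' ↦ ?_
    obtain rfl := Finset.mem_singleton.1 (support_monomial_subset hd')
    refine Nat.eq_of_mul_eq_mul_left hp.pos ?_
    rw [Finset.mul_sum, ← hn]
    exact h2
  · refine (expand_monomial p d _).trans (congrArg (fun c ↦ monomial c (coeff e f)) ?_)
    exact Finsupp.ext fun x ↦ h3 x (Finset.mem_univ x)

instance isIso_expandHom (m : ℕ) : IsIso (expandHom k p m) := by
  refine isIso_of_bijective _ fun V ↦ ⟨?_, ?_⟩
  · exact fun (f g : (sym k p m).N V) h ↦
      Subtype.ext (expand_injective (Fact.out : p.Prime).pos (congrArg Subtype.val h))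
  · refine fun f : (frobSym k p m (p * m)).N V ↦ ?_
    obtain ⟨g, hg, h⟩ := expand_surj f.2
    exact ⟨(⟨g, hg⟩ : (sym k p m).N V), Subtype.ext h⟩

lemma isIso_incl_self {σ : Type} (N : SubPol k p σ) (h : ∀ V, N.N V ≤ N.N V) :
    IsIso (N.incl N h) :=
  isIso_of_bijective _ fun V ↦
    (⟨Submodule.inclusion_injective (h V), fun x : N.N V ↦ ⟨x, rfl⟩⟩ : Function.Bijective
      (Submodule.inclusion (h V)))

lemma frobSym_eq_bot {n m : ℕ} (h : n < p * m) (V : FV p) : (frobSym k p m n).N V = ⊥ := by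
  rw [eq_bot_iff]
  intro f hf
  by_contra hc
  obtain ⟨e, he⟩ := Finset.nonempty_iff_ne_empty.2 fun h0 ↦ hc (support_eq_empty.1 h0)
  have hn := sym_degree.1 hf.2 e he
  have hi : m ≤ pcount p e := hf.1 he
  have h2 : ∑ x, p * (e x / p) ≤ ∑ x, e x := Finset.sum_le_sum fun x _ ↦ Nat.mul_div_le _ _
  rw [hn, ← Finset.mul_sum] at h2
  exact absurd ((Nat.mul_le_mul_left p hi).trans h2) h.not_ge

variable [HasExt.{w} (Fun k p)] {π : Fun k p} [π.Additive] {I : Type u}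

omit [CharP k p] [π.Additive] in
lemma TAcyc.of_tIso {T T' : Fun k p} {f : T ⟶ T'} (hf : TIso π I f) (h : TAcyc π I T) :
    TAcyc π I T' := fun n ↦
  have := h n
  (hf n).2.subsingleton

lemma TAcyc.of_bot (N : SubPol k p Unit) (h : ∀ V, N.N V = ⊥) : TAcyc π I N.fn := by
  refine TAcyc.of_zeroT (fun_hom_ext fun V ↦ ?_)
  refine fun x : N.N V ↦ ?_
  have : Subsingleton (N.N V) := by rw [h V]; infer_instance
  exact Subsingleton.elim (α := N.N V) _ _

/-- The inclusions between the steps of the Frobenius filtration. -/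
lemma TIso.of_frobSym_incl {m n : ℕ} (hm : 1 ≤ m) (h : p * (m - 1) < n) :
    TIso π I ((frobSym k p m n).incl (frobSym k p 1 n)
      fun _ ↦ inf_le_inf_right _ (frobIdeal_mono hm)) := by
  induction m, hm using Nat.le_induction with
  | base => exact @TIso.of_isIso _ _ _ _ _ _ _ _ _ _ (isIso_incl_self _ _)
  | succ m hm ih =>
    rw [Nat.add_sub_cancel] at h
    have h1 : TIso π I _ := ih (lt_of_le_of_lt (Nat.mul_le_mul_left p (Nat.sub_le _ _)) h)
    have h2 : TIso π I (frobIncl k p m n) :=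
      TIso.of_frobIncl (Nat.sub_add_cancel h.le) (Nat.sub_pos_of_lt h).ne' (Nat.pos_iff_ne_zero.1 hm)
    have h3 := TIso.comp h2 h1
    exact h3

/-- The `p`-th power map into the kernel of reduction. -/
noncomputable abbrev powHom (k : Type u) [Field k] (p : ℕ) [Fact p.Prime] [CharP k p] (m : ℕ)
    (hm : 1 ≤ m) : (sym k p m).fn ⟶ (frobSym k p 1 (p * m)).fn :=
  expandHom k p m ≫ (frobSym k p m (p * m)).incl (frobSym k p 1 (p * m))
    fun _ ↦ inf_le_inf_right _ (frobIdeal_mono hm)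

lemma TIso.of_powHom {m : ℕ} (hm : 1 ≤ m) : TIso π I (powHom k p m hm) :=
  TIso.comp (TIso.of_isIso _) (TIso.of_frobSym_incl hm
    (mul_lt_mul_of_pos_left (by omega) (Fact.out : p.Prime).pos))

lemma TAcyc.of_frobSym_one {n : ℕ} (hn : ∀ h, n ≠ p ^ (h + 1)) :
    TAcyc π I (frobSym k p 1 n).fn := by
  have hp := (Fact.out : p.Prime)
  rcases Nat.eq_zero_or_pos n with rfl | h0
  · exact TAcyc.of_bot _ (frobSym_eq_bot (by simpa using hp.pos))
  by_cases h : p ∣ n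
  · obtain ⟨m, rfl⟩ := h
    have hm : 1 ≤ m := Nat.pos_of_mul_pos_left h0
    exact TAcyc.of_tIso (TIso.of_powHom hm) (TAcyc.of_sym fun h e ↦ hn h (by rw [e, pow_succ']))
  · have h1 : p * (n / p) < n :=
      lt_of_le_of_ne (Nat.mul_div_le _ _) fun e ↦ h ⟨_, e.symm⟩
    exact TAcyc.of_tIso (TIso.of_frobSym_incl (m := n / p + 1) (Nat.le_add_left _ _) h1)
      (TAcyc.of_bot _ (frobSym_eq_bot (Nat.lt_mul_div_succ n hp.pos)))

end FrobeniusPowers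

section PolynomialFunctions

open MvPolynomial

variable {k : Type u} [Field k] {p : ℕ} [Fact p.Prime]

section Reduction

/-- The reduction of an exponent modulo `x^p = x`. -/
def rdNat (p n : ℕ) : ℕ := if n < p then n else (n - 1) % (p - 1) + 1

omit [Fact p.Prime] in
lemma rdNat_of_lt {n : ℕ} (h : n < p) : rdNat p n = n := if_pos h

lemma rdNat_lt (n : ℕ) : rdNat p n < p := by
  have hp := (Fact.out : p.Prime).two_le
  rw [rdNat]
  split_ifs with h
  · exact h
  · have := Nat.mod_lt (n - 1) (show 0 < p - 1 by omega)
    omega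

lemma rdNat_lt_self {n : ℕ} (h : p ≤ n) : rdNat p n < n := (rdNat_lt n).trans_le h

lemma rdNat_le (n : ℕ) : rdNat p n ≤ n := by
  rcases lt_or_ge n p with h | h
  · exact (rdNat_of_lt h).le
  · exact (rdNat_lt_self h).le

lemma pow_rdNat (c : ZMod p) (n : ℕ) : c ^ rdNat p n = c ^ n := by
  have hp := (Fact.out : p.Prime).two_le
  rcases lt_or_ge n p with h | h
  · rw [rdNat_of_lt h]
  rw [rdNat, if_neg h.not_gt]
  rcases eq_or_ne c 0 with rfl | hc
  · rw [zero_pow (by omega), zero_pow (by omega)]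
  · have h1 : n = (p - 1) * ((n - 1) / (p - 1)) + ((n - 1) % (p - 1) + 1) := by
      have := Nat.div_add_mod (n - 1) (p - 1)
      omega
    conv_rhs => rw [h1, pow_add, pow_mul, ZMod.pow_card_sub_one_eq_one hc, one_pow, one_mul]

variable {α : Type*} [Fintype α]

/-- The reduction of exponents of monomials modulo `x^p = x`. -/
noncomputable def rdExp (p : ℕ) (e : α →₀ ℕ) : α →₀ ℕ :=
  Finsupp.equivFunOnFinite.symm fun x ↦ rdNat p (e x)

lemma sum_rdExp_le (e : α →₀ ℕ) : ∑ x, rdExp p e x ≤ ∑ x, e x :=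
  Finset.sum_le_sum fun x _ ↦ rdNat_le (e x)

lemma sum_rdExp_lt {e : α →₀ ℕ} (h : 1 ≤ pcount p e) : ∑ x, rdExp p e x < ∑ x, e x := by
  obtain ⟨x, -, hx⟩ := Finset.exists_ne_zero_of_sum_ne_zero (s := Finset.univ)
    (f := fun a ↦ e a / p) (Nat.one_le_iff_ne_zero.1 h)
  refine Finset.sum_lt_sum (fun x _ ↦ rdNat_le (e x)) ⟨x, Finset.mem_univ x, rdNat_lt_self ?_⟩
  by_contra! hc
  exact hx (Nat.div_eq_of_lt hc)

lemma rdExp_eq_self {e : α →₀ ℕ} (h : ∑ x, e x ≤ ∑ x, rdExp p e x) : rdExp p e = e :=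
  Finsupp.ext fun x ↦ (Finset.sum_eq_sum_iff_of_le fun x _ ↦ rdNat_le (p := p) (e x)).1
    (le_antisymm (sum_rdExp_le e) h) x (Finset.mem_univ x)

lemma rdExp_of_pcount {e : α →₀ ℕ} (h : pcount p e = 0) : rdExp p e = e := by
  refine Finsupp.ext fun x ↦ rdNat_of_lt ?_
  have := (Finset.sum_eq_zero_iff.1 h) x (Finset.mem_univ x)
  exact (Nat.div_eq_zero_iff.1 this).resolve_left (Fact.out : p.Prime).ne_zero

end Reduction

variable [CharP k p]

/-- The one-dimensional space. -/
abbrev line (p : ℕ) [Fact p.Prime] : FV p := FGModuleCat.of (ZMod p) (ZMod p)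

/-- Evaluation of polynomials at a linear form. -/
noncomputable def evAt (k : Type u) [Field k] [CharP k p] {V : FV p} (h : V ⟶ line p) :
    Pol k Unit V →ₐ[k] k :=
  plift fun _ ↦ (ZMod.castHom (dvd_refl p) k).toAddMonoidHom.comp h.hom.hom.toAddMonoidHom

lemma evAt_X {V : FV p} (h : V ⟶ line p) (x) :
    evAt k h (X x) = ZMod.castHom (dvd_refl p) k (h.hom.hom (bas V x.2)) := plift_X _ _

lemma evAt_lin {V : FV p} (h : V ⟶ line p) (v : V) :
    evAt k h (lin k () v) = ZMod.castHom (dvd_refl p) k (h.hom.hom v) := plift_lin _ _ _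

lemma evAt_pmap {V U : FV p} (g : V ⟶ U) (h : U ⟶ line p) (f : Pol k Unit V) :
    evAt k h (pmap k (fun _ ↦ g) f) = evAt k (g ≫ h) f := by
  refine congrArg (fun F : Pol k Unit V →ₐ[k] k ↦ F f) (pol_algHom_ext
    (f := (evAt k h).comp (pmap k fun _ ↦ g)) fun i v ↦ ?_)
  rw [AlgHom.comp_apply, pmap_lin, evAt_lin, evAt_lin]
  rfl

lemma evAt_expand {V : FV p} (h : V ⟶ line p) (f : Pol k Unit V) :
    evAt k h (expand p f) = evAt k h f := by
  refine congrArg (fun F : Pol k Unit V →ₐ[k] k ↦ F f) (pol_algHom_ext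
    (f := (evAt k h).comp (expand p)) fun i v ↦ ?_)
  rw [AlgHom.comp_apply, expand_lin, map_pow, evAt_lin, ← map_pow, ZMod.pow_card]

lemma evAt_red {V : FV p} (h : V ⟶ line p) (f : Pol k Unit V) :
    evAt k h (mapExp k (rdExp p) f) = evAt k h f := by
  induction f using MvPolynomial.induction_on' with
  | monomial e a =>
    rw [mapExp_monomial]
    simp only [evAt, plift, aeval_monomial]
    rw [Finsupp.prod_fintype _ _ (by simp), Finsupp.prod_fintype _ _ (by simp)]
    refine congrArg _ (Finset.prod_congr rfl fun x _ ↦ ?_)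
    change (ZMod.castHom (dvd_refl p) k (h.hom.hom (bas V x.2))) ^ rdNat p (e x) =
      (ZMod.castHom (dvd_refl p) k (h.hom.hom (bas V x.2))) ^ e x
    rw [← map_pow (ZMod.castHom (dvd_refl p) k), ← map_pow (ZMod.castHom (dvd_refl p) k), pow_rdNat]
  | add f g hf hg => rw [map_add, map_add, map_add, hf, hg]

/-- The linear form with given values on the basis. -/
noncomputable def formOf {V : FV p} (c : Fin (Module.finrank (ZMod p) V) → ZMod p) :
    V ⟶ line p := FGModuleCat.ofHom ((bas V).constr (ZMod p) c)

lemma formOf_bas {V : FV p} (c : Fin (Module.finrank (ZMod p) V) → ZMod p) (x) :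
    (formOf c).hom.hom (bas V x) = c x := (bas V).constr_basis _ _ _

lemma eq_zero_of_evAt {V : FV p} {f : Pol k Unit V} (hf : ∀ e ∈ f.support, ∀ x, e x < p)
    (h : ∀ g : V ⟶ line p, evAt k g f = 0) : f = 0 := by
  classical
  refine eq_zero_of_eval_zero_at_prod_finset f
    (fun _ ↦ Finset.univ.image (ZMod.castHom (dvd_refl p) k)) (fun x ↦ ?_) fun c hc ↦ ?_
  · rw [Finset.card_image_of_injective _ (ZMod.castHom (dvd_refl p) k).injective,
      Finset.card_univ, ZMod.card]
    exact (degreeOf_lt_iff (Fact.out : p.Prime).pos).2 fun e he ↦ hf e he x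
  · choose d hd hdc using fun x ↦ Finset.mem_image.1 (hc x)
    rw [← h (formOf fun x ↦ d ((), x))]
    rw [evAt, plift, aeval_eq_eval]
    refine congrArg (fun q ↦ eval q f) (funext fun x ↦ ?_)
    rw [← hdc x]
    exact congrArg _ (formOf_bas (fun x ↦ d ((), x)) x.2).symm

lemma exists_evAt {V : FV p} (g : (V ⟶ line p) → k) :
    ∃ f : Pol k Unit V, ∀ h, evAt k h f = g h := by
  classical
  have h1 : ∀ h₀ : V ⟶ line p, ∃ f : Pol k Unit V, ∀ h, evAt k h f = if h₀ = h then 1 else 0 := by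
    intro h₀
    refine ⟨∏ a, (1 - (X ((), a) -
      C (ZMod.castHom (dvd_refl p) k (h₀.hom.hom (bas V a)))) ^ (p - 1)), fun h ↦ ?_⟩
    rw [map_prod]
    have h2 : ∀ a, evAt k h (1 - (X ((), a) - C (ZMod.castHom (dvd_refl p) k
        (h₀.hom.hom (bas V a)))) ^ (p - 1)) =
        if h₀.hom.hom (bas V a) = h.hom.hom (bas V a) then 1 else 0 := by
      intro a
      have hp := (Fact.out : p.Prime).two_le
      rw [map_sub, map_pow, map_sub, map_one, evAt_X, algHom_C, Algebra.algebraMap_self_apply,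
        ← map_sub, ← map_pow]
      split_ifs with h3
      · rw [h3, sub_self, zero_pow (by omega), map_zero, sub_zero]
      · rw [ZMod.pow_card_sub_one_eq_one (sub_ne_zero.2 (Ne.symm h3)), map_one, sub_self]
    rw [Finset.prod_congr rfl fun a _ ↦ h2 a, Finset.prod_ite_zero]
    have h4 : (∀ a ∈ Finset.univ, h₀.hom.hom (bas V a) = h.hom.hom (bas V a)) ↔ h₀ = h := by
      refine ⟨fun h5 ↦ ?_, fun h5 _ _ ↦ h5 ▸ rfl⟩
      exact FGModuleCat.hom_ext ((bas V).ext fun a ↦ h5 a (Finset.mem_univ a))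
    simp only [h4, Finset.prod_const_one]
  choose δ hδ using h1
  have : Fintype (V ⟶ line p) := Fintype.ofFinite _
  refine ⟨∑ h₀, C (g h₀) * δ h₀, fun h ↦ ?_⟩
  rw [map_sum, Finset.sum_eq_single h]
  · rw [map_mul, hδ, if_pos rfl, mul_one, algHom_C]
    rfl
  · intro h₀ _ hne
    rw [map_mul, hδ, if_neg hne, mul_zero]
  · exact fun h ↦ absurd (Finset.mem_univ _) h

/-- Polynomials of degree at most `n`. -/
noncomputable def leq (k : Type u) [Field k] (p : ℕ) [Fact p.Prime] [CharP k p] (n : ℕ) :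
    SubPol k p Unit where
  N V := restrictSupport k {e | ∑ x, e x ≤ n}
  stable g f hf := by
    rw [f.as_sum, map_sum]
    refine Submodule.sum_mem _ fun e he ↦ ?_
    have h1 : monomial e (coeff e f) ∈ (sym k p (∑ x, e x)).N _ := by
      refine sym_degree.2 fun d' hd' ↦ ?_
      obtain rfl := Finset.mem_singleton.1 (support_monomial_subset hd')
      rfl
    have h2 := sym_degree.1 ((sym k p (∑ x, e x)).stable g _ h1)
    exact fun d hd ↦ (h2 d hd).trans_le (hf he)

lemma mem_leq {n : ℕ} {V : FV p} {f : Pol k Unit V} :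
    f ∈ (leq k p n).N V ↔ ∀ e ∈ f.support, ∑ x, e x ≤ n := Iff.rfl

lemma sym_le_leq (n : ℕ) (V : FV p) : (sym k p n).N V ≤ (leq k p n).N V :=
  fun _ hf ↦ mem_leq.2 fun e he ↦ (sym_degree.1 hf e he).le

/-- Evaluation of polynomials on linear forms. -/
noncomputable def evl (k : Type u) [Field k] [CharP k p] (V : FV p) :
    Pol k Unit V →ₗ[k] ((V ⟶ line p) → k) := LinearMap.pi fun h ↦ (evAt k h).toLinearMap

lemma evl_apply {V : FV p} (f : Pol k Unit V) (h : V ⟶ line p) : evl k V f h = evAt k h f := rfl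

lemma evl_red {V : FV p} (f : Pol k Unit V) :
    evl k V (mapExp k (rdExp p) f : Pol k Unit V) = evl k V f := by
  funext h
  rw [evl_apply, evl_apply]
  exact evAt_red h f

lemma evl_surjective (V : FV p) : Function.Surjective (evl k V) := fun g ↦ by
  obtain ⟨f, hf⟩ := exists_evAt g
  exact ⟨f, funext hf⟩

lemma eq_zero_of_evl {V : FV p} {f : Pol k Unit V} (hf : ∀ e ∈ f.support, ∀ x, e x < p)
    (h : evl k V f = 0) : f = 0 := eq_zero_of_evAt hf fun g ↦ congrFun h g

/-- Functions on linear forms given by polynomials of degree at most `n`. -/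
noncomputable def filN (k : Type u) [Field k] (p : ℕ) [Fact p.Prime] [CharP k p] (n : ℕ)
    (V : FV p) : Submodule k ((V ⟶ line p) → k) := ((leq k p n).N V).map (evl k V)

lemma evl_mem_filN {n : ℕ} {V : FV p} {f : Pol k Unit V} (hf : f ∈ (leq k p n).N V) :
    evl k V f ∈ filN k p n V := ⟨f, hf, rfl⟩

lemma filN_mono {m n : ℕ} (h : m ≤ n) (V : FV p) : filN k p m V ≤ filN k p n V :=
  Submodule.map_mono fun _ hf e he ↦ le_trans (mem_leq.1 hf e he) h

omit [CharP k p] in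
lemma rdExp_lt {α : Type*} [Fintype α] (e : α →₀ ℕ) (x : α) : rdExp p e x < p := rdNat_lt _

omit [CharP k p] in
lemma red_support_lt {α : Type*} [Fintype α] {f : MvPolynomial α k} {e : α →₀ ℕ}
    (he : e ∈ (mapExp k (rdExp p) f).support) (x : α) : e x < p := by
  obtain ⟨d, -, rfl⟩ := mapExp_mem_support he
  exact rdExp_lt d x

lemma filN_eq_top {n : ℕ} {V : FV p} (h : Module.finrank (ZMod p) V * p ≤ n)
    (g : (V ⟶ line p) → k) : g ∈ filN k p n V := by
  obtain ⟨f, rfl⟩ := evl_surjective V g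
  rw [← evl_red]
  refine evl_mem_filN (mem_leq.2 fun e he ↦ ?_)
  refine le_trans (Finset.sum_le_card_nsmul _ _ p fun x _ ↦ (red_support_lt he x).le) ?_
  simpa using h

lemma pcount_pos_of_red {n : ℕ} {V : FV p} {f g : Pol k Unit V}
    (hf : f ∈ (sym k p (n + 1)).N V) (hg : g ∈ (leq k p n).N V)
    (h1 : mapExp k (rdExp p) g = mapExp k (rdExp p) f) {e} (he : e ∈ f.support) :
    1 ≤ pcount p e := by
  by_contra! hc
  have he' := rdExp_of_pcount (Nat.lt_one_iff.1 hc)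
  have hn := sym_degree.1 hf e he
  have h2 : coeff (rdExp p e) (mapExp k (rdExp p) f) = coeff e f := by
    refine mapExp_coeff_eq _ fun d hd hde ↦ ?_
    rw [he'] at hde
    rw [← hde]
    refine (rdExp_eq_self ?_).symm
    rw [hde, hn, sym_degree.1 hf d hd]
  rw [he', ← h1] at h2
  obtain ⟨d, hd, hde⟩ := mapExp_mem_support
    (mem_support_iff.2 (h2.symm ▸ mem_support_iff.1 he))
  have h3 := sum_rdExp_le (p := p) d
  rw [hde, hn] at h3
  exact absurd (h3.trans (mem_leq.1 hg d hd)) (Nat.not_succ_le_self n)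

lemma evl_mem_filN_iff {n : ℕ} {V : FV p} {f : Pol k Unit V} (hf : f ∈ (sym k p (n + 1)).N V) :
    evl k V f ∈ filN k p n V ↔ f ∈ frobIdeal k p _ 1 := by
  constructor
  · rintro ⟨g, hg, hfg⟩
    have h1 : mapExp k (rdExp p) (g - f) = 0 := by
      refine eq_zero_of_evl (p := p) (fun e he x ↦ red_support_lt he x) ?_
      rw [evl_red, map_sub, hfg, sub_self]
    rw [map_sub, sub_eq_zero] at h1
    exact mem_frobIdeal.2 fun e he ↦ pcount_pos_of_red hf hg h1 he
  · intro h
    rw [← evl_red]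
    refine evl_mem_filN (mem_leq.2 fun e he ↦ ?_)
    obtain ⟨d, hd, rfl⟩ := mapExp_mem_support he
    have h3 := sum_rdExp_lt (p := p) (e := d) (mem_frobIdeal.1 h d hd)
    rw [sym_degree.1 hf d hd] at h3
    exact Nat.lt_succ_iff.1 h3

lemma leq_succ {n : ℕ} {V : FV p} {f : Pol k Unit V} (hf : f ∈ (leq k p (n + 1)).N V) :
    ∃ g ∈ (sym k p (n + 1)).N V, f - g ∈ (leq k p n).N V := by
  suffices h : f ∈ (sym k p (n + 1)).N V ⊔ (leq k p n).N V by
    obtain ⟨g, hg, r, hr, rfl⟩ := Submodule.mem_sup.1 h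
    exact ⟨g, hg, by rwa [add_sub_cancel_left]⟩
  rw [f.as_sum]
  refine Submodule.sum_mem _ fun e he ↦ ?_
  rcases (mem_leq.1 hf e he).eq_or_lt with h | h
  · refine Submodule.mem_sup_left (sym_degree.2 fun d' hd' ↦ ?_)
    obtain rfl := Finset.mem_singleton.1 (support_monomial_subset hd')
    exact h
  · refine Submodule.mem_sup_right (mem_leq.2 fun d' hd' ↦ ?_)
    obtain rfl := Finset.mem_singleton.1 (support_monomial_subset hd')
    exact Nat.lt_succ_iff.1 h

end PolynomialFunctions

section DegreeFiltration

variable {k : Type u} [Field k] {p : ℕ} [Fact p.Prime] [CharP k p]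

/-- Functoriality of functions on linear forms. -/
noncomputable abbrev funMap (k : Type u) [Field k] {V U : FV p} (g : V ⟶ U) :
    ((V ⟶ line p) → k) →ₗ[k] ((U ⟶ line p) → k) := LinearMap.funLeft k k fun h ↦ g ≫ h

lemma evl_pmap {V U : FV p} (g : V ⟶ U) (f : Pol k Unit V) :
    evl k U (pmap k (fun _ ↦ g) f) = funMap k g (evl k V f) := by
  funext h
  exact evAt_pmap g h f

lemma filN_stable (n : ℕ) {V U : FV p} (g : V ⟶ U) :
    ∀ x ∈ filN k p n V, funMap k g x ∈ filN k p n U := by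
  rintro _ ⟨f, hf, rfl⟩
  rw [← evl_pmap]
  exact evl_mem_filN ((leq k p n).stable (fun _ ↦ g) f hf)

/-- The functor of functions given by polynomials of degree at most `n`. -/
noncomputable def fil (k : Type u) [Field k] (p : ℕ) [Fact p.Prime] [CharP k p] (n : ℕ) :
    Fun k p where
  obj V := ModuleCat.of k (filN k p n V)
  map g := ModuleCat.ofHom ((funMap k g).restrict (filN_stable n g))
  map_id V := by
    ext1
    exact LinearMap.ext fun f ↦ Subtype.ext rfl
  map_comp g h := by
    ext1
    refine LinearMap.ext ?_
    exact fun f : filN k p n _ ↦ Subtype.ext (funext fun l ↦ congrArg f.1 (Category.assoc g h l))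

/-- The inclusions between the steps of the degree filtration. -/
noncomputable def filIncl (k : Type u) [Field k] (p : ℕ) [Fact p.Prime] [CharP k p] {m n : ℕ}
    (h : m ≤ n) : fil k p m ⟶ fil k p n where
  app V := ModuleCat.ofHom (Submodule.inclusion (filN_mono h V))
  naturality _ _ _ := rfl

lemma filIncl_comp {l m n : ℕ} (h : l ≤ m) (h' : m ≤ n) :
    filIncl k p h ≫ filIncl k p h' = filIncl k p (h.trans h') := rfl

instance {m n : ℕ} (h : m ≤ n) : Mono (filIncl k p h) :=
  mono_of_injective _ fun V ↦ (Submodule.inclusion_injective (filN_mono (k := k) h V) :)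

/-- The functor of all functions on linear forms. -/
noncomputable abbrev allFun (k : Type u) [Field k] (p : ℕ) [Fact p.Prime] : Fun k p :=
  coind (line p) (ModuleCat.of k k)

/-- The inclusion of the functions of bounded degree. -/
noncomputable def filToAll (k : Type u) [Field k] (p : ℕ) [Fact p.Prime] [CharP k p] (n : ℕ) :
    fil k p n ⟶ allFun k p where
  app V := ModuleCat.ofHom (filN k p n V).subtype
  naturality _ _ _ := rfl

instance (n : ℕ) : Mono (filToAll k p n) :=
  mono_of_injective _ fun V ↦ ((filN k p n V).subtype_injective :)

/-- Evaluation from a functor of polynomials. -/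
noncomputable def evHom (N : SubPol k p Unit) (n : ℕ)
    (h : ∀ V, ∀ f ∈ N.N V, evl k V f ∈ filN k p n V) : N.fn ⟶ fil k p n where
  app V := ModuleCat.ofHom ((evl k V).restrict (h V))
  naturality V U g := by
    ext1
    refine LinearMap.ext ?_
    exact fun f : N.N V ↦ Subtype.ext (evl_pmap g f.1)

/-- Evaluation from symmetric powers. -/
noncomputable abbrev evSym (k : Type u) [Field k] (p : ℕ) [Fact p.Prime] [CharP k p] (n : ℕ) :
    (sym k p n).fn ⟶ fil k p n :=
  evHom _ n fun V _ hf ↦ evl_mem_filN (sym_le_leq n V hf)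

/-- The graded pieces of the degree filtration. -/
noncomputable abbrev filGr (k : Type u) [Field k] (p : ℕ) [Fact p.Prime] [CharP k p] (n : ℕ) :
    Fun k p := Limits.cokernel (filIncl k p n.le_succ)

/-- The kernel of evaluation modulo lower degree, evaluated. -/
noncomputable abbrev evFrob (k : Type u) [Field k] (p : ℕ) [Fact p.Prime] [CharP k p] (n : ℕ) :
    (frobSym k p 1 (n + 1)).fn ⟶ fil k p n :=
  evHom _ n fun _ _ hf ↦ (evl_mem_filN_iff hf.2).2 hf.1

/-- The inclusion of the kernel of evaluation modulo lower degree. -/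
noncomputable abbrev frobToSym (k : Type u) [Field k] (p : ℕ) [Fact p.Prime] [CharP k p] (n : ℕ) :
    (frobSym k p 1 n).fn ⟶ (sym k p n).fn :=
  (frobSym k p 1 n).incl (sym k p n) fun _ ↦ inf_le_right

/-- Evaluation modulo lower degree. -/
noncomputable abbrev symToGr (k : Type u) [Field k] (p : ℕ) [Fact p.Prime] [CharP k p] (n : ℕ) :
    (sym k p (n + 1)).fn ⟶ filGr k p n :=
  evSym k p (n + 1) ≫ Limits.cokernel.π (filIncl k p n.le_succ)

lemma frob_square (n : ℕ) :
    frobToSym k p (n + 1) ≫ evSym k p (n + 1) = evFrob k p n ≫ filIncl k p n.le_succ := rfl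

lemma frobToSym_symToGr (n : ℕ) : frobToSym k p (n + 1) ≫ symToGr k p n = 0 :=
  (congrArg (fun f ↦ f ≫ Limits.cokernel.π (filIncl k p n.le_succ)) (frob_square n)).trans
    ((Category.assoc _ _ _).trans (by rw [Limits.cokernel.condition, Limits.comp_zero]))

lemma filGr_eq_zero {n : ℕ} {V : FV p} (x : filN k p (n + 1) V)
    (h : (Limits.cokernel.π (filIncl k p n.le_succ)).app V x = 0) : x.1 ∈ filN k p n V := by
  obtain ⟨y, hy⟩ := shortExact_app (shortExact_cokernel (filIncl k p n.le_succ)) (V := V) x h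
  revert y
  refine fun (y : filN k p n V) hy ↦ ?_
  have h1 : y.1 = x.1 := congrArg Subtype.val hy
  exact h1 ▸ y.2

lemma filGr_zero {n : ℕ} {V : FV p} (y : filN k p n V) :
    (Limits.cokernel.π (filIncl k p n.le_succ)).app V
      (⟨y.1, filN_mono n.le_succ V y.2⟩ : filN k p (n + 1) V) = 0 :=
  congrArg (fun F : fil k p n ⟶ _ ↦ F.app V y)
    (Limits.cokernel.condition (filIncl k p n.le_succ))

lemma symToGr_surjective (n : ℕ) (V : FV p) : Function.Surjective ((symToGr k p n).app V) := by
  intro y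
  obtain ⟨x, rfl⟩ := surjective_of_epi (Limits.cokernel.π (filIncl k p n.le_succ)) V y
  revert x
  refine fun x : filN k p (n + 1) V ↦ ?_
  obtain ⟨f, hf, hfx⟩ := x.2
  obtain ⟨g, hg, hfg⟩ := leq_succ hf
  refine ⟨(⟨g, hg⟩ : (sym k p (n + 1)).N V), ?_⟩
  have hr := evl_mem_filN hfg
  have hs := evl_mem_filN (sym_le_leq _ V hg)
  have h2 : x = (⟨evl k V g, hs⟩ : filN k p (n + 1) V) +
      ⟨evl k V (f - g), filN_mono n.le_succ V hr⟩ := by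
    refine Subtype.ext (hfx.symm.trans ?_)
    exact (add_sub_cancel _ _).symm.trans
      (congrArg (evl k V g + ·) (map_sub (evl k V) f g).symm)
  rw [h2]
  refine Eq.trans ?_ (((Limits.cokernel.π (filIncl k p n.le_succ)).app V).hom.map_add _ _).symm
  exact ((congrArg _ (filGr_zero ⟨evl k V (f - g), hr⟩)).trans (add_zero _)).symm

lemma shortExact_symToGr (n : ℕ) :
    (ShortComplex.mk (frobToSym k p (n + 1)) (symToGr k p n)
      (frobToSym_symToGr n)).ShortExact := by
  refine shortExact_of_pointwise _ (fun V ↦ ?_) (symToGr_surjective n) fun V ↦ ?_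
  · exact (Submodule.inclusion_injective (inf_le_right :
      frobIdeal k p _ 1 ⊓ (sym k p (n + 1)).N V ≤ _) :)
  · refine fun (f : (sym k p (n + 1)).N V) hf ↦ ?_
    have h1 := filGr_eq_zero (⟨evl k V f.1, evl_mem_filN (sym_le_leq _ V f.2)⟩ :
      filN k p (n + 1) V) hf
    exact ⟨(⟨f.1, (evl_mem_filN_iff f.2).1 h1, f.2⟩ : (frobSym k p 1 (n + 1)).N V), rfl⟩

lemma powHom_evFrob {m n : ℕ} (hm : 1 ≤ m) (h : p * m = n + 1) (h' : m ≤ n) :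
    evSym k p m ≫ filIncl k p h' =
      (expandHom k p m ≫ (frobSym k p m (p * m)).incl (frobSym k p 1 (n + 1))
        fun _ ↦ by rw [← h]; exact inf_le_inf_right _ (frobIdeal_mono hm)) ≫ evFrob k p n := by
  refine fun_hom_ext fun V ↦ ?_
  refine fun f : (sym k p m).N V ↦ Subtype.ext (funext fun h ↦ ?_)
  exact (evAt_expand h f.1).symm

variable [HasExt.{w} (Fun k p)] {π : Fun k p} [π.Additive] {I : Type u}

lemma TAcyc.of_filGr {n : ℕ} (hn : ∀ h, n + 1 ≠ p ^ h) : TAcyc π I (filGr k p n) :=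
  TAcyc.right (shortExact_symToGr n) (TAcyc.of_frobSym_one fun h ↦ hn (h + 1)) (TAcyc.of_sym hn)

end DegreeFiltration

section FrobeniusPowers

variable {k : Type u} [Field k] {p : ℕ} [Fact p.Prime] [CharP k p]

variable [HasExt.{w} (Fun k p)] {π : Fun k p} [π.Additive] {I : Type u}

omit [π.Additive] [CharP k p] in
lemma TIso.of_tAcyc {T T' : Fun k p} (f : T ⟶ T') (h : TAcyc π I T) (h' : TAcyc π I T') :
    TIso π I f := fun n ↦ by
  have h1 := h n
  have h2 := h' n
  exact ⟨fun x y _ ↦ Subsingleton.elim x y, fun y ↦ ⟨0, Subsingleton.elim _ _⟩⟩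

omit [π.Additive] in
lemma TIso.of_evSym_succ {n : ℕ} (h : TIso π I (evFrob k p n)) :
    TIso π I (evSym k p (n + 1)) := by
  have h1 := TIso.mid_of_left (π := π) (I := I) (shortExact_symToGr (k := k) (p := p) n)
    (shortExact_cokernel (filIncl k p n.le_succ))
    (ShortComplex.Hom.mk (evFrob k p n) (evSym k p (n + 1)) (𝟙 (filGr k p n))
      (frob_square n).symm (Category.comp_id _).symm) h (inferInstanceAs (IsIso (𝟙 _)))
  exact h1

lemma TIso.of_filIncl {m n : ℕ} (h : m ≤ n) (hn : ∀ j, m < j → j ≤ n → ∀ h, j ≠ p ^ h) :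
    TIso π I (filIncl k p h) := by
  induction n, h using Nat.le_induction with
  | base => exact TIso.of_isIso (𝟙 (fil k p m))
  | succ n h ih =>
    have h1 : TIso π I (filIncl k p n.le_succ) := TIso.of_acyc_right
      (shortExact_cokernel (filIncl k p n.le_succ))
      (TAcyc.of_filGr (hn (n + 1) (by omega) le_rfl))
    have h2 := TIso.comp (ih fun j hj hj' ↦ hn j hj (by omega)) h1
    rwa [filIncl_comp] at h2

lemma TAcyc.of_fil_zero : TAcyc π I (fil k p 0) := by
  refine TAcyc.of_zeroT (fun_hom_ext fun V ↦ ?_)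
  refine fun x : filN k p 0 V ↦ Subtype.ext (funext fun h ↦ ?_)
  obtain ⟨f, hf, hfx⟩ := x.2
  change x.1 ((0 : V ⟶ V) ≫ h) = x.1 h
  have h1 : f = MvPolynomial.C (MvPolynomial.coeff 0 f) := by
    refine MvPolynomial.totalDegree_eq_zero_iff_eq_C.1 (Nat.le_zero.1 ?_)
    refine Finset.sup_le fun e he ↦ ?_
    rw [Finsupp.sum_fintype _ _ fun _ ↦ rfl]
    exact mem_leq.1 hf e he
  rw [← hfx, evl_apply, evl_apply, h1, MvPolynomial.algHom_C, MvPolynomial.algHom_C]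

lemma TIso.of_pow {m n : ℕ} (hm : 1 ≤ m) (h : p * m = n) :
    TIso π I (expandHom k p m ≫ (frobSym k p m (p * m)).incl (frobSym k p 1 n)
        fun _ ↦ by rw [← h]; exact inf_le_inf_right _ (frobIdeal_mono hm)) := by
  subst h
  exact TIso.of_powHom hm

lemma TIso.of_evSym (h n : ℕ) (hn : n = p ^ h) : TIso π I (evSym k p n) := by
  have hp := (Fact.out : p.Prime)
  induction h generalizing n with
  | zero =>
    obtain rfl : n = 1 := by simpa using hn
    exact TIso.of_evSym_succ (TIso.of_tAcyc _ (TAcyc.of_frobSym_one fun h ↦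
      (Nat.one_lt_pow h.succ_ne_zero hp.one_lt).ne) TAcyc.of_fil_zero)
  | succ h ih =>
    obtain ⟨N, rfl⟩ : ∃ N, n = N + 1 := ⟨n - 1, by have := hp.pos; have := Nat.pow_pos (n := h + 1) this; omega⟩
    have h0 := Nat.pow_pos (n := h) hp.pos
    have h1 : p * p ^ h = N + 1 := by rw [hn, pow_succ']
    have h2 : p ^ h ≤ N := by nlinarith [hp.two_le]
    have h3 : ∀ j, p ^ h < j → j ≤ N → ∀ i, j ≠ p ^ i := by
      rintro j hj hj' i rfl
      have h4 := (Nat.pow_lt_pow_iff_right hp.one_lt).1 hj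
      have h5 : p ^ i < p ^ (h + 1) := by omega
      have h6 := (Nat.pow_lt_pow_iff_right hp.one_lt).1 h5
      omega
    refine TIso.of_evSym_succ (TIso.of_comp_left (TIso.of_pow h0 h1) ?_)
    exact (powHom_evFrob (k := k) h0 h1 h2) ▸ TIso.comp (ih _ rfl) (TIso.of_filIncl h2 h3)

omit [CharP k p] [HasExt.{w} (Fun k p)] in
lemma eq_zero_of_epi {F G : Fun k p} (f : F ⟶ G) [Epi f] {V : FV p} (h : ∀ x, f.app V x = 0)
    (y : G.obj V) : y = 0 := by
  obtain ⟨x, rfl⟩ := surjective_of_epi f V y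
  exact h x

omit [HasExt.{w} (Fun k p)] in
lemma vanishes_cokernel {n D : ℕ} (h : D * p ≤ n) :
    Vanishes D (tw I (Limits.cokernel (filToAll k p n))) := by
  refine fun V hV x ↦ ?_
  revert x
  refine fun x : I →₀ (Limits.cokernel (filToAll k p n)).obj V ↦ Finsupp.ext fun i ↦ ?_
  refine eq_zero_of_epi (Limits.cokernel.π (filToAll k p n)) (fun y ↦ ?_) _
  have hy := filN_eq_top (k := k) ((Nat.mul_le_mul_right p hV).trans h) y
  exact congrArg (fun F : fil k p n ⟶ _ ↦ F.app V (⟨y, hy⟩ : filN k p n V))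
    (Limits.cokernel.condition (filToAll k p n))

/-- Copies of the functor of functions, as functions with values in copies of `k`. -/
noncomputable abbrev allTw (k : Type u) [Field k] (p : ℕ) [Fact p.Prime] (I : Type u) :
    tw I (allFun k p) ⟶ coind (line p) (ModuleCat.of k (I →₀ k)) :=
  coindLift (Finsupp.mapRange.linearMap
    (LinearMap.proj (φ := fun _ : line p ⟶ line p ↦ k) (𝟙 (line p))))

omit [CharP k p] [HasExt.{w} (Fun k p)] in
lemma allTw_apply {V : FV p} (x : I →₀ ((V ⟶ line p) → k)) (h : V ⟶ line p) (i : I) :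
    (((allTw k p I).app V x : (V ⟶ line p) → (I →₀ k)) h) i = x i h :=
  congrArg (x i) (Category.comp_id h)

instance isIso_allTw : IsIso (allTw k p I) := by
  classical
  refine isIso_of_bijective _ fun V ↦ ⟨?_, ?_⟩
  · refine fun (x y : I →₀ ((V ⟶ line p) → k)) hxy ↦ ?_
    refine Finsupp.ext fun i ↦ funext fun h ↦ ?_
    rw [← allTw_apply, ← allTw_apply, hxy]
  · refine fun y : (V ⟶ line p) → (I →₀ k) ↦ ?_
    have := Fintype.ofFinite (V ⟶ line p)
    refine ⟨(Finsupp.onFinset (Finset.univ.biUnion fun h ↦ (y h).support)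
      (fun i h ↦ y h i) fun i hi ↦ ?_ : I →₀ ((V ⟶ line p) → k)), ?_⟩
    · obtain ⟨h, hh⟩ := Function.ne_iff.1 hi
      exact Finset.mem_biUnion.2 ⟨h, Finset.mem_univ _, Finsupp.mem_support_iff.2 hh⟩
    · exact funext fun h ↦ Finsupp.ext fun i ↦ allTw_apply _ h i

omit [CharP k p] [π.Additive] in
lemma ext_allFun_zero : Nonempty (Ext π (tw I (allFun k p)) 0 ≃ₗ[k]
    (π.obj (line p) →ₗ[k] (I →₀ k))) :=
  ⟨(ExtIso.equiv k (ExtIso.of_isIso (allTw k p I)) 0).trans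
    ((extZeroEquiv k π _).symm.trans (coindEquiv π (line p) (ModuleCat.of k (I →₀ k))))⟩

omit [CharP k p] [π.Additive] in
lemma ext_allFun_succ (s : ℕ) : Subsingleton (Ext π (tw I (allFun k p)) (s + 1)) := by
  have h1 : Subsingleton (Ext π (coind (line p) (ModuleCat.of k (I →₀ k))) (s + 1)) :=
    subsingleton_of_forall_eq 0 fun x ↦ Ext.eq_zero_of_injective x
  exact (ExtIso.equiv k (X := π) (ExtIso.of_isIso (allTw k p I)) (s + 1)).toEquiv.subsingleton

/-- The Ext groups with values in a symmetric power of large `p`-power degree, in low degree. -/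
lemma exists_ext_sym (π : Fun k p) [π.Additive] (I : Type u) (R : ℕ) : ∃ h, R < 2 * p ^ h ∧
    Nonempty (Ext π (tw I (sym k p (p ^ h)).fn) 0 ≃ₗ[k] (π.obj (line p) →ₗ[k] (I →₀ k))) ∧
    ∀ s, s ≠ 0 → s ≤ R → Subsingleton (Ext π (tw I (sym k p (p ^ h)).fn) s) := by
  have hp := (Fact.out : p.Prime)
  obtain ⟨D, hD⟩ := FP.of_additive π R
  let h := R + D * p
  have h1 : R + D * p < p ^ h := Nat.lt_pow_self hp.one_lt
  have h2 : ∀ s ≤ R, Nonempty (Ext π (tw I (sym k p (p ^ h)).fn) s ≃ₗ[k]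
      Ext π (tw I (allFun k p)) s) := fun s hs ↦ by
    have h3 := ext_f_bijective_of_right k
      (shortExact_tw I (shortExact_cokernel (filToAll k p (p ^ h))))
      (hD _ (vanishes_cokernel (by omega)) s hs)
      fun m hm ↦ hD _ (vanishes_cokernel (by omega)) m (by omega)
    exact ⟨(ExtIso.equiv k (TIso.of_evSym (π := π) (I := I) h _ rfl) s).trans
      (LinearEquiv.ofBijective _ h3)⟩
  refine ⟨h, by omega, ?_, fun s hs hsR ↦ ?_⟩
  · obtain ⟨e⟩ := h2 0 (Nat.zero_le _)
    obtain ⟨e'⟩ := ext_allFun_zero (π := π) (I := I)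
    exact ⟨e.trans e'⟩
  · obtain ⟨e⟩ := h2 s hsR
    obtain ⟨t, rfl⟩ := Nat.exists_eq_succ_of_ne_zero hs
    have := ext_allFun_succ (π := π) (I := I) t
    exact e.toEquiv.subsingleton

end FrobeniusPowers

section Derivations

open MvPolynomial LinearMap

lemma choose_prime_sub_one {R : Type*} [CommRing R] {p : ℕ} [Fact p.Prime] [CharP R p] {i : ℕ}
    (hi : i < p) : ((p - 1).choose i : R) = (-1) ^ i := by
  have hp := (Fact.out : p.Prime)
  induction i with
  | zero => simp
  | succ i ih =>
    have h1 : p.choose (i + 1) = (p - 1).choose i + (p - 1).choose (i + 1) := by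
      conv_lhs => rw [← Nat.sub_add_cancel hp.one_le]
      exact Nat.choose_succ_succ _ _
    have h2 : ((p.choose (i + 1) : ℕ) : R) = 0 :=
      (CharP.cast_eq_zero_iff R p _).2 (hp.dvd_choose_self i.succ_ne_zero hi)
    rw [h1, Nat.cast_add, ih (by omega)] at h2
    rw [pow_succ, eq_neg_of_add_eq_zero_right h2]
    ring

variable {k : Type*} [Field k] {p : ℕ} [Fact p.Prime] [CharP k p]

lemma Commute.sub_pow_prime_sub_one (k : Type*) [Field k] [CharP k p] {S : Type*} [Ring S]
    [Algebra k S] {x y : S} (h : Commute x y) :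
    (x - y) ^ (p - 1) = ∑ i ∈ Finset.range p, x ^ i * y ^ (p - 1 - i) := by
  have hp := (Fact.out : p.Prime)
  rw [sub_eq_add_neg, Commute.add_pow h.neg_right, Nat.sub_add_cancel hp.one_le]
  refine Finset.sum_congr rfl fun i hi ↦ ?_
  have hi' := Finset.mem_range.1 hi
  have h1 : ((p - 1).choose i : S) = algebraMap k S ((-1) ^ i) := by
    rw [← choose_prime_sub_one hi', map_natCast]
  have h2 : (-1 : S) ^ (p - 1 - i) = algebraMap k S ((-1) ^ (p - 1 - i)) := by simp
  have h3 : ((-1 : k) ^ (p - 1 - i)) * (-1) ^ i = 1 := by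
    rw [← pow_add, Nat.sub_add_cancel (by omega), ← mul_right_inj' (neg_ne_zero.2 one_ne_zero),
      ← pow_succ', Nat.sub_add_cancel hp.one_le, neg_one_pow_char, mul_one]
  rw [neg_pow, h1, h2, (Algebra.commutes _ (y ^ (p - 1 - i))), mul_assoc, mul_assoc, ← map_mul, h3,
    map_one, mul_one]

/-- The sum of the `d ^ i * h * d ^ j` with `i + j + 1 = p` is an iterated commutator. -/
lemma sum_pow_mul_pow {E : Type*} [Ring E] [Algebra k E] (d h : E) :
    ∑ i ∈ Finset.range p, d ^ i * h * d ^ (p - 1 - i) =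
      ((mulLeft k d - mulRight k d) ^ (p - 1)) h := by
  rw [Commute.sub_pow_prime_sub_one k (commute_mulLeft_right d d), LinearMap.sum_apply]
  refine Finset.sum_congr rfl fun i _ ↦ ?_
  rw [pow_mulLeft, pow_mulRight, Module.End.mul_apply, mulLeft_apply, mulRight_apply, mul_assoc]

lemma pow_mul_sub_mul_pow {E : Type*} [Ring E] [Algebra k E] (d h : E) :
    d ^ p * h - h * d ^ p = ((mulLeft k d - mulRight k d) ^ p) h := by
  rcases subsingleton_or_nontrivial E with hE | hE
  · exact Subsingleton.elim _ _
  have : CharP (Module.End k E) p := charP_of_injective_algebraMap' k p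
  rw [sub_pow_char_of_commute p (commute_mulLeft_right d d), pow_mulLeft, pow_mulRight]
  rfl

variable {A : Type*} [CommRing A] [Algebra k A]

/-- Iterated commutators of derivations are derivations. -/
lemma exists_derivation_commutator (d h : Derivation k A A) (n : ℕ) : ∃ D : Derivation k A A,
    ((mulLeft k (d : Module.End k A) - mulRight k (d : Module.End k A)) ^ n)
      (h : Module.End k A) = D := by
  induction n with
  | zero => exact ⟨h, rfl⟩
  | succ n ih =>
    obtain ⟨D, hD⟩ := ih
    refine ⟨⁅d, D⁆, ?_⟩
    rw [pow_succ', Module.End.mul_apply, hD]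
    exact (Derivation.commutator_coe_linear_map).symm

lemma commutator_mul (d : Derivation k A A) (f : A) (n : ℕ) :
    ((mulLeft k (d : Module.End k A) - mulRight k (d : Module.End k A)) ^ n) (mulLeft k f) =
      mulLeft k (((d : Module.End k A) ^ n) f) := by
  induction n with
  | zero => rfl
  | succ n ih =>
    rw [pow_succ', Module.End.mul_apply, ih, pow_succ', Module.End.mul_apply]
    ext g
    change d (_ * g) - _ * d g = d _ * g
    rw [Derivation.leibniz]
    simp only [smul_eq_mul]
    ring

/-- The `p`-th power of a derivation satisfies the Leibniz rule. -/
lemma derivation_pow_leibniz (d : Derivation k A A) (f g : A) :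
    ((d : Module.End k A) ^ p) (f * g) =
      ((d : Module.End k A) ^ p) f * g + f * ((d : Module.End k A) ^ p) g := by
  have h1 := congrArg (fun F : Module.End k A ↦ F g)
    (pow_mul_sub_mul_pow (k := k) (p := p) (d : Module.End k A) (mulLeft k f))
  rw [commutator_mul] at h1
  exact sub_eq_iff_eq_add.1 h1

end Derivations

section ShiftComplex

open MvPolynomial

variable {k : Type*} [Field k]

section General

variable {α : Type*} {M : Type*} [AddCommMonoid M]

lemma derivation_homogeneous {w : α → M} {c : M} (D : Derivation k (MvPolynomial α k)
    (MvPolynomial α k)) (hD : ∀ x, IsWeightedHomogeneous w (D (X x)) (w x + c))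
    {f : MvPolynomial α k} {m : M} (hf : IsWeightedHomogeneous w f m) :
    IsWeightedHomogeneous w (D f) (m + c) := by
  classical
  rw [f.as_sum, map_sum]
  refine IsWeightedHomogeneous.sum _ _ _ fun e he ↦ ?_
  have h1 : D = mkDerivation k fun x ↦ D (X x) :=
    derivation_ext fun x ↦ (mkDerivation_X k (fun x ↦ D (X x)) x).symm
  rw [h1, mkDerivation_monomial, smul_eq_C_mul]
  refine IsWeightedHomogeneous.C_mul (IsWeightedHomogeneous.sum _ _ _ fun x hx ↦ ?_) _
  have h2 : e - Finsupp.single x 1 + Finsupp.single x 1 = e := tsub_add_cancel_of_le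
    (Finsupp.single_le_iff.2 (Nat.one_le_iff_ne_zero.2 (Finsupp.mem_support_iff.1 hx)))
  rw [← hf (mem_support_iff.1 he), ← h2, map_add, Finsupp.weight_single, one_smul, h2, add_assoc]
  exact (isWeightedHomogeneous_monomial w _ _ rfl).mul (hD x)

/-- The ideal generated by a set of variables. -/
noncomputable abbrev varIdeal (k : Type*) [Field k] {α : Type*} (T : Set α) :
    Ideal (MvPolynomial α k) := Ideal.span (X '' T)

lemma derivation_varIdeal {T : Set α} (D : Derivation k (MvPolynomial α k) (MvPolynomial α k))
    (hD : ∀ x ∈ T, D (X x) ∈ varIdeal k T) {f : MvPolynomial α k} (hf : f ∈ varIdeal k T) :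
    D f ∈ varIdeal k T := by
  induction hf using Submodule.span_induction with
  | mem f hf => obtain ⟨x, hx, rfl⟩ := hf; exact hD x hx
  | zero => rw [map_zero]; exact zero_mem _
  | add f g _ _ hf hg => rw [map_add]; exact add_mem hf hg
  | smul a f hf h =>
    rw [smul_eq_mul, Derivation.leibniz]
    exact add_mem (Ideal.mul_mem_left _ _ h) (Ideal.mul_mem_right _ _ hf)

lemma mem_of_X_mul_mem {T : Set α} {x : α} (hx : x ∉ T) {f : MvPolynomial α k}
    (hf : X x * f ∈ varIdeal k T) : f ∈ varIdeal k T := by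
  classical
  rw [mem_ideal_span_X_image] at hf ⊢
  intro e he
  obtain ⟨i, hi, h⟩ := hf (Finsupp.single x 1 + e) (by
    rw [support_X_mul]; exact Finset.mem_map.2 ⟨e, he, rfl⟩)
  refine ⟨i, hi, fun h0 ↦ h ?_⟩
  have : x ≠ i := fun h ↦ hx (h ▸ hi)
  simp [this, h0]

lemma exists_X_mul_add {w : α → M} [IsCancelAdd M] {T : Set α} {x : α} {m n : M} (hn : n + w x = m)
    {f : MvPolynomial α k} (hf : IsWeightedHomogeneous w f m) (h : f ∈ varIdeal k (insert x T)) :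
    ∃ g, IsWeightedHomogeneous w g n ∧ f - X x * g ∈ varIdeal k T := by
  classical
  refine ⟨f.divMonomial (Finsupp.single x 1), fun e he ↦ ?_, ?_⟩
  · rw [coeff_divMonomial] at he
    have := hf he
    rw [map_add, Finsupp.weight_single, one_smul, ← hn, add_comm n] at this
    exact add_left_cancel this
  · rw [sub_eq_iff_eq_add'.2 (divMonomial_add_modMonomial_single f x).symm,
      mem_ideal_span_X_image]
    rw [mem_ideal_span_X_image] at h
    intro e he
    have h1 : ¬ Finsupp.single x 1 ≤ e := fun h2 ↦
      mem_support_iff.1 he (coeff_modMonomial_of_le _ h2)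
    have h3 : e ∈ f.support := by
      rw [mem_support_iff, coeff_modMonomial_of_not_le _ h1] at he
      exact mem_support_iff.2 he
    obtain ⟨i, hi, h4⟩ := h e h3
    rcases hi with rfl | hi
    · exact absurd (Finsupp.single_le_iff.2 (Nat.one_le_iff_ne_zero.2 h4)) h1
    · exact ⟨i, hi, h4⟩

end General

end ShiftComplex

section ShiftComplex

open MvPolynomial

variable {k : Type*} [Field k] {p : ℕ} {ι : Type*}

/-- The derivation shifting the variables of each block. -/
noncomputable def shiftD (k : Type*) [Field k] (p : ℕ) (ι : Type*) :
    Derivation k (MvPolynomial (Fin p × ι) k) (MvPolynomial (Fin p × ι) k) :=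
  mkDerivation k fun x ↦ if h : x.1.1 + 1 < p then X (⟨x.1.1 + 1, h⟩, x.2) else 0

lemma shiftD_X (x : Fin p × ι) : shiftD k p ι (X x) =
    if h : x.1.1 + 1 < p then X (⟨x.1.1 + 1, h⟩, x.2) else 0 := mkDerivation_X _ _ _

lemma shiftD_pow_X (x : Fin p × ι) (n : ℕ) :
    ((shiftD k p ι : Module.End k (MvPolynomial (Fin p × ι) k)) ^ n) (X x) =
      if h : x.1.1 + n < p then X (⟨x.1.1 + n, h⟩, x.2) else 0 := by
  induction n with
  | zero => rw [dif_pos (by omega)]; rfl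
  | succ n ih =>
    rw [pow_succ', Module.End.mul_apply, ih]
    by_cases h : x.1.1 + n < p
    · rw [dif_pos h]
      exact shiftD_X _
    · rw [dif_neg h, map_zero, dif_neg (by omega)]

/-- The ideal generated by the variables of index at least `s a` in the block `a`. -/
noncomputable abbrev tailIdeal (k : Type*) [Field k] {p : ℕ} (s : ι → ℕ) :
    Ideal (MvPolynomial (Fin p × ι) k) := varIdeal k {x | s x.2 ≤ x.1.1}

lemma X_mem_tailIdeal {s : ι → ℕ} {x : Fin p × ι} (h : s x.2 ≤ x.1.1) :
    (X x : MvPolynomial (Fin p × ι) k) ∈ tailIdeal k s := Ideal.subset_span ⟨x, h, rfl⟩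

variable [DecidableEq ι]

/-- The multidegree, modulo `p`. -/
def mdeg (p : ℕ) (x : Fin p × ι) : ι → ZMod p := Pi.single x.2 1

lemma tail_insert (s : ι → ℕ) (a : ι) (h : s a < p) :
    {x : Fin p × ι | s x.2 ≤ x.1.1} =
      insert (⟨s a, h⟩, a) {x | Function.update s a (s a + 1) x.2 ≤ x.1.1} := by
  ext ⟨i, b⟩
  simp only [Set.mem_ofPred_eq, Set.mem_insert_iff, Prod.mk.injEq, Fin.ext_iff]
  by_cases hb : b = a
  · subst hb
    rw [Function.update_self]
    simp only [and_true]
    omega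
  · rw [Function.update_of_ne hb]
    simp [hb]

lemma notMem_tail (s : ι → ℕ) (a : ι) (h : s a < p) :
    ((⟨s a, h⟩, a) : Fin p × ι) ∉
      {x : Fin p × ι | Function.update s a (s a + 1) x.2 ≤ x.1.1} := by
  simp

lemma tailIdeal_update_le (s : ι → ℕ) (a : ι) :
    tailIdeal k (p := p) (Function.update s a (s a + 1)) ≤ tailIdeal k s := by
  refine Ideal.span_mono (Set.image_mono fun x hx ↦ ?_)
  have hy : Function.update s a (s a + 1) x.2 ≤ x.1.1 := hx
  change s x.2 ≤ x.1.1
  by_cases h : x.2 = a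
  · rw [h, Function.update_self] at hy
    rw [h]
    omega
  · rwa [Function.update_of_ne h] at hy

/-- Operators which are multiplicative up to higher order terms. -/
structure Adm (A : Module.End k (MvPolynomial (Fin p × ι) k)) : Prop where
  stable : ∀ s : ι → ℕ, ∀ f ∈ tailIdeal k s, A f ∈ tailIdeal k s
  comm : ∀ (s : ι → ℕ) (a : ι) (h : s a < p) (f : MvPolynomial (Fin p × ι) k),
    A (X (⟨s a, h⟩, a) * f) - X (⟨s a, h⟩, a) * A f ∈
      tailIdeal k (Function.update s a (s a + 1))
  deg : ∀ f m, IsWeightedHomogeneous (mdeg p) f m → IsWeightedHomogeneous (mdeg p) (A f) m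

lemma adm_one : Adm (1 : Module.End k (MvPolynomial (Fin p × ι) k)) where
  stable _ _ h := h
  comm s a h f := by
    rw [Module.End.one_apply, Module.End.one_apply, sub_self]
    exact zero_mem _
  deg _ _ h := h

lemma Adm.mul {A B : Module.End k (MvPolynomial (Fin p × ι) k)} (hA : Adm A) (hB : Adm B) :
    Adm (A * B) where
  stable s f hf := hA.stable s _ (hB.stable s f hf)
  comm s a h f := by
    have h1 := add_mem (hA.stable _ _ (hB.comm s a h f)) (hA.comm s a h (B f))
    rwa [map_sub, sub_add_sub_cancel] at h1
  deg f m hf := hA.deg _ _ (hB.deg _ _ hf)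

lemma Adm.pow {A : Module.End k (MvPolynomial (Fin p × ι) k)} (hA : Adm A) (n : ℕ) :
    Adm (A ^ n) := by
  induction n with
  | zero => exact adm_one
  | succ n ih => rw [pow_succ]; exact ih.mul hA

lemma adm_shiftD : Adm (shiftD k p ι : Module.End k (MvPolynomial (Fin p × ι) k)) where
  stable s f hf := by
    refine derivation_varIdeal (shiftD k p ι) (fun x hx ↦ ?_) hf
    have hx' : s x.2 ≤ x.1.1 := hx
    rw [shiftD_X]
    split_ifs
    · exact X_mem_tailIdeal (show s x.2 ≤ x.1.1 + 1 by omega)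
    · exact zero_mem _
  comm s a h f := by
    change shiftD k p ι _ - _ * shiftD k p ι f ∈ _
    rw [Derivation.leibniz, smul_eq_mul, smul_eq_mul, add_sub_cancel_left, shiftD_X]
    refine Ideal.mul_mem_left _ _ ?_
    split_ifs
    · exact X_mem_tailIdeal (by simp)
    · exact zero_mem _
  deg f m hf := by
    have h1 := derivation_homogeneous (c := 0) (w := mdeg p) (shiftD k p ι) (fun x ↦ ?_) hf
    · rwa [add_zero] at h1
    rw [shiftD_X, add_zero]
    split_ifs with h
    · exact isWeightedHomogeneous_X k (mdeg p) (⟨x.1.1 + 1, h⟩, x.2)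
    · exact isWeightedHomogeneous_zero _ _ _

/-- Exactness modulo a tail ideal in a given multidegree. -/
def Ex (A B : Module.End k (MvPolynomial (Fin p × ι) k)) (s : ι → ℕ) (n : ι → ZMod p) : Prop :=
  ∀ f, IsWeightedHomogeneous (mdeg p) f n → A f ∈ tailIdeal k s →
    ∃ g, IsWeightedHomogeneous (mdeg p) g n ∧ f - B g ∈ tailIdeal k s

variable {A B : Module.End k (MvPolynomial (Fin p × ι) k)}

lemma Adm.mem_of_X_mul (hA : Adm A) {s : ι → ℕ} {a : ι} (h : s a < p)
    {f : MvPolynomial (Fin p × ι) k}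
    (hf : A (X (⟨s a, h⟩, a) * f) ∈ tailIdeal k (Function.update s a (s a + 1))) :
    A f ∈ tailIdeal k (Function.update s a (s a + 1)) := by
  refine mem_of_X_mul_mem (notMem_tail s a h) ?_
  have h1 := sub_mem hf (hA.comm s a h f)
  rwa [sub_sub_cancel] at h1

lemma isWeightedHomogeneous_sub {α M R : Type*} [AddCommMonoid M] [CommRing R] {w : α → M}
    {f g : MvPolynomial α R} {m : M} (hf : IsWeightedHomogeneous w f m)
    (hg : IsWeightedHomogeneous w g m) : IsWeightedHomogeneous w (f - g) m :=
  Submodule.sub_mem (weightedHomogeneousSubmodule R w m) hf hg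

lemma exists_X_mul_sub {s : ι → ℕ} {a : ι} (h : s a < p) {f : MvPolynomial (Fin p × ι) k}
    {n : ι → ZMod p} (hf : IsWeightedHomogeneous (mdeg p) f n) (hs : f ∈ tailIdeal k s) :
    ∃ g, IsWeightedHomogeneous (mdeg p) g (n - Pi.single a 1) ∧
      f - X (⟨s a, h⟩, a) * g ∈ tailIdeal k (Function.update s a (s a + 1)) := by
  have h0 : n - Pi.single a 1 + mdeg p (⟨s a, h⟩, a) = n := sub_add_cancel n (Pi.single a 1)
  have h1 : f ∈ varIdeal k (insert (⟨s a, h⟩, a)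
      {x : Fin p × ι | Function.update s a (s a + 1) x.2 ≤ x.1.1}) := by
    rw [← tail_insert]
    exact hs
  exact exists_X_mul_add h0 hf h1

lemma X_mul_homogeneous {a : ι} (i : Fin p) {f : MvPolynomial (Fin p × ι) k}
    {n : ι → ZMod p} (hf : IsWeightedHomogeneous (mdeg p) f (n - Pi.single a 1)) :
    IsWeightedHomogeneous (mdeg p) (X (i, a) * f) n := by
  have h1 := (isWeightedHomogeneous_X k (mdeg p) (i, a)).mul hf
  rwa [show mdeg p (i, a) = Pi.single a 1 from rfl, add_sub_cancel] at h1

lemma Ex.descend (hA : Adm A) (hB : Adm B) (hBA : B * A = 0) {s : ι → ℕ}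
    {n : ι → ZMod p} {a : ι} (h : s a < p) (h1 : Ex A B (Function.update s a (s a + 1)) n)
    (h2 : Ex B A (Function.update s a (s a + 1)) (n - Pi.single a 1)) : Ex A B s n := by
  intro f hf hf'
  obtain ⟨g, hg, hg'⟩ := exists_X_mul_sub h (hA.deg f n hf) hf'
  have h3 : B g ∈ tailIdeal k (Function.update s a (s a + 1)) := by
    refine hB.mem_of_X_mul h ?_
    have h4 := hB.stable _ _ hg'
    rw [map_sub, ← Module.End.mul_apply, hBA, LinearMap.zero_apply, zero_sub] at h4
    exact neg_mem_iff.1 h4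
  obtain ⟨g', h5, h6⟩ := h2 g hg h3
  obtain ⟨g'', h7, h8⟩ := h1 (f - X (⟨s a, h⟩, a) * g')
    (isWeightedHomogeneous_sub hf (X_mul_homogeneous _ h5)) (by
      have h7 := sub_mem (add_mem hg' (Ideal.mul_mem_left _ (X (⟨s a, h⟩, a)) h6))
        (hA.comm s a h g')
      rw [map_sub]
      convert h7 using 1
      ring)
  refine ⟨g'', h7, ?_⟩
  have h9 := add_mem (tailIdeal_update_le s a h8)
    (Ideal.mul_mem_right g' _ (X_mem_tailIdeal (k := k) (s := s) (x := (⟨s a, h⟩, a)) le_rfl))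
  convert h9 using 1
  ring

end ShiftComplex

section ShiftComplex

open MvPolynomial

lemma derivation_eq_smul {k α M : Type*} [Field k] [AddCommMonoid M] {w : α → M}
    (D : Derivation k (MvPolynomial α k) (MvPolynomial α k)) (φ : M →+ k)
    (hD : ∀ x, D (X x) = φ (w x) • X x) {f : MvPolynomial α k} {m : M}
    (hf : IsWeightedHomogeneous w f m) : D f = φ m • f := by
  classical
  conv_lhs => rw [f.as_sum]
  conv_rhs => rw [f.as_sum]
  rw [map_sum, Finset.smul_sum]
  refine Finset.sum_congr rfl fun e he ↦ ?_
  have h1 : D = mkDerivation k fun x ↦ φ (w x) • (X x : MvPolynomial α k) :=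
    derivation_ext fun x ↦ (hD x).trans (mkDerivation_X k (fun x ↦ φ (w x) • X x) x).symm
  rw [h1, mkDerivation_monomial, ← hf (mem_support_iff.1 he), Finsupp.weight_apply, Finsupp.sum,
    Finsupp.sum, map_sum, Finset.sum_smul, Finset.smul_sum]
  refine Finset.sum_congr rfl fun x hx ↦ ?_
  have h2 : Finsupp.single x 1 + (e - Finsupp.single x 1) = e := add_tsub_cancel_of_le
    (Finsupp.single_le_iff.2 (Nat.one_le_iff_ne_zero.2 (Finsupp.mem_support_iff.1 hx)))
  rw [smul_eq_mul, mul_smul_comm, mul_comm, X, monomial_mul, h2, smul_monomial, smul_monomial,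
    smul_monomial, map_nsmul]
  simp only [smul_eq_mul, nsmul_eq_mul]
  congr 1
  ring

variable {k : Type*} [Field k] {p : ℕ} [Fact p.Prime] {ι : Type*} [DecidableEq ι]

/-- The contracting homotopy attached to a block. -/
noncomputable def homotopyD (k : Type*) [Field k] (p : ℕ) [Fact p.Prime] {ι : Type*}
    [DecidableEq ι] (a : ι) :
    Derivation k (MvPolynomial (Fin p × ι) k) (MvPolynomial (Fin p × ι) k) :=
  mkDerivation k fun x ↦ if x.1.1 + 1 = p ∧ x.2 = a then X (0, a) else 0

lemma homotopyD_X (a : ι) (x : Fin p × ι) : homotopyD k p a (X x) =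
    if x.1.1 + 1 = p ∧ x.2 = a then X (0, a) else 0 := mkDerivation_X _ _ _

lemma homotopyD_stable {a : ι} {s : ι → ℕ} (hs : s a = p) {f : MvPolynomial (Fin p × ι) k}
    (hf : f ∈ tailIdeal k s) : homotopyD k p a f ∈ tailIdeal k s := by
  refine derivation_varIdeal (homotopyD k p a) (fun x hx ↦ ?_) hf
  have hx' : s x.2 ≤ x.1.1 := hx
  rw [homotopyD_X, if_neg]
  · exact zero_mem _
  · rintro ⟨_, rfl⟩
    have := x.1.2
    omega

lemma homotopyD_deg (a : ι) {f : MvPolynomial (Fin p × ι) k} {n : ι → ZMod p}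
    (hf : IsWeightedHomogeneous (mdeg p) f n) :
    IsWeightedHomogeneous (mdeg p) (homotopyD k p a f) n := by
  have h1 := derivation_homogeneous (c := 0) (w := mdeg p) (homotopyD k p a) (fun x ↦ ?_) hf
  · rwa [add_zero] at h1
  rw [homotopyD_X, add_zero]
  split_ifs with h
  · obtain ⟨_, rfl⟩ := h
    exact isWeightedHomogeneous_X k (mdeg p) ((0 : Fin p), x.2)
  · exact isWeightedHomogeneous_zero _ _ _

variable [CharP k p]

lemma sum_homotopy (a : ι) {f : MvPolynomial (Fin p × ι) k} {n : ι → ZMod p}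
    (hf : IsWeightedHomogeneous (mdeg p) f n) :
    ∑ i ∈ Finset.range p, ((shiftD k p ι : Module.End k (MvPolynomial (Fin p × ι) k)) ^ i)
      (homotopyD k p a (((shiftD k p ι : Module.End k (MvPolynomial (Fin p × ι) k)) ^ (p - 1 - i))
        f)) = ZMod.castHom (dvd_refl p) k (n a) • f := by
  obtain ⟨E, hE⟩ := exists_derivation_commutator (shiftD k p ι) (homotopyD k p a) (p - 1)
  rw [← sum_pow_mul_pow] at hE
  have h1 : ∀ f, ∑ i ∈ Finset.range p,
      ((shiftD k p ι : Module.End k (MvPolynomial (Fin p × ι) k)) ^ i)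
      (homotopyD k p a (((shiftD k p ι : Module.End k (MvPolynomial (Fin p × ι) k)) ^ (p - 1 - i))
        f)) = E f := fun f ↦ by
    refine Eq.trans ?_ (congrArg (fun F : Module.End k (MvPolynomial (Fin p × ι) k) ↦ F f) hE)
    change _ = (∑ i ∈ Finset.range p, _ : Module.End k (MvPolynomial (Fin p × ι) k)) f
    rw [LinearMap.sum_apply]
    rfl
  rw [h1]
  refine derivation_eq_smul (w := mdeg p) E ((ZMod.castHom (dvd_refl p) k).toAddMonoidHom.comp
    (Pi.evalAddMonoidHom (fun _ : ι ↦ ZMod p) a)) (fun x ↦ ?_) hf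
  rw [← h1, Finset.sum_eq_single x.1.1]
  · have hx := x.1.2
    rw [shiftD_pow_X, dif_pos (by omega), homotopyD_X]
    change _ = ZMod.castHom (dvd_refl p) k ((Pi.single x.2 1 : ι → ZMod p) a) • _
    by_cases h : x.2 = a
    · rw [if_pos ⟨by change x.1.1 + (p - 1 - x.1.1) + 1 = p; omega, h⟩, h, Pi.single_eq_same,
        map_one, one_smul, shiftD_pow_X, dif_pos (by simp)]
      congr 1
      ext
      · simp
      · exact h.symm
    · rw [if_neg fun h' ↦ h h'.2, Pi.single_eq_of_ne (Ne.symm h), map_zero, map_zero, zero_smul]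
  · intro i hi hne
    have hi' := Finset.mem_range.1 hi
    have hx := x.1.2
    rw [shiftD_pow_X]
    by_cases h : x.1.1 + (p - 1 - i) < p
    · rw [dif_pos h, homotopyD_X, if_neg, map_zero]
      rintro ⟨h2, _⟩
      have h3 : x.1.1 + (p - 1 - i) + 1 = p := h2
      omega
    · rw [dif_neg h, map_zero, map_zero]
  · intro h
    exact absurd (Finset.mem_range.2 x.1.2) h

omit [DecidableEq ι] in
lemma shiftD_pow_prime :
    (shiftD k p ι : Module.End k (MvPolynomial (Fin p × ι) k)) ^ p = 0 := by
  refine LinearMap.ext fun f ↦ ?_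
  induction f using MvPolynomial.induction_on with
  | C c =>
    have h1 := (Fact.out : p.Prime).ne_zero
    obtain ⟨q, rfl⟩ := Nat.exists_eq_succ_of_ne_zero h1
    rw [pow_succ, Module.End.mul_apply]
    change ((_ : Module.End k _) ^ q) (shiftD k _ ι (C c)) = _
    rw [derivation_C, map_zero]
    rfl
  | add f g hf hg => rw [map_add, hf, hg]; simp
  | mul_X f x hf =>
    rw [derivation_pow_leibniz, hf, shiftD_pow_X, dif_neg (by omega)]
    simp

/-- The two operators occurring in the periodic complex. -/
def IsShiftPair (A B : Module.End k (MvPolynomial (Fin p × ι) k)) : Prop :=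
  (A = shiftD k p ι ∧ B = (shiftD k p ι : Module.End k _) ^ (p - 1)) ∨
    (A = (shiftD k p ι : Module.End k _) ^ (p - 1) ∧ B = shiftD k p ι)

variable {A B : Module.End k (MvPolynomial (Fin p × ι) k)}

omit [Fact p.Prime] [DecidableEq ι] [CharP k p] in
lemma IsShiftPair.symm (h : IsShiftPair A B) : IsShiftPair B A :=
  Or.symm (h.imp And.symm And.symm)

omit [Fact p.Prime] [CharP k p] in
lemma IsShiftPair.adm (h : IsShiftPair A B) : Adm A := by
  obtain ⟨rfl, rfl⟩ | ⟨rfl, rfl⟩ := h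
  · exact adm_shiftD
  · exact adm_shiftD.pow _

omit [DecidableEq ι] in
lemma IsShiftPair.mul_eq_zero (h : IsShiftPair A B) : A * B = 0 := by
  have h1 := (Fact.out : p.Prime).one_le
  obtain ⟨rfl, rfl⟩ | ⟨rfl, rfl⟩ := h
  · rw [← pow_succ', Nat.sub_add_cancel h1, shiftD_pow_prime]
  · rw [← pow_succ, Nat.sub_add_cancel h1, shiftD_pow_prime]

omit [Fact p.Prime] [DecidableEq ι] [CharP k p] in
lemma tailIdeal_smul_mem {s : ι → ℕ} (c : k) {f : MvPolynomial (Fin p × ι) k}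
    (hf : f ∈ tailIdeal k s) : c • f ∈ tailIdeal k s := by
  rw [smul_eq_C_mul]
  exact Ideal.mul_mem_left _ _ hf

lemma IsShiftPair.ex_of_eq (h : IsShiftPair A B) {s : ι → ℕ} {n : ι → ZMod p} {a : ι}
    (hs : s a = p) (hn : n a ≠ 0) : Ex A B s n := by
  intro f hf hf'
  have hp := (Fact.out : p.Prime).one_le
  set c := ZMod.castHom (dvd_refl p) k (n a) with hc
  have hc0 : c ≠ 0 := fun h0 ↦ hn ((map_eq_zero _).1 h0)
  suffices ∃ g, IsWeightedHomogeneous (mdeg p) g n ∧ c • f - B g ∈ tailIdeal k s by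
    obtain ⟨g, hg, hg'⟩ := this
    refine ⟨c⁻¹ • g, Submodule.smul_mem (weightedHomogeneousSubmodule k (mdeg p) n) _ hg, ?_⟩
    have h1 := tailIdeal_smul_mem c⁻¹ hg'
    rwa [smul_sub, smul_smul, inv_mul_cancel₀ hc0, one_smul, ← map_smul] at h1
  rw [hc, ← sum_homotopy a hf]
  obtain ⟨q, hq⟩ : ∃ q, p = q + 1 := ⟨p - 1, by omega⟩
  obtain ⟨rfl, rfl⟩ | ⟨rfl, rfl⟩ := h
  · refine ⟨homotopyD k p a f, homotopyD_deg a hf, ?_⟩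
    rw [show Finset.range p = Finset.range (p - 1 + 1) by rw [Nat.sub_add_cancel hp],
      Finset.sum_range_succ, Nat.sub_self, pow_zero, Module.End.one_apply, add_sub_cancel_right]
    refine Submodule.sum_mem _ fun i hi ↦ ?_
    have hi' := Finset.mem_range.1 hi
    refine (adm_shiftD.pow i).stable s _ (homotopyD_stable hs ?_)
    rw [show p - 1 - i = p - 1 - i - 1 + 1 by omega, pow_succ]
    exact (adm_shiftD.pow _).stable s _ hf'
  · refine ⟨∑ i ∈ Finset.range (p - 1),
      ((shiftD k p ι : Module.End k (MvPolynomial (Fin p × ι) k)) ^ i) (homotopyD k p a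
        (((shiftD k p ι : Module.End k (MvPolynomial (Fin p × ι) k)) ^ (p - 1 - (i + 1))) f)),
      IsWeightedHomogeneous.sum _ _ _ fun i _ ↦ (adm_shiftD.pow i).deg _ _
        (homotopyD_deg a ((adm_shiftD.pow _).deg _ _ hf)), ?_⟩
    rw [show Finset.range p = Finset.range (p - 1 + 1) by rw [Nat.sub_add_cancel hp],
      Finset.sum_range_succ', map_sum]
    have h1 : ∀ i ∈ Finset.range (p - 1),
      ((shiftD k p ι : Module.End k (MvPolynomial (Fin p × ι) k)) ^ (i + 1)) (homotopyD k p a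
        (((shiftD k p ι : Module.End k (MvPolynomial (Fin p × ι) k)) ^ (p - 1 - (i + 1))) f)) =
      (shiftD k p ι : Module.End k (MvPolynomial (Fin p × ι) k))
        (((shiftD k p ι : Module.End k (MvPolynomial (Fin p × ι) k)) ^ i) (homotopyD k p a
        (((shiftD k p ι : Module.End k (MvPolynomial (Fin p × ι) k)) ^ (p - 1 - (i + 1))) f))) :=
      fun i _ ↦ by rw [pow_succ']; rfl
    rw [Finset.sum_congr rfl h1, add_sub_cancel_left]
    exact homotopyD_stable hs hf'

lemma IsShiftPair.ex_of_lt (h : IsShiftPair A B) {s : ι → ℕ} {n : ι → ZMod p} {a : ι}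
    (hs : s a ≤ p) (hn : p < (n a).val + s a) : Ex A B s n := by
  obtain ⟨t, ht⟩ : ∃ t, s a + t = p := ⟨p - s a, by omega⟩
  have hp := (Fact.out : p.Prime).one_lt
  have : Fact (1 < p) := ⟨hp⟩
  induction t generalizing s n A B with
  | zero =>
    refine h.ex_of_eq (a := a) (by omega) fun h0 ↦ ?_
    rw [h0, ZMod.val_zero] at hn
    omega
  | succ t ih =>
    have hl : s a < p := by omega
    refine Ex.descend h.adm h.symm.adm h.symm.mul_eq_zero hl (ih h ?_ ?_ ?_)
      (ih h.symm ?_ ?_ ?_)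
    all_goals rw [Function.update_self]
    any_goals omega
    rw [Pi.sub_apply, Pi.single_eq_same, ZMod.val_sub (by rw [ZMod.val_one]; omega), ZMod.val_one]
    omega

end ShiftComplex

section ShiftComplex

open MvPolynomial

variable {k : Type*} [Field k] {p : ℕ} [Fact p.Prime] {ι : Type}

/-- The inclusion of the `p`-th powers of the first variables of the blocks. -/
noncomputable def powIncl (k : Type*) [Field k] (p : ℕ) [Fact p.Prime] (ι : Type) :
    MvPolynomial (Unit × ι) k →ₐ[k] MvPolynomial (Fin p × ι) k :=
  aeval fun x ↦ X (0, x.2) ^ p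

lemma powIncl_X (x : Unit × ι) : powIncl k p ι (X x) = X (0, x.2) ^ p := aeval_X _ _

lemma powIncl_homogeneous [DecidableEq ι] (q : MvPolynomial (Unit × ι) k) :
    IsWeightedHomogeneous (mdeg p) (powIncl k p ι q) 0 := by
  refine isWeightedHomogeneous_aeval (w := fun _ ↦ 0) (fun x ↦ ?_)
    (f := q) fun e _ ↦ ?_
  · have h1 := (isWeightedHomogeneous_X k (mdeg p) ((0 : Fin p), x.2)).pow p
    rwa [show p • mdeg p ((0 : Fin p), x.2) = 0 from
      funext fun b ↦ by rw [Pi.smul_apply, nsmul_eq_mul, CharP.cast_eq_zero, zero_mul]; rfl] at h1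
  · rw [Finsupp.weight_apply]
    simp

lemma mem_range_add_tailIdeal [DecidableEq ι] [Fintype ι] {f : MvPolynomial (Fin p × ι) k}
    (hf : IsWeightedHomogeneous (mdeg p) f 0) :
    ∃ q, f - powIncl k p ι q ∈ tailIdeal k (fun _ ↦ 1) := by
  suffices ∃ r ∈ (powIncl k p ι).range, f - r ∈ tailIdeal k (fun _ ↦ 1) by
    obtain ⟨_, ⟨q, rfl⟩, hr⟩ := this
    exact ⟨q, hr⟩
  have key : ∀ e ∈ f.support, ∃ r ∈ (powIncl k p ι).range,
      monomial e (coeff e f) - r ∈ tailIdeal k (fun _ ↦ 1) := fun e he ↦ by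
    by_cases h : ∃ x : Fin p × ι, 1 ≤ x.1.1 ∧ e x ≠ 0
    · obtain ⟨x, hx, hx'⟩ := h
      refine ⟨0, zero_mem _, ?_⟩
      rw [sub_zero, mem_ideal_span_X_image]
      intro e' he'
      rw [Finset.mem_singleton.1 (support_monomial_subset he')]
      exact ⟨x, hx, hx'⟩
    · push Not at h
      refine ⟨_, ?_, by rw [sub_self]; exact zero_mem _⟩
      rw [monomial_eq]
      refine mul_mem ((powIncl k p ι).range.algebraMap_mem _) ?_
      rw [Finsupp.prod_fintype _ _ fun _ ↦ pow_zero _]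
      refine prod_mem fun x _ ↦ ?_
      by_cases hx : 1 ≤ x.1.1
      · rw [h x hx, pow_zero]
        exact one_mem _
      · obtain ⟨i, b⟩ := x
        have hi : i = 0 := Fin.ext (by rw [Fin.val_zero]; simpa using hx)
        subst hi
        have h1 := congrFun (hf (mem_support_iff.1 he)) b
        rw [Finsupp.weight_apply, Finsupp.sum_fintype _ _ fun x ↦ zero_smul ℕ (mdeg p x),
          Finset.sum_apply, Finset.sum_eq_single ((0 : Fin p), b)] at h1
        · rw [Pi.smul_apply, mdeg, Pi.single_eq_same, nsmul_eq_mul, mul_one, Pi.zero_apply,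
            ZMod.natCast_eq_zero_iff] at h1
          obtain ⟨t, ht⟩ := h1
          refine ⟨X ((), b) ^ t, ?_⟩
          rw [ht, pow_mul]
          exact (map_pow _ _ _).trans (congrArg (· ^ t) (powIncl_X _))
        · rintro ⟨j, c⟩ _ hne
          by_cases hj : 1 ≤ j.1
          · rw [h _ hj, zero_smul]
            rfl
          · have hj : j = 0 := Fin.ext (by rw [Fin.val_zero]; omega)
            subst hj
            have hc : b ≠ c := fun h ↦ hne (by rw [h])
            rw [Pi.smul_apply, mdeg, Pi.single_eq_of_ne hc, smul_zero]
        · intro h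
          exact absurd (Finset.mem_univ _) h
  choose! r hr hr' using key
  refine ⟨∑ e ∈ f.support, r e, sum_mem hr, ?_⟩
  rw [show f - ∑ e ∈ f.support, r e = ∑ e ∈ f.support, (monomial e (coeff e f) - r e) by
    rw [Finset.sum_sub_distrib, ← f.as_sum]]
  exact sum_mem hr'

variable [CharP k p]

lemma shiftD_powIncl (q : MvPolynomial (Unit × ι) k) :
    shiftD k p ι (powIncl k p ι q) = 0 := by
  induction q using MvPolynomial.induction_on with
  | C c =>
    rw [powIncl, algHom_C]
    exact Derivation.map_algebraMap _ _
  | add f g hf hg => rw [map_add, map_add, hf, hg, add_zero]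
  | mul_X f x hf =>
    rw [map_mul, Derivation.leibniz, hf, powIncl_X, Derivation.leibniz_pow, smul_zero, add_zero,
      ← Nat.cast_smul_eq_nsmul k, CharP.cast_eq_zero, zero_smul, smul_zero]

lemma IsShiftPair.powIncl {A B : Module.End k (MvPolynomial (Fin p × ι) k)}
    (h : IsShiftPair A B) (q : MvPolynomial (Unit × ι) k) : A (powIncl k p ι q) = 0 := by
  obtain ⟨rfl, rfl⟩ | ⟨rfl, rfl⟩ := h
  · exact shiftD_powIncl q
  · obtain ⟨t, ht⟩ : ∃ t, p - 1 = t + 1 := ⟨p - 2, by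
      have := (Fact.out : p.Prime).two_le
      omega⟩
    rw [ht, pow_succ, Module.End.mul_apply]
    exact (congrArg _ (shiftD_powIncl q)).trans (map_zero _)

variable [DecidableEq ι]

/-- Exactness modulo a tail ideal in multidegree zero, up to `p`-th powers. -/
def ExPow (A B : Module.End k (MvPolynomial (Fin p × ι) k)) (s : ι → ℕ) : Prop :=
  ∀ f, IsWeightedHomogeneous (mdeg p) f 0 → A f ∈ tailIdeal k s →
    ∃ g q, IsWeightedHomogeneous (mdeg p) g 0 ∧ f - B g - powIncl k p ι q ∈ tailIdeal k s

variable {A B : Module.End k (MvPolynomial (Fin p × ι) k)}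

lemma ExPow.ascend (h : IsShiftPair A B) {s : ι → ℕ} {a : ι} (hs : s a < p) (hs' : s a ≠ 0)
    (h1 : ExPow A B s) : ExPow A B (Function.update s a (s a + 1)) := by
  intro f hf hf'
  have hp := (Fact.out : p.Prime).one_lt
  have : Fact (1 < p) := ⟨hp⟩
  obtain ⟨g, q, hg, hq⟩ := h1 f hf (tailIdeal_update_le s a hf')
  obtain ⟨g', h2, h3⟩ := exists_X_mul_sub hs (isWeightedHomogeneous_sub
    (isWeightedHomogeneous_sub hf (h.symm.adm.deg _ _ hg)) (powIncl_homogeneous q)) hq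
  have h4 : A g' ∈ tailIdeal k (Function.update s a (s a + 1)) := by
    refine h.adm.mem_of_X_mul hs ?_
    have h5 := sub_mem hf' (h.adm.stable _ _ h3)
    rwa [map_sub, map_sub, map_sub, ← Module.End.mul_apply, h.mul_eq_zero, h.powIncl,
      LinearMap.zero_apply, sub_zero, sub_zero, sub_sub_cancel] at h5
  obtain ⟨g'', h5, h6⟩ := h.ex_of_lt (a := a)
    (s := Function.update s a (s a + 1)) (n := 0 - Pi.single a 1)
    (by rw [Function.update_self]; omega) (by
      rw [Function.update_self, Pi.sub_apply, Pi.single_eq_same, Pi.zero_apply, zero_sub,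
        ZMod.neg_val, if_neg one_ne_zero, ZMod.val_one]
      omega) g' h2 h4
  refine ⟨g + X (⟨s a, hs⟩, a) * g'', q, ?_, ?_⟩
  · exact IsWeightedHomogeneous.add hg (X_mul_homogeneous _ h5)
  · have h7 := sub_mem (add_mem h3 (Ideal.mul_mem_left _ (X (⟨s a, hs⟩, a)) h6))
      (h.symm.adm.comm s a hs g'')
    rw [map_add]
    convert h7 using 1
    ring

variable [Fintype ι]

lemma IsShiftPair.exPow (h : IsShiftPair A B) {s : ι → ℕ} (hs : ∀ a, 1 ≤ s a ∧ s a ≤ p) :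
    ExPow A B s := by
  obtain ⟨n, hn⟩ : ∃ n, ∑ a, s a = n := ⟨_, rfl⟩
  induction n generalizing s with
  | zero =>
    intro f hf _
    have hs1 : s = fun _ ↦ 1 := funext fun a ↦ by
      have h1 := Finset.sum_eq_zero_iff.1 hn a (Finset.mem_univ a)
      have h2 := (hs a).1
      omega
    obtain ⟨q, hq⟩ := mem_range_add_tailIdeal hf
    refine ⟨0, q, isWeightedHomogeneous_zero _ _ _, ?_⟩
    rwa [map_zero, sub_zero, hs1]
  | succ n ih =>
    by_cases h1 : ∀ a, s a = 1
    · intro f hf _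
      obtain ⟨q, hq⟩ := mem_range_add_tailIdeal hf
      refine ⟨0, q, isWeightedHomogeneous_zero _ _ _, ?_⟩
      rwa [map_zero, sub_zero, show s = fun _ ↦ 1 from funext h1]
    · push Not at h1
      obtain ⟨a, ha⟩ := h1
      have h2 := hs a
      have h3 := ExPow.ascend (s := Function.update s a (s a - 1)) (a := a) h
        (by rw [Function.update_self]; omega) (by rw [Function.update_self]; omega) (ih ?_ ?_)
      · rwa [Function.update_self, Function.update_idem, Nat.sub_add_cancel h2.1,
          Function.update_eq_self] at h3
      · intro b
        by_cases hb : b = a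
        · rw [hb, Function.update_self]
          omega
        · rw [Function.update_of_ne hb]
          exact hs b
      · have h4 := Finset.sum_update_of_mem (Finset.mem_univ a) s (s a - 1)
        have h5 := Finset.sum_update_of_mem (Finset.mem_univ a) s (s a)
        rw [Function.update_eq_self] at h5
        omega

/-- The periodic complex is exact up to `p`-th powers of the first variables. -/
theorem IsShiftPair.exact (h : IsShiftPair A B) {f : MvPolynomial (Fin p × ι) k} (hf : A f = 0) :
    ∃ g q, f = B g + DjamentTouze.powIncl k p ι q := by
  have h1 : ∀ m, ∃ g q, weightedHomogeneousComponent (mdeg p) m f =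
      B g + DjamentTouze.powIncl k p ι q := fun m ↦ by
    have h2 := weightedHomogeneousComponent_isWeightedHomogeneous (w := mdeg p) m f
    have h3 : A (weightedHomogeneousComponent (mdeg p) m f) ∈ tailIdeal k (fun _ : ι ↦ p) := by
      rw [← component_comm (h := id) A Function.injective_id h.adm.deg, hf, map_zero]
      exact zero_mem _
    have h4 : ∀ g ∈ tailIdeal k (p := p) (fun _ : ι ↦ p), g = 0 := fun g hg ↦ by
      have h5 : {x : Fin p × ι | p ≤ x.1.1} = ∅ :=
        Set.eq_empty_of_forall_notMem fun x hx ↦ absurd x.1.2 (not_lt.2 hx)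
      have h6 : g ∈ varIdeal k {x : Fin p × ι | p ≤ x.1.1} := hg
      rw [h5, varIdeal, Set.image_empty, Ideal.span_empty] at h6
      exact h6
    by_cases hm : m = 0
    · subst hm
      have hp := (Fact.out : p.Prime).one_le
      obtain ⟨g, q, _, hq⟩ := h.exPow (fun _ ↦ ⟨hp, le_rfl⟩) _ h2 h3
      exact ⟨g, q, by rw [← sub_eq_zero, ← sub_sub]; exact h4 _ hq⟩
    · obtain ⟨a, ha⟩ := Function.ne_iff.1 hm
      obtain ⟨g, _, hg⟩ := h.ex_of_eq rfl ha _ h2 h3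
      exact ⟨g, 0, by rw [map_zero, add_zero, ← sub_eq_zero]; exact h4 _ hg⟩
  choose g q hgq using h1
  have h2 := weightedHomogeneousComponent_finsupp (w := mdeg p) f
  refine ⟨∑ m ∈ h2.toFinset, g m, ∑ m ∈ h2.toFinset, q m, ?_⟩
  rw [map_sum, map_sum, ← Finset.sum_add_distrib, ← Finset.sum_congr rfl fun m _ ↦ hgq m,
    ← finsum_eq_sum _ h2, sum_weightedHomogeneousComponent]

end ShiftComplex

section Resolution

variable (R : Type*) [CommRing R] {C : Type*} [Category C] [Abelian C] [Linear R C]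
  [HasExt.{w} C] (X : C)

variable {T U : ℕ → C} (f : ∀ i, T i ⟶ U i) (g : ∀ i, U i ⟶ T (i + 1))
  (hfg : ∀ i, f i ≫ g i = 0) (hS : ∀ i, (ShortComplex.mk (f i) (g i) (hfg i)).ShortExact)
  {N : ℕ} {P : ℕ → ℕ → Prop}
  (hP0 : ∀ s i, s ≤ N → ¬ P s i → Subsingleton (Ext X (U i) s))

include hS hP0

lemma subsingleton_ext_cocycles (s i : ℕ) (hs : s ≤ N)
    (h : ∀ r j, r ≤ s → r + j = s + i → ¬ P r j) : Subsingleton (Ext X (T i) s) := by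
  induction s generalizing i with
  | zero => exact subsingleton_ext_left_zero (hS i) (hP0 0 i hs (h 0 i le_rfl rfl))
  | succ s ih =>
    exact subsingleton_ext_left_succ (hS i)
      (ih (i + 1) (by omega) fun r j hr hrj ↦ h r j (by omega) (by omega))
      (hP0 (s + 1) i hs (h (s + 1) i le_rfl rfl))

/-- Ext groups with values in the cocycles of an exact complex each of whose terms has sparse
Ext groups. -/
lemma ext_cocycles {W : Type*} [AddCommGroup W] [Module R W]
    (hP1 : ∀ s i, s ≤ N → P s i → Nonempty (Ext X (U i) s ≃ₗ[R] W))
    (hPe : ∀ s i, P s i → Even (s + i))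
    (hPu : ∀ s i s' i', P s i → P s' i' → s + i = s' + i' → s = s')
    (s i : ℕ) (hs : s ≤ N) (h : ∃ r j, r ≤ s ∧ r + j = s + i ∧ P r j) :
    Nonempty (Ext X (T i) s ≃ₗ[R] W) := by
  have hP2 : ∀ s i, Odd (s + i) → ∀ r j, r ≤ s → r + j = s + i → ¬ P r j :=
    fun s i h r j _ hrj hr ↦ Nat.not_even_iff_odd.2 h (hrj ▸ hPe r j hr)
  induction s generalizing i with
  | zero =>
    obtain ⟨r, j, hr, hrj, hp⟩ := h
    obtain rfl : r = 0 := by omega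
    obtain rfl : j = i := by omega
    obtain ⟨e⟩ := hP1 0 j hs hp
    refine ⟨(LinearEquiv.ofBijective _ (ext_f_bijective_of_right R (hS j) ?_ ?_)).trans e⟩
    · refine subsingleton_ext_cocycles X f g hfg hS hP0 0 (j + 1) hs (hP2 _ _ ?_)
      have := hPe 0 j hp
      rw [← add_assoc]
      exact this.add_one
    · intro m hm
      omega
  | succ s ih =>
    obtain ⟨r, j, hr, hrj, hp⟩ := h
    have hev : Even (s + 1 + i) := hrj ▸ hPe r j hp
    by_cases hrs : r = s + 1
    · subst hrs
      obtain rfl : j = i := by omega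
      obtain ⟨e⟩ := hP1 (s + 1) j hs hp
      refine ⟨(LinearEquiv.ofBijective _ (ext_f_bijective_of_right R (hS j) ?_ ?_)).trans e⟩
      · refine subsingleton_ext_cocycles X f g hfg hS hP0 _ _ hs (hP2 _ _ ?_)
        rw [← add_assoc]
        exact hev.add_one
      · intro m hm
        obtain rfl : m = s := by omega
        refine subsingleton_ext_cocycles X f g hfg hS hP0 _ _ (by omega) fun r' j' h1 h2 h3 ↦ ?_
        have := hPu _ _ _ _ h3 hp (by omega)
        omega
    · have h1 : Subsingleton (Ext X (U i) s) := hP0 s i (by omega) fun h2 ↦ by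
        have h3 := hPe s i h2
        rw [add_right_comm] at hev
        exact Nat.not_even_iff_odd.2 h3.add_one hev
      have h2 : Subsingleton (Ext X (U i) (s + 1)) := hP0 _ i hs fun h2 ↦
        hrs (hPu _ _ _ _ hp h2 hrj)
      obtain ⟨e⟩ := ih (i + 1) (by omega) ⟨r, j, by omega, by omega, hp⟩
      exact ⟨(LinearEquiv.ofBijective _ (ext_δ_bijective R (hS i) h1 h2)).symm.trans e⟩

end Resolution

section Cocycles

variable {C : Type*} [Category C] [Abelian C] {Y : ℕ → C} (D : ∀ i, Y i ⟶ Y (i + 1))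
  (hD : ∀ i, D i ≫ D (i + 1) = 0)

/-- The corestriction of a differential to the cocycles. -/
noncomputable abbrev toCocycles (i : ℕ) : Y i ⟶ Limits.kernel (D (i + 1)) :=
  Limits.kernel.lift (D (i + 1)) (D i) (hD i)

lemma ι_toCocycles (i : ℕ) : Limits.kernel.ι (D i) ≫ toCocycles D hD i = 0 := by
  rw [← cancel_mono (Limits.kernel.ι (D (i + 1)))]
  simp

lemma shortExact_cocycles (i : ℕ) [Epi (toCocycles D hD i)] :
    (ShortComplex.mk (Limits.kernel.ι (D i)) (toCocycles D hD i)
      (ι_toCocycles D hD i)).ShortExact where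
  exact := ShortComplex.exact_of_f_is_kernel _
    (Limits.isKernelOfComp (Limits.kernel.ι (D (i + 1))) (D i) (Limits.kernelIsKernel (D i))
      (ι_toCocycles D hD i) (by simp))
  mono_f := by dsimp; infer_instance
  epi_g := by assumption

end Cocycles

section Complex

open MvPolynomial

lemma component_eq_zero {α β M M' R : Type*} [AddCommMonoid M] [AddCommMonoid M'] [CommRing R]
    {w : α → M} {w' : β → M'}
    (θ : MvPolynomial α R →ₗ[R] MvPolynomial β R) {h : M → M'}
    (hθ : ∀ f m, IsWeightedHomogeneous w f m → IsWeightedHomogeneous w' (θ f) (h m))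
    (f : MvPolynomial α R) {m : M'} (hm : ∀ m', h m' ≠ m) :
    weightedHomogeneousComponent w' m (θ f) = 0 := by
  classical
  induction f using MvPolynomial.induction_on' with
  | monomial e a =>
    rw [weightedHomogeneousComponent_of_mem (hθ _ _ (isWeightedHomogeneous_monomial w e a rfl)),
      if_neg (hm _).symm]
  | add f g hf hg => rw [map_add, map_add, hf, hg, add_zero]

variable {k : Type u} [Field k] {p : ℕ} [Fact p.Prime] [CharP k p]

lemma shiftD_lin {V : FV p} (i : Fin p) (v : V) :
    shiftD k p (Fin (Module.finrank (ZMod p) V)) (lin k i v) =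
      if h : i.1 + 1 < p then lin k ⟨i.1 + 1, h⟩ v else 0 := by
  change shiftD k p _ (∑ a, C (ZMod.castHom (dvd_refl p) k ((bas V).repr v a)) * X (i, a)) = _
  simp only [map_sum, Derivation.leibniz, derivation_C, mul_zero, add_zero, shiftD_X,
    smul_eq_mul]
  split_ifs
  · rfl
  · simp

lemma shiftD_pmap {V U : FV p} (g : V ⟶ U) (f : Pol k (Fin p) V) :
    shiftD k p _ (pmap k (fun _ ↦ g) f) = pmap k (fun _ ↦ g) (shiftD k p _ f) := by
  induction f using MvPolynomial.induction_on with
  | C c =>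
    rw [algHom_C, derivation_C, map_zero]
    exact Derivation.map_algebraMap _ _
  | add f g hf hg => rw [map_add, map_add, hf, hg, map_add, map_add]
  | mul_X f x hf =>
    have h1 : shiftD k p _ (pmap k (fun _ ↦ g) (X x)) =
        pmap k (fun _ ↦ g) (shiftD k p _ (X x)) := by
      rw [← lin_bas (k := k) x.1 x.2, pmap_lin, shiftD_lin, shiftD_lin]
      split_ifs
      · rw [pmap_lin]
      · rw [map_zero]
    rw [map_mul, Derivation.leibniz, hf, h1, Derivation.leibniz, map_add, smul_eq_mul,
      smul_eq_mul, smul_eq_mul, smul_eq_mul, map_mul, map_mul]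

/-- The powers of the shift derivation. -/
noncomputable abbrev shiftE (k : Type u) [Field k] {p : ℕ} [Fact p.Prime] (V : FV p) (n : ℕ) :
    Pol k (Fin p) V →ₗ[k] Pol k (Fin p) V :=
  (shiftD k p (Fin (Module.finrank (ZMod p) V)) : Module.End k (Pol k (Fin p) V)) ^ n

lemma shiftD_pow_pmap {V U : FV p} (n : ℕ) (g : V ⟶ U) (f : Pol k (Fin p) V) :
    shiftE k U n (pmap k (fun _ ↦ g) f) = pmap k (fun _ ↦ g) (shiftE k V n f) := by
  induction n with
  | zero => rfl
  | succ n ih =>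
    rw [shiftE, shiftE, pow_succ', pow_succ', Module.End.mul_apply, Module.End.mul_apply, ih]
    exact shiftD_pmap g _

/-- The degree and the weight. -/
def bw (p : ℕ) (i : Fin p) : ℕ × ℕ := (1, i.1)

/-- Polynomials of given degree and weight in `p` blocks of variables. -/
noncomputable abbrev blk (k : Type u) [Field k] (p : ℕ) [Fact p.Prime] [CharP k p] (n W : ℕ) :
    SubPol k p (Fin p) := gr k p (bw p) (n, W)

omit [CharP k p] in
lemma shiftD_pow_homogeneous {V : FV p} {m : ℕ × ℕ} (j : ℕ) {f : Pol k (Fin p) V}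
    (hf : IsWeightedHomogeneous (fun x ↦ bw p x.1) f m) :
    IsWeightedHomogeneous (fun x ↦ bw p x.1)
      (shiftE k V j f) (m + (0, j)) := by
  induction j with
  | zero => exact hf
  | succ j ih =>
    rw [shiftE, pow_succ', Module.End.mul_apply,
      show m + (0, j + 1) = m + (0, j) + (0, 1) by rw [add_assoc]; rfl]
    refine derivation_homogeneous (shiftD k p _) (fun x ↦ ?_) ih
    rw [shiftD_X]
    split_ifs with h
    · exact isWeightedHomogeneous_X k (fun x : Fin p × Fin (Module.finrank (ZMod p) V) ↦ bw p x.1)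
        (⟨x.1.1 + 1, h⟩, x.2)
    · exact isWeightedHomogeneous_zero _ _ _

/-- The powers of the shift derivation in the periodic complex. -/
def ew (p i : ℕ) : ℕ := if Even i then 1 else p - 1

/-- The weights of the terms of the periodic complex. -/
def cw (p : ℕ) : ℕ → ℕ
  | 0 => 0
  | i + 1 => cw p i + ew p i

omit [Fact p.Prime] [CharP k p] in
lemma isShiftPair_ew (i : ℕ) {ι : Type*} :
    IsShiftPair ((shiftD k p ι : Module.End k (MvPolynomial (Fin p × ι) k)) ^ ew p i)
      ((shiftD k p ι : Module.End k (MvPolynomial (Fin p × ι) k)) ^ ew p (i + 1)) := by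
  by_cases h : Even i
  · have h' : ¬ Even (i + 1) := Nat.not_even_iff_odd.2 h.add_one
    exact Or.inl ⟨by rw [ew, if_pos h, pow_one], by rw [ew, if_neg h']⟩
  · have h' : Even (i + 1) := (Nat.not_even_iff_odd.1 h).add_one
    exact Or.inr ⟨by rw [ew, if_neg h], by rw [ew, if_pos h', pow_one]⟩

/-- The differentials of the periodic complex. -/
noncomputable def diff (k : Type u) [Field k] (p : ℕ) [Fact p.Prime] [CharP k p] (n i : ℕ) :
    (blk k p n (cw p i)).fn ⟶ (blk k p n (cw p (i + 1))).fn :=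
  SubPol.hom _ _ (fun V ↦ shiftE k V (ew p i))
    (fun g f _ ↦ shiftD_pow_pmap (ew p i) g f)
    (fun _ _ hf ↦ shiftD_pow_homogeneous (m := (n, cw p i)) (ew p i) hf)

lemma diff_diff (n i : ℕ) : diff k p n i ≫ diff k p n (i + 1) = 0 := by
  refine fun_hom_ext fun V ↦ ?_
  refine fun f : (blk k p n (cw p i)).N V ↦ Subtype.ext ?_
  have h1 := (isShiftPair_ew (k := k) (p := p) i
    (ι := Fin (Module.finrank (ZMod p) V))).symm.mul_eq_zero
  exact congrArg (fun F : Module.End k (Pol k (Fin p) V) ↦ F f.1) h1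

lemma powIncl_lin {V : FV p} (v : V) :
    powIncl k p (Fin (Module.finrank (ZMod p) V)) (lin k () v) = lin k 0 v ^ p := by
  change powIncl k p _ (∑ a, C (ZMod.castHom (dvd_refl p) k ((bas V).repr v a)) * X ((), a)) =
    (∑ a, C (ZMod.castHom (dvd_refl p) k ((bas V).repr v a)) * X ((0 : Fin p), a) :
      Pol k (Fin p) V) ^ p
  rw [sum_pow_char, map_sum]
  refine Finset.sum_congr rfl fun a _ ↦ ?_
  rw [map_mul, algHom_C, powIncl_X, mul_pow, ← C_pow, ← map_pow, ZMod.pow_card]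
  rfl

lemma powIncl_pmap {V U : FV p} (g : V ⟶ U) (f : Pol k Unit V) :
    powIncl k p _ (pmap k (fun _ ↦ g) f) = pmap k (fun _ ↦ g) (powIncl k p _ f) := by
  refine congrArg (fun F : Pol k Unit V →ₐ[k] Pol k (Fin p) U ↦ F f) (pol_algHom_ext
    (f := (powIncl k p _).comp (pmap k fun _ ↦ g)) (g := (pmap k fun _ ↦ g).comp (powIncl k p _))
    fun i v ↦ ?_)
  rw [AlgHom.comp_apply, AlgHom.comp_apply, pmap_lin, powIncl_lin, powIncl_lin, map_pow, pmap_lin]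

omit [CharP k p] in
lemma powIncl_degree {ι : Type} {m : ℕ} {f : MvPolynomial (Unit × ι) k}
    (hf : IsWeightedHomogeneous (fun _ ↦ (1 : ℕ)) f m) :
    IsWeightedHomogeneous (fun x : Fin p × ι ↦ bw p x.1) (powIncl k p ι f) (p * m, 0) := by
  have h1 := isWeightedHomogeneous_map ((AddMonoidHom.mulLeft p).prod (0 : ℕ →+ ℕ)) hf
  refine isWeightedHomogeneous_aeval (fun x ↦ ?_) h1
  have h2 := (isWeightedHomogeneous_X k (fun x : Fin p × ι ↦ bw p x.1) (0, x.2)).pow p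
  rwa [show p • bw p 0 = (((AddMonoidHom.mulLeft p).prod (0 : ℕ →+ ℕ)) ∘
    (fun _ : Unit × ι ↦ (1 : ℕ))) x from Prod.ext rfl (mul_zero p)] at h2

/-- The coaugmentation of the periodic complex. -/
noncomputable def coaug (k : Type u) [Field k] (p : ℕ) [Fact p.Prime] [CharP k p] (m : ℕ) :
    (sym k p m).fn ⟶ (blk k p (p * m) (cw p 0)).fn :=
  SubPol.hom _ _ (fun V ↦ (powIncl k p (Fin (Module.finrank (ZMod p) V))).toLinearMap)
    (fun g f _ ↦ powIncl_pmap g f) (fun _ _ hf ↦ powIncl_degree hf)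

lemma coaug_diff (m : ℕ) : coaug k p m ≫ diff k p (p * m) 0 = 0 := by
  refine fun_hom_ext fun V ↦ ?_
  exact fun f : (sym k p m).N V ↦ Subtype.ext ((isShiftPair_ew (k := k) (p := p) 0
    (ι := Fin (Module.finrank (ZMod p) V))).powIncl f.1)

omit [CharP k p] in
lemma powIncl_injective (ι : Type) : Function.Injective (powIncl k p ι) := by
  have h1 : powIncl k p ι = (rename fun x : Unit × ι ↦ ((0 : Fin p), x.2)).comp (expand p) :=
    algHom_ext fun x ↦ by
      rw [powIncl_X, AlgHom.comp_apply, expand_X, map_pow, rename_X]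
  rw [h1]
  refine (rename_injective _ ?_).comp (expand_injective (Fact.out : p.Prime).pos)
  rintro ⟨_, a⟩ ⟨_, b⟩ h
  exact Prod.ext rfl (Prod.mk.inj h).2

instance mono_coaug (m : ℕ) : Mono (coaug k p m) :=
  mono_of_injective _ fun V ↦ fun (_ _ : (sym k p m).N V) h ↦
    Subtype.ext (powIncl_injective _ (congrArg Subtype.val h))

lemma ew_pos (i : ℕ) : 0 < ew p i := by
  have := (Fact.out : p.Prime).two_le
  rw [ew]
  split_ifs <;> omega

/-- The homogeneous components in the blocks. -/
noncomputable abbrev bcomp (k : Type u) [Field k] {p : ℕ} [Fact p.Prime] (V : FV p) (m : ℕ × ℕ) :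
    Pol k (Fin p) V →ₗ[k] Pol k (Fin p) V :=
  weightedHomogeneousComponent (fun x : Fin p × Fin (Module.finrank (ZMod p) V) ↦ bw p x.1) m

omit [CharP k p] in
lemma bcomp_shiftE {V : FV p} (j : ℕ) (f : Pol k (Fin p) V) (m : ℕ × ℕ) :
    bcomp k V (m + (0, j)) (shiftE k V j f) = shiftE k V j (bcomp k V m f) :=
  component_comm (shiftE k V j) (h := fun m ↦ m + (0, j)) (add_left_injective _)
    (fun _ _ hf ↦ shiftD_pow_homogeneous j hf) f m

omit [CharP k p] in
lemma bcomp_shiftE_zero {V : FV p} (j : ℕ) (hj : 0 < j) (f : Pol k (Fin p) V) (n : ℕ) :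
    bcomp k V (n, 0) (shiftE k V j f) = 0 :=
  component_eq_zero (shiftE k V j) (h := fun m : ℕ × ℕ ↦ m + (0, j))
    (fun _ _ hf ↦ shiftD_pow_homogeneous j hf) f fun m hm ↦ by
      have h3 : m.2 + j = 0 := congrArg Prod.snd hm
      omega

omit [CharP k p] in
lemma bcomp_powIncl {V : FV p} (q : Pol k Unit V) (m : ℕ) :
    bcomp k V (p * m, 0) (powIncl k p _ q) =
      powIncl k p _ (weightedHomogeneousComponent (fun _ ↦ (1 : ℕ)) m q) :=
  component_comm (powIncl k p (Fin (Module.finrank (ZMod p) V))).toLinearMap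
    (h := fun m ↦ (p * m, 0)) (fun _ _ hab ↦
      Nat.eq_of_mul_eq_mul_left (Fact.out : p.Prime).pos (Prod.mk.inj hab).1)
    (fun _ _ hf ↦ powIncl_degree hf) q m

omit [CharP k p] in
lemma bcomp_powIncl_zero {V : FV p} (q : Pol k Unit V) (n W : ℕ) (hW : 0 < W) :
    bcomp k V (n, W) (powIncl k p _ q) = 0 :=
  component_eq_zero (powIncl k p (Fin (Module.finrank (ZMod p) V))).toLinearMap
    (h := fun m : ℕ ↦ (p * m, 0)) (fun _ _ hf ↦ powIncl_degree hf) q fun _ hm ↦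
      hW.ne (Prod.mk.inj hm).2

lemma shiftE_exact {V : FV p} (i : ℕ) {f : Pol k (Fin p) V} (h : shiftE k V (ew p i) f = 0) :
    ∃ g q, f = shiftE k V (ew p (i + 1)) g + powIncl k p _ q :=
  (isShiftPair_ew (k := k) (p := p) i).exact h

omit [Fact p.Prime] in
lemma ew_add_two (i : ℕ) : ew p (i + 1 + 1) = ew p i := by
  simp [ew, Nat.even_add_one]

lemma diff_exact (n i : ℕ) {V : FV p} {f : Pol k (Fin p) V}
    (hf : f ∈ (blk k p n (cw p (i + 1))).N V) (h : shiftE k V (ew p (i + 1)) f = 0) :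
    ∃ g ∈ (blk k p n (cw p i)).N V, shiftE k V (ew p i) g = f := by
  obtain ⟨g, q, hgq⟩ := shiftE_exact (i + 1) h
  rw [ew_add_two] at hgq
  refine ⟨bcomp k V (n, cw p i) g, weightedHomogeneousComponent_isWeightedHomogeneous _ _, ?_⟩
  have h1 := bcomp_shiftE (ew p i) g (n, cw p i)
  have h2 := bcomp_powIncl_zero q n (cw p (i + 1)) (Nat.lt_add_left _ (ew_pos i))
  have h3 : bcomp k V (n, cw p (i + 1)) f = f :=
    IsWeightedHomogeneous.weightedHomogeneousComponent_same hf
  have h4 := congrArg (bcomp k V (n, cw p (i + 1))) hgq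
  rw [map_add, h2, add_zero, h3] at h4
  exact h1.symm.trans h4.symm

lemma coaug_exact (m : ℕ) {V : FV p} {f : Pol k (Fin p) V}
    (hf : f ∈ (blk k p (p * m) (cw p 0)).N V) (h : shiftE k V (ew p 0) f = 0) :
    ∃ q ∈ (sym k p m).N V, powIncl k p _ q = f := by
  obtain ⟨g, q, hgq⟩ := shiftE_exact 0 h
  refine ⟨weightedHomogeneousComponent (fun _ ↦ 1) m q,
    weightedHomogeneousComponent_isWeightedHomogeneous _ _, ?_⟩
  have h1 := bcomp_powIncl q m
  have h2 := bcomp_shiftE_zero (ew p 1) (ew_pos 1) g (p * m)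
  have h3 : bcomp k V (p * m, 0) f = f :=
    IsWeightedHomogeneous.weightedHomogeneousComponent_same hf
  have h4 := congrArg (bcomp k V (p * m, 0)) hgq
  rw [map_add, h2, zero_add, h3] at h4
  exact h1.symm.trans h4.symm

end Complex

section Cocycles

variable {k : Type u} [Field k] {p : ℕ} [Fact p.Prime] [CharP k p]

omit [CharP k p] in
lemma epi_kernel_lift {F G H : Fun k p} (f : F ⟶ G) (g : G ⟶ H) (hfg : f ≫ g = 0)
    (h : ∀ V (x : G.obj V), g.app V x = 0 → ∃ y, f.app V y = x) :
    Epi (Limits.kernel.lift g f hfg) := by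
  refine epi_of_surjective _ fun V ↦ ?_
  intro z
  obtain ⟨y, hy⟩ := h V ((Limits.kernel.ι g).app V z) (congrArg
    (fun φ : Limits.kernel g ⟶ H ↦ φ.app V z) (Limits.kernel.condition g))
  exact ⟨y, injective_of_mono (Limits.kernel.ι g) V ((congrArg (fun φ : F ⟶ G ↦ φ.app V y)
    (Limits.kernel.lift_ι g f hfg)).trans hy)⟩

instance epi_toCocycles (n i : ℕ) : Epi (toCocycles (diff k p n) (diff_diff n) i) := by
  refine epi_kernel_lift _ _ _ fun V ↦ ?_
  refine fun (x : (blk k p n (cw p (i + 1))).N V) hx ↦ ?_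
  obtain ⟨y, hy, hyx⟩ := diff_exact n i x.2 (congrArg Subtype.val hx)
  exact ⟨(⟨y, hy⟩ : (blk k p n (cw p i)).N V), Subtype.ext hyx⟩

instance isIso_lift_coaug (m : ℕ) :
    IsIso (Limits.kernel.lift (diff k p (p * m) 0) (coaug k p m) (coaug_diff m)) := by
  have : Epi (Limits.kernel.lift (diff k p (p * m) 0) (coaug k p m) (coaug_diff m)) := by
    refine epi_kernel_lift _ _ _ fun V ↦ ?_
    refine fun (x : (blk k p (p * m) (cw p 0)).N V) hx ↦ ?_
    obtain ⟨y, hy, hyx⟩ := coaug_exact m x.2 (congrArg Subtype.val hx)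
    exact ⟨(⟨y, hy⟩ : (sym k p m).N V), Subtype.ext hyx⟩
  exact isIso_of_mono_of_epi _

end Cocycles

section Multidegree

open MvPolynomial

variable {k : Type u} [Field k] {p : ℕ} [Fact p.Prime] [CharP k p]

lemma pmap_congr {σ M : Type} [AddCommMonoid M] {w : σ → M} {m : M} {V U : FV p}
    (g g' : σ → (V ⟶ U)) {f : Pol k σ V} (hf : IsWeightedHomogeneous (fun x ↦ w x.1) f m)
    (h : ∀ i, g i = g' i ∨ ∃ φ : M →+ ℕ, φ (w i) ≠ 0 ∧ φ m = 0) : pmap k g f = pmap k g' f := by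
  rw [pmap, pmap, plift, plift, aeval_def, aeval_def, eval₂_eq, eval₂_eq]
  refine Finset.sum_congr rfl fun d hd ↦ congrArg _ (Finset.prod_congr rfl fun x hx ↦ ?_)
  rcases h x.1 with h1 | ⟨φ, h1, h2⟩
  · rw [h1]
  · rw [← hf (mem_support_iff.1 hd), ← weight_comp, Finsupp.weight_apply] at h2
    have h3 := Finset.sum_eq_zero_iff.1 h2 x hx
    rcases mul_eq_zero.1 h3 with h4 | h4
    · exact absurd h4 (Finsupp.mem_support_iff.1 hx)
    · exact absurd h4 h1

/-- The weight giving the multidegree. -/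
def mw (p : ℕ) (i : Fin p) : Fin p → ℕ := Pi.single i 1

/-- The degree and the weight of a multidegree. -/
def mtot (p : ℕ) : (Fin p → ℕ) →+ ℕ × ℕ where
  toFun e := (∑ i, e i, ∑ i : Fin p, e i * i.1)
  map_zero' := by simp
  map_add' e e' := by simp [Finset.sum_add_distrib, add_mul]

omit [Fact p.Prime] in
lemma mtot_mw (i : Fin p) : mtot p (mw p i) = bw p i := by
  refine Prod.ext ?_ ?_
  · change ∑ j, (Pi.single i 1 : Fin p → ℕ) j = 1
    simp
  · change ∑ j : Fin p, (Pi.single i 1 : Fin p → ℕ) j * j.1 = i.1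
    rw [Finset.sum_eq_single i (fun j _ hj ↦ by simp [hj]) (by simp)]
    simp

/-- The multidegrees of given degree and weight. -/
def mset (p n W : ℕ) : Finset (Fin p → ℕ) := {e ∈ Finset.Iic fun _ ↦ n | mtot p e = (n, W)}

omit [Fact p.Prime] in
lemma mem_mset {n W : ℕ} {e : Fin p → ℕ} : e ∈ mset p n W ↔ mtot p e = (n, W) := by
  refine ⟨fun h ↦ (Finset.mem_filter.1 h).2, fun h ↦ Finset.mem_filter.2
    ⟨Finset.mem_Iic.2 fun i ↦ ?_, h⟩⟩
  have h1 : ∑ i, e i = n := congrArg Prod.fst h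
  exact h1 ▸ Finset.single_le_sum (fun _ _ ↦ Nat.zero_le _) (Finset.mem_univ i)

/-- The homogeneous components for the multidegree. -/
noncomputable abbrev mcomp (k : Type u) [Field k] {p : ℕ} [Fact p.Prime] (V : FV p)
    (e : Fin p → ℕ) : Pol k (Fin p) V →ₗ[k] Pol k (Fin p) V :=
  weightedHomogeneousComponent (fun x : Fin p × Fin (Module.finrank (ZMod p) V) ↦ mw p x.1) e

omit [CharP k p] in
lemma sum_mcomp {V : FV p} {n W : ℕ} {f : Pol k (Fin p) V}
    (hf : IsWeightedHomogeneous (fun x ↦ bw p x.1) f (n, W)) :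
    ∑ e ∈ mset p n W, mcomp k V e f = f := by
  classical
  ext d
  rw [coeff_sum]
  simp only [mcomp, coeff_weightedHomogeneousComponent]
  rw [Finset.sum_ite_eq]
  split_ifs with h
  · rfl
  · by_contra hd
    apply h
    rw [mem_mset, ← hf (Ne.symm hd), ← weight_comp]
    simp only [mtot_mw]

/-- The projection to a multidegree. -/
noncomputable def mproj (k : Type u) [Field k] (p : ℕ) [Fact p.Prime] [CharP k p] (n W : ℕ)
    (e : Fin p → ℕ) : (blk k p n W).fn ⟶ (gr k p (mw p) e).fn :=
  SubPol.hom _ _ (fun V ↦ mcomp k V e) (fun g f _ ↦ pmap_component (fun _ ↦ g) f e)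
    (fun _ _ _ ↦ weightedHomogeneousComponent_isWeightedHomogeneous _ _)

lemma gr_mw_le {n W : ℕ} {e : Fin p → ℕ} (he : e ∈ mset p n W) (V : FV p)
    {f : Pol k (Fin p) V} (hf : f ∈ (gr k p (mw p) e).N V) : f ∈ (blk k p n W).N V := by
  have h1 := isWeightedHomogeneous_map (mtot p) hf
  rw [mem_mset.1 he, show mtot p ∘ (fun x : Fin p × Fin (Module.finrank (ZMod p) V) ↦ mw p x.1) =
    fun x ↦ bw p x.1 from funext fun x ↦ mtot_mw x.1] at h1
  exact h1

/-- The inclusion of a multidegree. -/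
noncomputable def mincl (k : Type u) [Field k] (p : ℕ) [Fact p.Prime] [CharP k p] {n W : ℕ}
    (e : mset p n W) : (gr k p (mw p) e.1).fn ⟶ (blk k p n W).fn :=
  SubPol.hom _ _ (fun _ ↦ LinearMap.id) (fun _ _ _ ↦ rfl) (fun V _ hf ↦ gr_mw_le e.2 V hf)

lemma sum_mproj_mincl (n W : ℕ) :
    ∑ e ∈ (mset p n W).attach, mproj k p n W e.1 ≫ mincl k p e = 𝟙 _ := by
  refine fun_hom_ext fun V ↦ ?_
  refine fun f : (blk k p n W).N V ↦ Subtype.ext ?_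
  let φ : ((blk k p n W).fn ⟶ (blk k p n W).fn) →+ Pol k (Fin p) V :=
    { toFun := fun g ↦ (show (blk k p n W).N V from g.app V f).1
      map_zero' := rfl
      map_add' := fun _ _ ↦ rfl }
  refine (map_sum φ _ _).trans ?_
  exact (Finset.sum_attach (mset p n W) fun e ↦ mcomp k V e f.1).trans (sum_mcomp f.2)

omit [Fact p.Prime] in
lemma single_mem_mset (n : ℕ) (j : Fin p) : Pi.single j n ∈ mset p n (n * j.1) := by
  refine mem_mset.2 (Prod.ext ?_ ?_)
  · change ∑ i, (Pi.single j n : Fin p → ℕ) i = n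
    simp
  · change ∑ i : Fin p, (Pi.single j n : Fin p → ℕ) i * i.1 = n * j.1
    rw [Finset.sum_eq_single j (fun i _ hi ↦ by simp [hi]) (by simp), Pi.single_eq_same]

omit [Fact p.Prime] in
lemma eq_single_or {n W : ℕ} (hn : n ≠ 0) {e : Fin p → ℕ} (he : e ∈ mset p n W) :
    (∃ j, e = Pi.single j n ∧ W = n * j.1) ∨ ∃ i i', i' ≠ i ∧ e i ≠ 0 ∧ e i' ≠ 0 := by
  have h1 : ∑ i, e i = n := congrArg Prod.fst (mem_mset.1 he)
  have h2 : ∑ i : Fin p, e i * i.1 = W := congrArg Prod.snd (mem_mset.1 he)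
  by_contra! hc
  obtain ⟨i, -, hi⟩ := Finset.exists_ne_zero_of_sum_ne_zero (h1.trans_ne hn)
  have h3 : ∀ i', i' ≠ i → e i' = 0 := fun i' hi' ↦ hc.2 i i' hi' hi
  rw [Finset.sum_eq_single i (fun j _ hj ↦ h3 j hj) (by simp)] at h1
  rw [Finset.sum_eq_single i (fun j _ hj ↦ by rw [h3 j hj, zero_mul]) (by simp)] at h2
  refine hc.1 i (funext fun j ↦ ?_) (by rw [← h2, h1])
  by_cases hj : j = i
  · subst hj
    rw [Pi.single_eq_same, h1]
  · rw [h3 j hj, Pi.single_eq_of_ne hj]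

omit [Fact p.Prime] in
lemma exists_ne_of_ne_single {n W : ℕ} {e : Fin p → ℕ} (he : e ∈ mset p n W) {j : Fin p}
    (hej : e ≠ Pi.single j n) : ∃ i, i ≠ j ∧ e i ≠ 0 := by
  have h1 : ∑ i, e i = n := congrArg Prod.fst (mem_mset.1 he)
  by_contra! hc
  rw [Finset.sum_eq_single j (fun i _ hi ↦ hc i hi) (by simp)] at h1
  refine hej (funext fun i ↦ ?_)
  by_cases hi : i = j
  · subst hi
    rw [Pi.single_eq_same, h1]
  · rw [hc i hi, Pi.single_eq_of_ne hi]

/-- The insertion of the variables into a block. -/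
noncomputable def toBlock (k : Type u) [Field k] [CharP k p] (V : FV p) (j : Fin p) :
    Pol k Unit V →ₐ[k] Pol k (Fin p) V := plift fun _ ↦ lin k j

/-- The projection to a block. -/
noncomputable def ofBlock (k : Type u) [Field k] [CharP k p] (V : FV p) (j : Fin p) :
    Pol k (Fin p) V →ₐ[k] Pol k Unit V := plift fun i ↦ if i = j then lin k () else 0

lemma toBlock_pmap (j : Fin p) {V U : FV p} (g : V ⟶ U) (f : Pol k Unit V) :
    toBlock k U j (pmap k (fun _ ↦ g) f) = pmap k (fun _ ↦ g) (toBlock k V j f) := by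
  refine congrArg (fun F : Pol k Unit V →ₐ[k] Pol k (Fin p) U ↦ F f) (pol_algHom_ext
    (f := (toBlock k U j).comp (pmap k fun _ ↦ g)) (g := (pmap k fun _ ↦ g).comp (toBlock k V j))
    fun i v ↦ ?_)
  rw [AlgHom.comp_apply, AlgHom.comp_apply, pmap_lin, toBlock, toBlock, plift_lin, plift_lin,
    pmap_lin]

lemma ofBlock_pmap (j : Fin p) {V U : FV p} (g : V ⟶ U) (f : Pol k (Fin p) V) :
    ofBlock k U j (pmap k (fun _ ↦ g) f) = pmap k (fun _ ↦ g) (ofBlock k V j f) := by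
  refine congrArg (fun F : Pol k (Fin p) V →ₐ[k] Pol k Unit U ↦ F f) (pol_algHom_ext
    (f := (ofBlock k U j).comp (pmap k fun _ ↦ g)) (g := (pmap k fun _ ↦ g).comp (ofBlock k V j))
    fun i v ↦ ?_)
  rw [AlgHom.comp_apply, AlgHom.comp_apply, pmap_lin, ofBlock, ofBlock, plift_lin, plift_lin]
  split_ifs
  · rw [pmap_lin]
  · rw [AddMonoidHom.zero_apply, AddMonoidHom.zero_apply, map_zero]

lemma ofBlock_toBlock (j : Fin p) {V : FV p} (f : Pol k Unit V) :
    ofBlock k V j (toBlock k V j f) = f := by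
  refine congrArg (fun F : Pol k Unit V →ₐ[k] Pol k Unit V ↦ F f) (pol_algHom_ext
    (f := (ofBlock k V j).comp (toBlock k V j)) (g := AlgHom.id k _) fun i v ↦ ?_)
  rw [AlgHom.comp_apply, toBlock, plift_lin, ofBlock, plift_lin, if_pos rfl]
  rfl

lemma toBlock_ofBlock (j : Fin p) {V : FV p} (f : Pol k (Fin p) V) :
    toBlock k V j (ofBlock k V j f) = pmap k (fun i ↦ if i = j then 𝟙 V else 0) f := by
  refine congrArg (fun F : Pol k (Fin p) V →ₐ[k] Pol k (Fin p) V ↦ F f) (pol_algHom_ext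
    (f := (toBlock k V j).comp (ofBlock k V j))
    (g := pmap k (fun i ↦ if i = j then 𝟙 V else 0)) fun i v ↦ ?_)
  rw [AlgHom.comp_apply, ofBlock, plift_lin, pmap_lin]
  split_ifs with h
  · rw [toBlock, plift_lin, h]
    rfl
  · rw [AddMonoidHom.zero_apply, map_zero]
    exact (map_zero (lin k i)).symm

lemma toBlock_degree (j : Fin p) {V : FV p} {n : ℕ} {f : Pol k Unit V}
    (hf : IsWeightedHomogeneous (fun _ ↦ (1 : ℕ)) f n) :
    IsWeightedHomogeneous (fun x ↦ bw p x.1) (toBlock k V j f) (n, n * j.1) := by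
  have h1 := isWeightedHomogeneous_map
    ((AddMonoidHom.id ℕ).prod (AddMonoidHom.mulRight j.1)) hf
  refine plift_homogeneous (w := fun _ : Unit ↦ (1, 1 * j.1)) (w' := bw p) (fun i v ↦ ?_) h1
  rw [one_mul]
  exact lin_homogeneous (w := bw p) j v

lemma ofBlock_degree (j : Fin p) {V : FV p} {n W : ℕ} {f : Pol k (Fin p) V}
    (hf : IsWeightedHomogeneous (fun x ↦ bw p x.1) f (n, W)) :
    IsWeightedHomogeneous (fun _ ↦ (1 : ℕ)) (ofBlock k V j f) n := by
  have h1 := isWeightedHomogeneous_map (AddMonoidHom.fst ℕ ℕ) hf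
  refine plift_homogeneous (w := fun _ : Fin p ↦ 1) (w' := fun _ : Unit ↦ 1) (fun i v ↦ ?_) h1
  split_ifs
  · exact lin_homogeneous (w := fun _ : Unit ↦ 1) () v
  · exact isWeightedHomogeneous_zero _ _ _

/-- The insertion of the variables into a block. -/
noncomputable def blkIn (k : Type u) [Field k] (p : ℕ) [Fact p.Prime] [CharP k p] (n : ℕ)
    (j : Fin p) : (sym k p n).fn ⟶ (blk k p n (n * j.1)).fn :=
  SubPol.hom _ _ (fun V ↦ (toBlock k V j).toLinearMap) (fun g f _ ↦ toBlock_pmap j g f)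
    (fun _ _ hf ↦ toBlock_degree j hf)

/-- The projection to a block. -/
noncomputable def blkOut (k : Type u) [Field k] (p : ℕ) [Fact p.Prime] [CharP k p] (n W : ℕ)
    (j : Fin p) : (blk k p n W).fn ⟶ (sym k p n).fn :=
  SubPol.hom _ _ (fun V ↦ (ofBlock k V j).toLinearMap) (fun g f _ ↦ ofBlock_pmap j g f)
    (fun _ _ hf ↦ ofBlock_degree j hf)

lemma blkIn_blkOut (n : ℕ) (j : Fin p) :
    blkIn k p n j ≫ blkOut k p n (n * j.1) j = 𝟙 _ := by
  refine fun_hom_ext fun V ↦ ?_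
  exact fun f : (sym k p n).N V ↦ Subtype.ext (ofBlock_toBlock j f.1)

lemma pmap_block {V : FV p} {n : ℕ} (j : Fin p) {f : Pol k (Fin p) V}
    (hf : IsWeightedHomogeneous (fun x ↦ bw p x.1) f (n, n * j.1)) :
    pmap k (fun i ↦ if i = j then 𝟙 V else 0) f = mcomp k V (Pi.single j n) f := by
  have h0 : Pi.single j n ∈ mset p n (n * j.1) := single_mem_mset n j
  have h1 := sum_mcomp (pmap_homogeneous (fun i ↦ if i = j then 𝟙 V else 0) hf)
  rw [← h1, Finset.sum_eq_single _ _ (absurd h0)]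
  · refine (pmap_component (fun i ↦ if i = j then 𝟙 V else 0) f _).trans (Eq.trans ?_ (pmap_id _))
    refine pmap_congr _ _ (weightedHomogeneousComponent_isWeightedHomogeneous _ _) fun i ↦ ?_
    by_cases hi : i = j
    · exact Or.inl (if_pos hi)
    · refine Or.inr ⟨Pi.evalAddMonoidHom (fun _ ↦ ℕ) i, ?_,
        Pi.single_eq_of_ne (M := fun _ ↦ ℕ) hi n⟩
      exact (Pi.single_eq_same (M := fun _ ↦ ℕ) i 1).trans_ne one_ne_zero
  · intro e he hej
    obtain ⟨i, hi, hei⟩ := exists_ne_of_ne_single he hej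
    refine (pmap_component (fun i ↦ if i = j then 𝟙 V else 0) f _).trans ?_
    refine pmap_eq_zero _ (weightedHomogeneousComponent_isWeightedHomogeneous _ _)
      (Pi.evalAddMonoidHom (fun _ ↦ ℕ) i) (fun i' hi' ↦ ?_) hei
    have h3 : i' = j := by
      by_contra h
      exact hi' (if_neg h)
    exact Pi.single_eq_of_ne (h3 ▸ hi) 1

lemma blkOut_blkIn (n : ℕ) (j : Fin p) :
    blkOut k p n (n * j.1) j ≫ blkIn k p n j =
      mproj k p n (n * j.1) (Pi.single j n) ≫ mincl k p ⟨Pi.single j n, single_mem_mset n j⟩ := by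
  refine fun_hom_ext fun V ↦ ?_
  exact fun f : (blk k p n (n * j.1)).N V ↦ Subtype.ext
    ((toBlock_ofBlock j f.1).trans (pmap_block j f.2))

section

variable [HasExt.{w} (Fun k p)] {π : Fun k p} [π.Additive] {I : Type u}

lemma TAcyc.gr_multi {e : Fin p → ℕ} {i i' : Fin p} (h : i' ≠ i) (hi : e i ≠ 0) (hi' : e i' ≠ 0) :
    TAcyc π I (gr k p (mw p) e).fn :=
  TAcyc.gr_mixed (· = i) (Pi.evalAddMonoidHom (fun _ ↦ ℕ) i') (Pi.evalAddMonoidHom (fun _ ↦ ℕ) i)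
    (by rintro _ rfl; exact Pi.single_eq_of_ne h 1) hi'
    (fun x hx ↦ Pi.single_eq_of_ne (Ne.symm hx) 1) hi

lemma TAcyc.blk {n W : ℕ} (hn : n ≠ 0) (hW : ∀ j < p, W ≠ n * j) :
    TAcyc π I (blk k p n W).fn := by
  refine TAcyc.of_sum (mset p n W).attach (fun e ↦ (gr k p (mw p) e.1).fn)
    (fun e ↦ mproj k p n W e.1) (fun e ↦ mincl k p e) (fun e _ ↦ ?_) (sum_mproj_mincl n W)
  rcases eq_single_or hn e.2 with ⟨j, -, hj⟩ | ⟨i, i', h, hi, hi'⟩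
  · exact absurd hj (hW j.1 j.2)
  · exact TAcyc.gr_multi h hi hi'

lemma TIso.blkIn {n : ℕ} (hn : n ≠ 0) (j : Fin p) : TIso π I (blkIn k p n j) := by
  classical
  let e₀ : mset p n (n * j.1) := ⟨Pi.single j n, single_mem_mset n j⟩
  refine TIso.of_sum ((mset p n (n * j.1)).attach.erase e₀) (DjamentTouze.blkIn k p n j)
    (blkOut k p n (n * j.1) j) (blkIn_blkOut n j) (fun e ↦ (gr k p (mw p) e.1).fn)
    (fun e ↦ mproj k p n (n * j.1) e.1) (fun e ↦ mincl k p e) (fun e he ↦ ?_) ?_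
  · rcases eq_single_or hn e.2 with ⟨j', h1, hj⟩ | ⟨i, i', h, hi, hi'⟩
    · refine absurd (Subtype.ext (h1.trans ?_)) (Finset.ne_of_mem_erase he)
      exact congrArg (fun i : Fin p ↦ (Pi.single i n : Fin p → ℕ))
        (Fin.ext (Nat.eq_of_mul_eq_mul_left (Nat.pos_of_ne_zero hn) hj.symm))
    · exact TAcyc.gr_multi h hi hi'
  · rw [blkOut_blkIn]
    exact (Finset.add_sum_erase _ (fun e : mset p n (n * j.1) ↦
      mproj k p n (n * j.1) e.1 ≫ mincl k p e) (Finset.mem_attach _ e₀)).trans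
      (sum_mproj_mincl n (n * j.1))

end

end Multidegree

section Descent

lemma cw_even {p : ℕ} (hp : 2 ≤ p) (l : ℕ) : cw p (2 * l) = p * l := by
  induction l with
  | zero => rfl
  | succ l ih =>
    rw [show 2 * (l + 1) = 2 * l + 1 + 1 by ring, cw, cw, ih, ew, ew, if_pos (even_two_mul l),
      if_neg (by simp), mul_add, mul_one]
    omega

lemma cw_odd {p : ℕ} (hp : 2 ≤ p) (l : ℕ) : cw p (2 * l + 1) = p * l + 1 := by
  rw [cw, cw_even hp, ew, if_pos (even_two_mul l)]

lemma cw_eq_iff {p : ℕ} (hp : 2 ≤ p) {m i j : ℕ} : cw p i = p * m * j ↔ i = 2 * (m * j) := by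
  constructor
  · intro h
    rcases Nat.even_or_odd' i with ⟨l, rfl | rfl⟩
    · rw [cw_even hp, mul_assoc] at h
      rw [Nat.eq_of_mul_eq_mul_left (by omega) h]
    · rw [cw_odd hp, mul_assoc] at h
      have h1 : p ∣ p * l + 1 := ⟨_, h⟩
      have h2 := Nat.le_of_dvd one_pos ((Nat.dvd_add_right (dvd_mul_right p l)).1 h1)
      omega
  · rintro rfl
    rw [cw_even hp, mul_assoc]

/-- The total degrees where the second page does not vanish. -/
def IsAlive (p m s i : ℕ) : Prop := (∃ j < p, i = 2 * (m * j)) ∧ 2 * (p * m) ∣ s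

lemma IsAlive.even {p m s i : ℕ} (h : IsAlive p m s i) : Even (s + i) := by
  obtain ⟨⟨j, -, rfl⟩, q, rfl⟩ := h
  exact ⟨p * m * q + m * j, by ring⟩

lemma IsAlive.unique {p m : ℕ} (hm : m ≠ 0) {s i s' i' : ℕ} (h : IsAlive p m s i)
    (h' : IsAlive p m s' i') (hs : s + i = s' + i') : s = s' := by
  obtain ⟨⟨j, hj, rfl⟩, q, rfl⟩ := h
  obtain ⟨⟨j', hj', rfl⟩, q', rfl⟩ := h'
  have h1 : 2 * m * (j + p * q) = 2 * m * (j' + p * q') := by linarith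
  have h2 := Nat.eq_of_mul_eq_mul_left (by omega) h1
  have h3 := congrArg (· / p) h2
  simp only [Nat.add_mul_div_left _ _ (j.zero_le.trans_lt hj), Nat.div_eq_of_lt hj,
    Nat.div_eq_of_lt hj', zero_add] at h3
  rw [h3]

lemma exists_isAlive_iff {p m s : ℕ} (hp : 0 < p) :
    (∃ r j, r ≤ s ∧ r + j = s + 0 ∧ IsAlive p m r j) ↔ 2 * m ∣ s := by
  constructor
  · rintro ⟨_, _, -, hs, ⟨j, -, rfl⟩, q, rfl⟩
    exact ⟨p * q + j, by linarith⟩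
  · rintro ⟨t, rfl⟩
    have h : 2 * (p * m) * (t / p) + 2 * (m * (t % p)) = 2 * m * t := by
      conv_rhs => rw [← Nat.div_add_mod t p]
      ring
    exact ⟨_, _, by omega, by omega, ⟨t % p, Nat.mod_lt _ hp, rfl⟩, t / p, rfl⟩

variable {k : Type u} [Field k] {p : ℕ} [Fact p.Prime] [CharP k p]
  [HasExt.{w} (Fun k p)]

/-- The expected extension groups with values in the symmetric power of degree `n`. -/
def SymExt (π : Fun k p) (I : Type u) (W : Type*) [AddCommGroup W] [Module k W] (N n : ℕ) : Prop :=
  ∀ s ≤ N, (2 * n ∣ s → Nonempty (Ext π (tw I (sym k p n).fn) s ≃ₗ[k] W)) ∧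
    (¬ 2 * n ∣ s → Subsingleton (Ext π (tw I (sym k p n).fn) s))

variable {π : Fun k p} [π.Additive] {I : Type u} {W : Type*} [AddCommGroup W] [Module k W]
  {N m : ℕ}

lemma SymExt.ext_blk (h : SymExt π I W N (p * m)) (hm : m ≠ 0) {s i : ℕ} (hs : s ≤ N)
    (ha : IsAlive p m s i) :
    Nonempty (Ext π (tw I (blk k p (p * m) (cw p i)).fn) s ≃ₗ[k] W) := by
  have hp := (Fact.out : p.Prime)
  obtain ⟨⟨j, hj, hi⟩, hd⟩ := ha
  rw [(cw_eq_iff hp.two_le).2 hi]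
  obtain ⟨e⟩ := (h s hs).1 hd
  exact ⟨(ExtIso.equiv k (TIso.blkIn (π := π) (I := I) (mul_ne_zero hp.ne_zero hm)
    (⟨j, hj⟩ : Fin p)) s).symm.trans e⟩

lemma SymExt.subsingleton_ext_blk (h : SymExt π I W N (p * m)) (hm : m ≠ 0) {s i : ℕ} (hs : s ≤ N)
    (ha : ¬ IsAlive p m s i) :
    Subsingleton (Ext π (tw I (blk k p (p * m) (cw p i)).fn) s) := by
  have hp := (Fact.out : p.Prime)
  by_cases hi : ∃ j < p, i = 2 * (m * j)
  · have hd : ¬ 2 * (p * m) ∣ s := fun hd ↦ ha ⟨hi, hd⟩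
    obtain ⟨j, hj, hi⟩ := hi
    rw [(cw_eq_iff hp.two_le).2 hi]
    have := (h s hs).2 hd
    exact (ExtIso.equiv k (TIso.blkIn (π := π) (I := I) (mul_ne_zero hp.ne_zero hm)
      (⟨j, hj⟩ : Fin p)) s).symm.toEquiv.subsingleton
  · exact TAcyc.blk (mul_ne_zero hp.ne_zero hm)
      (fun j hj h1 ↦ hi ⟨j, hj, (cw_eq_iff hp.two_le).1 h1⟩) s

omit [HasExt.{w} (Fun k p)] in
lemma twMap_ι_toCocycles (I : Type u) (n i : ℕ) :
    twMap I (Limits.kernel.ι (diff k p n i)) ≫ twMap I (toCocycles (diff k p n) (diff_diff n) i) =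
      0 := by
  rw [twMap_comp, ι_toCocycles, twMap_zero]

omit [HasExt.{w} (Fun k p)] in
lemma shortExact_tw_cocycles (I : Type u) (n i : ℕ) :
    (ShortComplex.mk (twMap I (Limits.kernel.ι (diff k p n i)))
      (twMap I (toCocycles (diff k p n) (diff_diff n) i))
      (twMap_ι_toCocycles I n i)).ShortExact :=
  shortExact_tw I (shortExact_cocycles (diff k p n) (diff_diff n) i)

lemma SymExt.of_mul (h : SymExt π I W N (p * m)) (hm : m ≠ 0) : SymExt π I W N m := by
  have hp := (Fact.out : p.Prime)
  have hco : TIso π I (Limits.kernel.lift (diff k p (p * m) 0) (coaug k p m) (coaug_diff m)) :=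
    TIso.of_isIso _
  refine fun s hs ↦ ⟨fun hd ↦ ?_, fun hd ↦ ?_⟩
  · obtain ⟨e⟩ := ext_cocycles k π (T := fun i ↦ tw I (Limits.kernel (diff k p (p * m) i)))
      (U := fun i ↦ tw I (blk k p (p * m) (cw p i)).fn) _ _ (twMap_ι_toCocycles I (p * m))
      (shortExact_tw_cocycles I (p * m)) (fun s i hs ↦ h.subsingleton_ext_blk hm hs)
      (fun s i hs ↦ h.ext_blk hm hs) (fun _ _ ↦ IsAlive.even)
      (fun _ _ _ _ ↦ IsAlive.unique hm) s 0 hs ((exists_isAlive_iff hp.pos).2 hd)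
    exact ⟨(ExtIso.equiv k hco s).trans e⟩
  · have := subsingleton_ext_cocycles π (T := fun i ↦ tw I (Limits.kernel (diff k p (p * m) i)))
      (U := fun i ↦ tw I (blk k p (p * m) (cw p i)).fn) _ _ (twMap_ι_toCocycles I (p * m))
      (shortExact_tw_cocycles I (p * m)) (fun s i hs ↦ h.subsingleton_ext_blk hm hs) s 0 hs
      (fun r j hr hrj ha ↦ hd ((exists_isAlive_iff hp.pos).1 ⟨r, j, hr, hrj, ha⟩))
    exact (ExtIso.equiv k hco s).toEquiv.subsingleton

lemma SymExt.of_pow {h : ℕ} (H : SymExt π I W N (p ^ h)) : SymExt π I W N 1 := by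
  induction h with
  | zero => rwa [pow_zero] at H
  | succ h ih =>
    rw [pow_succ'] at H
    exact ih (H.of_mul (pow_ne_zero _ (Fact.out : p.Prime).ne_zero))

lemma symExt_one (π : Fun k p) [π.Additive] (I : Type u) (N : ℕ) :
    SymExt π I (π.obj (line p) →ₗ[k] (I →₀ k)) N 1 := by
  obtain ⟨h, hh, ⟨e⟩, h0⟩ := exists_ext_sym (k := k) (p := p) π I N
  refine SymExt.of_pow (h := h) fun s hs ↦ ⟨fun hd ↦ ?_, fun hd ↦ h0 s ?_ hs⟩
  · obtain rfl := Nat.eq_zero_of_dvd_of_lt hd (hs.trans_lt hh)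
    exact ⟨e⟩
  · rintro rfl
    exact hd (dvd_zero _)

end Descent

section Additive

variable {k : Type u} [Field k] {p : ℕ} [Fact p.Prime]

/-- The map from the line to `V` given by a vector. -/
noncomputable def ofVec {V : FV p} (v : V) : line p ⟶ V :=
  FGModuleCat.ofHom (LinearMap.toSpanSingleton (ZMod p) V v)

/-- The coordinate forms of the chosen basis. -/
noncomputable def basCoord (V : FV p) (a : Fin (Module.finrank (ZMod p) V)) : V ⟶ line p :=
  FGModuleCat.ofHom (V := V) (W := line p) ((bas V).coord a)

lemma sum_basCoord (V : FV p) : ∑ a, basCoord V a ≫ ofVec (bas V a) = 𝟙 V := by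
  refine FGModuleCat.hom_ext (LinearMap.ext fun v : V ↦ ?_)
  refine Eq.trans ?_ ((bas V).sum_repr v)
  have h : ∀ s : Finset (Fin (Module.finrank (ZMod p) V)),
      (∑ a ∈ s, basCoord V a ≫ ofVec (bas V a)).hom.hom v = ∑ a ∈ s, (bas V).repr v a • bas V a := by
    classical
    intro s
    induction s using Finset.induction_on with
    | empty => rfl
    | insert a s ha ih =>
      rw [Finset.sum_insert ha, Finset.sum_insert ha, ← ih]
      rfl
  exact h _

lemma exists_nsmul_id (e : line p ⟶ line p) : ∃ n : ℕ, e = n • 𝟙 (line p) := by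
  obtain ⟨n, hn⟩ := ZMod.natCast_zmod_surjective (e.hom.hom (1 : ZMod p))
  refine ⟨n, FGModuleCat.hom_ext (LinearMap.ext_ring ?_)⟩
  have h : ∀ m : ℕ, (m • 𝟙 (line p)).hom.hom (1 : ZMod p) = (m : ZMod p) := by
    intro m
    induction m with
    | zero => rw [zero_smul, Nat.cast_zero]; rfl
    | succ m ih => rw [succ_nsmul, Nat.cast_succ, ← ih]; rfl
  exact hn.symm.trans (h n).symm

variable (F G : Fun k p) [F.Additive] [G.Additive]

lemma map_comp_eq_comp_map (φ : F.obj (line p) ⟶ G.obj (line p)) (e : line p ⟶ line p) :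
    F.map e ≫ φ = φ ≫ G.map e := by
  obtain ⟨n, rfl⟩ := exists_nsmul_id e
  rw [Functor.map_nsmul, Functor.map_nsmul, Preadditive.nsmul_comp, Preadditive.comp_nsmul,
    F.map_id, G.map_id, Category.id_comp, Category.comp_id]

/-- The natural transformation between additive functors extending a map on the line. -/
noncomputable def extendLine (φ : F.obj (line p) ⟶ G.obj (line p)) : F ⟶ G where
  app V := ∑ a, F.map (basCoord V a) ≫ φ ≫ G.map (ofVec (bas V a))
  naturality V U g := by
    have h1 : F.map g = ∑ a, F.map (basCoord V a) ≫ F.map (ofVec (bas V a) ≫ g) := by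
      simp only [← F.map_comp, ← F.map_sum, ← Category.assoc, ← Preadditive.sum_comp]
      rw [sum_basCoord, Category.id_comp]
    have h2 : G.map g = ∑ b, G.map (g ≫ basCoord U b) ≫ G.map (ofVec (bas U b)) := by
      simp only [← G.map_comp, ← G.map_sum, Category.assoc, ← Preadditive.comp_sum]
      rw [sum_basCoord, Category.comp_id]
    rw [h1, h2, Preadditive.sum_comp, Preadditive.sum_comp]
    refine Finset.sum_congr rfl fun a _ ↦ ?_
    rw [Preadditive.comp_sum, Preadditive.comp_sum]
    refine Finset.sum_congr rfl fun b _ ↦ ?_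
    have h := map_comp_eq_comp_map F G φ (ofVec (bas V a) ≫ g ≫ basCoord U b)
    simp only [Functor.map_comp, Category.assoc] at h ⊢
    rw [reassoc_of% h]

lemma extendLine_comp {H : Fun k p} [H.Additive] (φ : F.obj (line p) ⟶ G.obj (line p))
    (ψ : G.obj (line p) ⟶ H.obj (line p)) :
    extendLine F G φ ≫ extendLine G H ψ = extendLine F H (φ ≫ ψ) := by
  ext1
  ext1 V
  change (∑ a, F.map (basCoord V a) ≫ φ ≫ G.map (ofVec (bas V a))) ≫ (extendLine G H ψ).app V =
    ∑ a, F.map (basCoord V a) ≫ (φ ≫ ψ) ≫ H.map (ofVec (bas V a))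
  rw [Preadditive.sum_comp]
  refine Finset.sum_congr rfl fun a _ ↦ ?_
  simp only [Category.assoc]
  refine congrArg (fun x ↦ F.map (basCoord V a) ≫ φ ≫ x) ?_
  change G.map _ ≫ (∑ b, G.map (basCoord V b) ≫ ψ ≫ H.map (ofVec (bas V b))) = _
  rw [Preadditive.comp_sum]
  have h := fun b ↦ map_comp_eq_comp_map G H ψ (ofVec (bas V a) ≫ basCoord V b)
  simp only [Functor.map_comp, Category.assoc] at h
  simp only [reassoc_of% h]
  rw [← Preadditive.comp_sum]
  refine congrArg (fun x ↦ ψ ≫ x) ?_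
  simp only [← H.map_comp, ← H.map_sum, ← Preadditive.comp_sum]
  rw [sum_basCoord, Category.comp_id]

lemma extendLine_id : extendLine F F (𝟙 _) = 𝟙 F := by
  ext1
  ext1 V
  change (∑ a, F.map (basCoord V a) ≫ 𝟙 _ ≫ F.map (ofVec (bas V a))) = 𝟙 _
  simp only [Category.id_comp, ← F.map_comp, ← F.map_sum]
  rw [sum_basCoord, F.map_id]

variable {F G} in
/-- Additive functors are determined by their value on the line. -/
noncomputable def additiveIso (φ : F.obj (line p) ≅ G.obj (line p)) : F ≅ G where
  hom := extendLine F G φ.hom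
  inv := extendLine G F φ.inv
  hom_inv_id := by rw [extendLine_comp, φ.hom_inv_id, extendLine_id]
  inv_hom_id := by rw [extendLine_comp, φ.inv_hom_id, extendLine_id]

end Additive

section LinearForms

open MvPolynomial

variable {k : Type u} [Field k] {p : ℕ} [Fact p.Prime] [CharP k p]

lemma sym_one_eq_span (V : FV p) : (sym k p 1).N V = Submodule.span k (Set.range X) :=
  homogeneousSubmodule_one_eq_span_X

lemma pmap_add_of_mem {V U : FV p} (g h : V ⟶ U) {f : Pol k Unit V} (hf : f ∈ (sym k p 1).N V) :
    pmap k (fun _ ↦ g + h) f = pmap k (fun _ ↦ g) f + pmap k (fun _ ↦ h) f := by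
  rw [sym_one_eq_span] at hf
  induction hf using Submodule.span_induction with
  | mem x hx =>
    obtain ⟨i, rfl⟩ := hx
    rw [← lin_bas (k := k) i.1 i.2, pmap_lin, pmap_lin, pmap_lin, ← map_add]
    rfl
  | zero => simp only [map_zero, add_zero]
  | add x y _ _ hx hy => rw [map_add, map_add, map_add, hx, hy]; abel
  | smul c x _ hx => rw [map_smul, map_smul, map_smul, hx, smul_add]

instance (I : Type u) : (tw I (sym k p 1).fn).Additive where
  map_add {V U g h} := by
    have key : (sym k p 1).fn.map (g + h) = (sym k p 1).fn.map g + (sym k p 1).fn.map h := by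
      ext1
      exact LinearMap.ext fun f : (sym k p 1).N V ↦ Subtype.ext (pmap_add_of_mem g h f.2)
    change (sumCopies k I).map _ = (sumCopies k I).map _ + (sumCopies k I).map _
    rw [key]
    ext1
    exact LinearMap.ext fun _ ↦ Finsupp.ext fun _ ↦ rfl

/-- Linear forms on the line form a one-dimensional space. -/
noncomputable def symOneLine : (sym k p 1).N (line p) ≃ₗ[k] k :=
  have hr : Module.finrank (ZMod p) (line p) = 1 := Module.finrank_self (ZMod p)
  have : Subsingleton (Fin (Module.finrank (ZMod p) (line p))) := by rw [hr]; infer_instance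
  (LinearEquiv.ofEq _ _ (sym_one_eq_span (line p))).trans
    ((Module.Basis.span (linearIndependent_X _ k)).repr.trans
      (Finsupp.uniqueLinearEquiv k k ((), Fin.cast hr.symm 0)))

end LinearForms

lemma exists_iso_tw {k : Type u} [Field k] {p : ℕ} [Fact p.Prime] [CharP k p] (ρ : Fun k p)
    [ρ.Additive] : ∃ I : Type u, Nonempty ((I →₀ k) ≃ₗ[k] ρ.obj (line p)) ∧
      Nonempty (tw I (sym k p 1).fn ≅ ρ) := by
  let b := Module.Basis.ofVectorSpace k (ρ.obj (line p))
  refine ⟨_, ⟨b.repr.symm⟩, ⟨additiveIso (LinearEquiv.toModuleIso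
    ((Finsupp.mapRange.linearEquiv symOneLine).trans b.repr.symm))⟩⟩

/-- For a perfect field `k` of characteristic `p > 0` and additive functors
`π, ρ : P_{F_p} → V_k` from finite-dimensional `F_p`-vector spaces to `k`-vector spaces,
`Ext^n_{F(P_{F_p},k)}(π, ρ)` is isomorphic as a `k`-vector space to
`Hom_k(π(F_p), ρ(F_p))` for even `n`, and is zero for odd `n`. -/
theorem ext_additive_functors_over_prime_field
    (k : Type u) [Field k] (p : ℕ) [Fact p.Prime] [CharP k p] [PerfectField k]
    [HasExt.{w} (FGModuleCat (ZMod p) ⥤ ModuleCat.{u} k)]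
    (π ρ : FGModuleCat (ZMod p) ⥤ ModuleCat.{u} k) [π.Additive] [ρ.Additive] (n : ℕ) :
    (Even n → Nonempty (Ext π ρ n ≃ₗ[k]
      ((π.obj (FGModuleCat.of (ZMod p) (ZMod p))) →ₗ[k]
        (ρ.obj (FGModuleCat.of (ZMod p) (ZMod p)))))) ∧
    (Odd n → ∀ x : Ext π ρ n, x = 0) := by
  obtain ⟨I, ⟨e⟩, ⟨i⟩⟩ := exists_iso_tw ρ
  have E := ExtIso.equiv k (ExtIso.of_isIso (X := π) i.hom) n
  obtain ⟨h, h'⟩ := symExt_one (k := k) π I n n le_rfl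
  rw [mul_one] at h h'
  refine ⟨fun hn ↦ ?_, fun hn x ↦ ?_⟩
  · obtain ⟨f⟩ := h hn.two_dvd
    exact ⟨E.symm.trans (f.trans (LinearEquiv.congrRight e))⟩
  · have := h' fun h2 ↦ Nat.not_even_iff_odd.2 hn (even_iff_two_dvd.2 h2)
    exact E.symm.toEquiv.subsingleton.elim x 0

end DjamentTouze
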